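/- arXiv:1004.4933 — 3 statements merged into one kernel-verified Lean document; each statement's English description precedes it below -/
import Mathlib

section
/- Let n and m be positive integers, not both equal to 1, and let Θ be an n×m real matrix. Then, with all quantities interpreted in the extended interval [0,+∞] (conventions: 1/(+∞) = 0 and a/0 = +∞ for a > 0): (i) if α(Θ) ≤ 1, then α(ᵗΘ) ≥ (n−1)/(m−α(Θ)); (ii) if α(Θ) ≥ 1, then α(ᵗΘ) ≥ (n − α(Θ)^{−1})/(m−1). -/
open Filter MeasureTheory
open scoped ENNReal RealInnerProductSpace

noncomputable section

/-- `Θ` is uniformly `ψ`-approximable: for every sufficiently large `t > 0` there exist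
integer vectors `x ≠ 0`, `y` with `|x|_∞ ≤ t` and `|Θx - y|_∞ ≤ ψ t`.
(The norm on `Fin k → ℝ` is the sup-norm.) -/
def UniformlyApprox (n m : ℕ) (Θ : Matrix (Fin n) (Fin m) ℝ) (ψ : ℝ → ℝ) : Prop :=
  ∀ᶠ t : ℝ in atTop, ∃ (x : Fin m → ℤ) (y : Fin n → ℤ), x ≠ 0 ∧
    ‖(fun j => (x j : ℝ))‖ ≤ t ∧
    ‖Θ.mulVec (fun j => (x j : ℝ)) - (fun i => (y i : ℝ))‖ ≤ ψ t

/-- `Θ` is (individually) `ψ`-approximable: there are infinitely many pairs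
`(x, y) ∈ ℤ^m × ℤ^n` with `|Θx - y|_∞ ≤ ψ (|x|_∞)`. -/
def IndivApprox (n m : ℕ) (Θ : Matrix (Fin n) (Fin m) ℝ) (ψ : ℝ → ℝ) : Prop :=
  {p : (Fin m → ℤ) × (Fin n → ℤ) |
    ‖Θ.mulVec (fun j => (p.1 j : ℝ)) - (fun i => (p.2 i : ℝ))‖ ≤
      ψ (‖(fun j => (p.1 j : ℝ))‖)}.Infinite

/-- The uniform Diophantine exponent `α(Θ) ∈ [0, +∞]`. -/
def alphaExp (n m : ℕ) (Θ : Matrix (Fin n) (Fin m) ℝ) : ℝ≥0∞ :=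
  sSup (ENNReal.ofReal '' {γ : ℝ | 0 < γ ∧ UniformlyApprox n m Θ (fun t => t ^ (-γ))})

/-- The individual Diophantine exponent `β(Θ) ∈ [0, +∞]`. -/
def betaExp (n m : ℕ) (Θ : Matrix (Fin n) (Fin m) ℝ) : ℝ≥0∞ :=
  sSup (ENNReal.ofReal '' {γ : ℝ | 0 < γ ∧ IndivApprox n m Θ (fun t => t ^ (-γ))})

/-- `Δ_d = 2^{1-d} d^{-1/2} vol_{d-1} {x ∈ [-1,1]^d : x_1 + ⋯ + x_d = 0}`. -/
def Delta (d : ℕ) : ℝ :=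
  (2:ℝ) ^ (1 - (d:ℤ)) * (Real.sqrt d)⁻¹ *
    (μH[(d:ℝ) - 1] {x : EuclideanSpace ℝ (Fin d) | (∀ i, |x i| ≤ 1) ∧ ∑ i, x i = 0}).toReal

/-- The parallelepiped `M_{h,r} = {(x,y) : |Θx - y|_∞ ≤ h, |x|_∞ ≤ r}`. -/
def Mset (n m : ℕ) (Θ : Matrix (Fin n) (Fin m) ℝ) (h r : ℝ) :
    Set ((Fin m → ℝ) × (Fin n → ℝ)) :=
  {p | ‖Θ.mulVec p.1 - p.2‖ ≤ h ∧ ‖p.1‖ ≤ r}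

/-- The parallelepiped `M̂_{h,r} = {(x,y) : |y|_∞ ≤ h, |ᵗΘ y - x|_∞ ≤ r}`. -/
def MhatSet (n m : ℕ) (Θ : Matrix (Fin n) (Fin m) ℝ) (h r : ℝ) :
    Set ((Fin m → ℝ) × (Fin n → ℝ)) :=
  {p | ‖p.2‖ ≤ h ∧ ‖Θ.transpose.mulVec p.2 - p.1‖ ≤ r}

/-- The section-dual `M^∧` of a set `M ⊆ ℝ^d`. -/
def sectionDual (d : ℕ) (M : Set (EuclideanSpace ℝ (Fin d))) :
    Set (EuclideanSpace ℝ (Fin d)) :=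
  {v | ∃ (e : EuclideanSpace ℝ (Fin d)) (l : ℝ), ‖e‖ = 1 ∧ 0 ≤ l ∧
    l ≤ (2:ℝ) ^ (1 - (d:ℤ)) * (μH[(d:ℝ) - 1] (M ∩ {x | ⟪e, x⟫ = 0})).toReal ∧ v = l • e}

/-- **Minkowski's linear forms theorem.** -/
theorem exists_int_ne_zero_abs_mulVec_le {ι : Type*} [Fintype ι] [DecidableEq ι] [Nonempty ι]
    (G : Matrix ι ι ℝ) (hG : G.det ≠ 0) (c : ι → ℝ) (hc : ∀ i, 0 < c i)
    (h : |G.det| ≤ ∏ i, c i) :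
    ∃ w : ι → ℤ, w ≠ 0 ∧ ∀ i, |G.mulVec (fun j => (w j : ℝ)) i| ≤ c i := by
  set b := Pi.basisFun ℝ ι
  have hdet : LinearMap.det (Matrix.toLin' G) ≠ 0 := by rwa [LinearMap.det_toLin']
  let e : (ι → ℝ) ≃ₗ[ℝ] (ι → ℝ) := LinearMap.equivOfDetNeZero _ hdet
  set box : Set (ι → ℝ) := Set.Icc (fun i => -c i) c
  set s : Set (ι → ℝ) := Matrix.toLin' G ⁻¹' box with hs
  have hmem : ∀ x, x ∈ s ↔ ∀ i, |G.mulVec x i| ≤ c i := by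
    intro x
    simp only [hs, box, Set.mem_preimage, Set.mem_Icc, Pi.le_def, Matrix.toLin'_apply, abs_le,
      forall_and]
  have hcpt : IsCompact s := by
    have h1 : s = e.toContinuousLinearEquiv.toHomeomorph ⁻¹' box := rfl
    rw [h1, Homeomorph.isCompact_preimage]
    exact isCompact_Icc
  have hvol : volume s = ENNReal.ofReal |G.det⁻¹| * ∏ i, ENNReal.ofReal (2 * c i) := by
    rw [hs, Measure.addHaar_preimage_linearMap _ hdet, LinearMap.det_toLin', Real.volume_Icc_pi]
    congr 2
    funext i
    ring_nf
  have fund := ZSpan.isAddFundamentalDomain' b volume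
  have key : volume (ZSpan.fundamentalDomain b) * 2 ^ Module.finrank ℝ (ι → ℝ) ≤ volume s := by
    rw [hvol, ZSpan.fundamentalDomain_pi_basisFun, Real.volume_pi_Ico,
      ← ENNReal.ofReal_prod_of_nonneg (f := fun i => 2 * c i)
        (fun i _ => by have := hc i; positivity),
      ← ENNReal.ofReal_mul (by positivity), Finset.prod_mul_distrib, abs_inv]
    have h2 : (0 : ℝ) < |G.det| := abs_pos.2 hG
    have : (2 : ℝ) ^ Fintype.card ι ≤ |G.det|⁻¹ * ((∏ i : ι, 2) * ∏ i, c i) := by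
      rw [Finset.prod_const, Finset.card_univ, mul_left_comm]
      have : 1 ≤ |G.det|⁻¹ * ∏ i, c i := by
        rw [inv_mul_eq_div, one_le_div h2]; exact h
      nlinarith [pow_pos (two_pos (α := ℝ)) (Fintype.card ι)]
    simpa [ENNReal.ofReal_pow] using ENNReal.ofReal_le_ofReal this
  have : Countable (Submodule.span ℤ (Set.range b)).toAddSubgroup :=
    inferInstanceAs (Countable (Submodule.span ℤ (Set.range b)))
  have : DiscreteTopology (Submodule.span ℤ (Set.range b)).toAddSubgroup :=
    inferInstanceAs (DiscreteTopology (Submodule.span ℤ (Set.range b)))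
  obtain ⟨x, hx0, hxs⟩ := exists_ne_zero_mem_lattice_of_measure_mul_two_pow_le_measure fund
    (fun x hx => by
      rw [hmem] at hx ⊢
      simpa [Matrix.mulVec_neg] using hx)
    ((convex_Icc _ _).linear_preimage _) hcpt key
  have hxm := (b.mem_span_iff_repr_mem ℤ (x : ι → ℝ)).1 x.2
  choose w hw using hxm
  have hwx : (fun j => (w j : ℝ)) = (x : ι → ℝ) := by
    funext j
    simpa [b] using hw j
  refine ⟨w, ?_, ?_⟩
  · rintro rfl
    apply hx0
    ext j
    simpa using (congrFun hwx j).symm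
  · rw [hwx]
    exact (hmem _).1 hxs

/-- A Siegel-type lemma: if the rows `a k` are integral combinations of the rows of a unimodular
matrix `F` and all their weighted maximal minors are small, there is a nonzero integer vector
annihilated by these combinations at which all the forms of `F` are bounded by the weights. -/
theorem exists_int_ne_zero_abs_mulVec_le_of_minors {ι κ : Type*} [Fintype ι] [DecidableEq ι]
    [Nonempty ι] [Fintype κ] [DecidableEq κ] (F : Matrix ι ι ℝ) (hF : |F.det| = 1)
    (ω : ι → ℝ) (hω : ∀ i, 0 < ω i) (a : κ → ι → ℝ)
    (hint : ∀ k, ∃ z : ι → ℤ, Matrix.vecMul (a k) F = fun i => (z i : ℝ))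
    (hne : ∃ s : κ → ι, (Matrix.of fun k l => a k (s l)).det ≠ 0)
    (hsmall : ∀ s : κ → ι, |(Matrix.of fun k l => a k (s l)).det| * ∏ l, ω (s l) ≤
      ((2 * Fintype.card ι : ℝ) ^ Fintype.card ι)⁻¹ * ∏ i, ω i) :
    ∃ w : ι → ℤ, w ≠ 0 ∧ ∀ i, |F.mulVec (fun j => (w j : ℝ)) i| ≤ ω i := by
  set D : (κ → ι) → ℝ := fun s => (Matrix.of fun k l => a k (s l)).det with hD
  obtain ⟨s, hsmax⟩ : ∃ s, ∀ s', |D s'| * ∏ l, ω (s' l) ≤ |D s| * ∏ l, ω (s l) := by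
    obtain ⟨s₀, -⟩ := hne
    have : Nonempty (κ → ι) := ⟨s₀⟩
    exact Finite.exists_max fun s => |D s| * ∏ l, ω (s l)
  have hωs : ∀ s : κ → ι, 0 < ∏ l, ω (s l) := fun s => Finset.prod_pos fun l _ => hω _
  have hDs : D s ≠ 0 := by
    obtain ⟨s₀, h₀⟩ := hne
    intro h
    have h1 := hsmax s₀
    rw [h, abs_zero, zero_mul] at h1
    exact absurd h1 (not_le.2 (mul_pos (abs_pos.2 h₀) (hωs s₀)))
  have hinj : Function.Injective s := by
    intro k l hkl
    by_contra hne
    exact hDs (Matrix.det_zero_of_column_eq hne fun i => by simp [hkl])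
  set d : ℝ := (Fintype.card ι : ℝ) with hd
  have hd1 : 1 ≤ d := by
    rw [hd]; exact_mod_cast Fintype.card_pos
  -- replace the rows of `F` selected by `s` with the given combinations
  let U : Matrix ι κ ℝ := Matrix.of fun i l => if i = s l then 1 else 0
  let V : Matrix κ ι ℝ := Matrix.of fun k i => a k i - if i = s k then 1 else 0
  let E : Matrix ι ι ℝ := 1 + U * V
  have hE : E.det = D s := by
    rw [Matrix.det_one_add_mul_comm]
    congr 1
    ext k l
    simp [U, V, Matrix.mul_apply, Matrix.one_apply, hinj.eq_iff, eq_comm]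
  have hErange : ∀ k i, E (s k) i = a k i := by
    intro k i
    simp [E, U, V, Matrix.mul_apply, Matrix.one_apply, hinj.eq_iff, eq_comm]
  have hEnot : ∀ j, j ∉ Set.range s → ∀ i, E j i = (1 : Matrix ι ι ℝ) j i := by
    intro j hj i
    have : ∀ l, j ≠ s l := fun l h => hj ⟨l, h.symm⟩
    simp [E, U, Matrix.mul_apply, this]
  classical
  let c : ι → ℝ := fun i => if i ∈ Set.range s then 1 / 2 else ω i / d
  have hc : ∀ i, 0 < c i := by
    intro i
    simp only [c]
    split_ifs
    · norm_num
    · exact div_pos (hω i) (by linarith)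
  have hdetle : |(E * F).det| ≤ ∏ i, c i := by
    rw [Matrix.det_mul, abs_mul, hF, mul_one, hE]
    have h1 : ∀ i, (2 * d)⁻¹ * ω i ≤ c i * (if i ∈ Set.range s then ω i else 1) := by
      intro i
      simp only [c]
      split_ifs
      · have := hω i
        have : (2 * d)⁻¹ ≤ 1 / 2 := by
          rw [one_div]; exact inv_anti₀ (by norm_num) (by linarith)
        gcongr
      · rw [mul_one, inv_mul_eq_div]
        have := hω i
        gcongr
        linarith
    have h2 := Finset.prod_le_prod (s := Finset.univ)
      (fun i _ => by have := hω i; positivity) (fun i _ => h1 i)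
    rw [Finset.prod_mul_distrib, Finset.prod_mul_distrib, Finset.prod_const, Finset.card_univ,
      inv_pow, ← Finset.prod_filter] at h2
    have h3 : ∏ i with i ∈ Set.range s, ω i = ∏ l, ω (s l) := by
      rw [← Finset.prod_image (f := ω) (g := s) (s := Finset.univ) (fun _ _ _ _ h => hinj h)]
      congr 1
      ext i
      simp
    rw [h3] at h2
    exact le_of_mul_le_mul_right ((hsmall s).trans h2) (hωs s)
  obtain ⟨w, hw0, hw⟩ := exists_int_ne_zero_abs_mulVec_le (E * F)
    (by rw [Matrix.det_mul, hE]; exact mul_ne_zero hDs (by intro h; simp [h] at hF)) c hc hdetle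
  set f := F.mulVec (fun j => (w j : ℝ)) with hf
  have hEf : ∀ i, ((E * F).mulVec fun j => (w j : ℝ)) i = ∑ j, E i j * f j := by
    intro i
    rw [← Matrix.mulVec_mulVec]
    rfl
  have hout : ∀ j, j ∉ Set.range s → |f j| ≤ ω j / d := by
    intro j hj
    have := hw j
    simp only [hEf, hEnot j hj, c, if_neg hj] at this
    simpa [Matrix.one_apply] using this
  have hzero : ∀ k, ∑ i, a k i * f i = 0 := by
    intro k
    have h1 := hw (s k)
    simp only [hEf, hErange, c, if_pos (Set.mem_range_self k)] at h1
    obtain ⟨z, hz⟩ := hint k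
    have h2 : ∑ i, a k i * f i = ((∑ i, z i * w i : ℤ) : ℝ) := by
      calc ∑ i, a k i * f i = a k ⬝ᵥ F.mulVec (fun j => (w j : ℝ)) := rfl
        _ = _ := by rw [Matrix.dotProduct_mulVec, hz]; simp [dotProduct]
    rw [h2] at h1 ⊢
    have h3 : |∑ i, z i * w i| < 1 := by
      have : (|∑ i, z i * w i| : ℝ) < 1 := by
        push_cast at h1; linarith
      exact_mod_cast this
    rw [Int.abs_lt_one_iff.1 h3]; simp
  refine ⟨w, hw0, fun i => ?_⟩
  by_cases hi : i ∈ Set.range s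
  swap
  · exact (hout i hi).trans (div_le_self (hω i).le hd1)
  obtain ⟨l, rfl⟩ := hi
  set A : Matrix κ κ ℝ := Matrix.of fun k l => a k (s l) with hA
  have hrel : A.mulVec (fun l => f (s l)) =
      ∑ i with i ∉ Set.range s, (-f i) • (fun k => a k i) := by
    funext k
    have h1 := hzero k
    rw [← Finset.sum_filter_add_sum_filter_not Finset.univ (fun i => i ∈ Set.range s)] at h1
    have h3 : ∑ i with i ∈ Set.range s, a k i * f i = ∑ l, a k (s l) * f (s l) := by
      rw [← Finset.sum_image (f := fun i => a k i * f i) (g := s) (s := Finset.univ)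
        (fun _ _ _ _ h => hinj h)]
      congr 1
      ext i
      simp
    rw [h3] at h1
    simp only [Matrix.mulVec, dotProduct, hA, Matrix.of_apply, Finset.sum_apply, Pi.smul_apply,
      smul_eq_mul, neg_mul, Finset.sum_neg_distrib]
    rw [eq_neg_iff_add_eq_zero, ← h1]
    congr 1
    exact Finset.sum_congr rfl fun _ _ => mul_comm _ _
  have hcram := congrArg (A.cramer · l) hrel
  simp only [Matrix.cramer_eq_adjugate_mulVec, Matrix.mulVec_mulVec, Matrix.adjugate_mul] at hcram
  rw [← Matrix.cramer_eq_adjugate_mulVec, map_sum, Matrix.smul_mulVec, Matrix.one_mulVec] at hcram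
  simp only [map_smul, Finset.sum_apply, Pi.smul_apply, smul_eq_mul, Matrix.cramer_apply] at hcram
  have hupd : ∀ i, (A.updateCol l fun k => a k i).det = D (Function.update s l i) := by
    intro i
    simp only [hD]
    congr 1
    ext k l'
    by_cases h : l' = l
    · subst h; simp
    · simp [h, hA]
  have hterm : ∀ i, |D (Function.update s l i)| * ω i ≤ |D s| * ω (s l) := by
    intro i
    have h1 := hsmax (Function.update s l i)
    rw [← Finset.mul_prod_erase Finset.univ _ (Finset.mem_univ l),
      ← Finset.mul_prod_erase Finset.univ (fun l => ω (s l)) (Finset.mem_univ l)] at h1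
    have h4 : ∏ x ∈ Finset.univ.erase l, ω (Function.update s l i x) =
        ∏ x ∈ Finset.univ.erase l, ω (s x) :=
      Finset.prod_congr rfl fun x hx => by
        rw [Function.update_of_ne (Finset.ne_of_mem_erase hx)]
    rw [h4, Function.update_self, ← mul_assoc, ← mul_assoc] at h1
    exact le_of_mul_le_mul_right h1 (Finset.prod_pos fun x _ => hω _)
  have hDpos : 0 < |D s| := abs_pos.2 hDs
  have : |D s| * |f (s l)| ≤ |D s| * ω (s l) := by
    rw [← abs_mul]
    change |A.det * f (s l)| ≤ _
    rw [hcram]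
    calc _ ≤ ∑ i with i ∉ Set.range s, |-f i * (A.updateCol l fun k => a k i).det| :=
          Finset.abs_sum_le_sum_abs _ _
      _ ≤ ∑ i with i ∉ Set.range s, |D s| * ω (s l) / d := by
          refine Finset.sum_le_sum fun i hi => ?_
          rw [abs_mul, abs_neg, hupd]
          calc |f i| * |D (Function.update s l i)|
              ≤ ω i / d * |D (Function.update s l i)| := by
                have := hout i (Finset.mem_filter.1 hi).2
                gcongr
            _ = |D (Function.update s l i)| * ω i / d := by ring
            _ ≤ _ := by
                have := hterm i
                gcongr
      _ ≤ ∑ i : ι, |D s| * ω (s l) / d := by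
          refine Finset.sum_le_sum_of_subset_of_nonneg (Finset.filter_subset _ _) fun _ _ _ => ?_
          have := hω (s l)
          positivity
      _ = |D s| * ω (s l) := by
          rw [Finset.sum_const, Finset.card_univ, nsmul_eq_mul, ← hd]
          field_simp
  exact le_of_mul_le_mul_left this hDpos

/-- The step to the next minimal point. -/
theorem exists_next_minimal_point {P : Type*} {X : P → ℕ} {L : P → ℝ}
    (hmin : ∀ N, (∃ p, X p ≤ N) → ∃ p, X p ≤ N ∧ ∀ q, X q ≤ N → L p ≤ L q)
    {γ t₀ : ℝ} (hγ : 0 < γ) (hU : ∀ t : ℝ, t₀ ≤ t → ∃ p, (X p : ℝ) ≤ t ∧ L p ≤ t ^ (-γ))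
    {z : P} {N : ℕ} (hN : t₀ < N + 1) (hz : ∀ q, X q ≤ N → L z ≤ L q) (hLz : 0 < L z) :
    ∃ z', N < X z' ∧ L z' < L z ∧ L z ≤ (X z' : ℝ) ^ (-γ) ∧ ∀ q, X q ≤ X z' → L z' ≤ L q := by
  classical
  have hex : ∃ M, ∃ p, X p ≤ M ∧ L p < L z := by
    obtain ⟨t, ht, ht'⟩ := (((tendsto_rpow_neg_atTop hγ).eventually_lt_const hLz).and
      (eventually_ge_atTop t₀)).exists
    obtain ⟨p, -, hp⟩ := hU t ht'
    exact ⟨X p, p, le_rfl, hp.trans_lt ht⟩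
  set N' := Nat.find hex with hN'
  obtain ⟨p, hpX, hpL⟩ := Nat.find_spec hex
  obtain ⟨z', hz'X, hz'min⟩ := hmin N' ⟨p, hpX⟩
  have hlt : L z' < L z := (hz'min p hpX).trans_lt hpL
  have hlow : ∀ q, X q < N' → L z ≤ L q := by
    intro q hq
    by_contra! h
    exact Nat.find_min hex hq ⟨q, le_rfl, h⟩
  have heq : X z' = N' := by
    by_contra h
    exact absurd (hlow z' (lt_of_le_of_ne hz'X h)) (not_le.2 hlt)
  have hNlt : N < X z' := by
    by_contra! h
    exact absurd (hz z' h) (not_le.2 hlt)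
  refine ⟨z', hNlt, hlt, ?_, by rw [heq]; exact hz'min⟩
  have hNr : (N : ℝ) + 1 ≤ X z' := by exact_mod_cast hNlt
  have hpos : (0 : ℝ) < X z' := by exact_mod_cast (Nat.zero_le N).trans_lt hNlt
  have hcont : Tendsto (fun t : ℝ => t ^ (-γ)) (nhdsWithin (X z' : ℝ) (Set.Iio (X z' : ℝ)))
      (nhds ((X z' : ℝ) ^ (-γ))) :=
    (Real.continuousAt_rpow_const _ _ (Or.inl hpos.ne')).tendsto.mono_left nhdsWithin_le_nhds
  refine ge_of_tendsto hcont ?_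
  have h1 : ∀ᶠ t in nhdsWithin (X z' : ℝ) (Set.Iio (X z' : ℝ)), t₀ < t :=
    nhdsWithin_le_nhds (lt_mem_nhds (hN.trans_le hNr))
  filter_upwards [h1, self_mem_nhdsWithin] with t ht ht'
  obtain ⟨q, hqX, hqL⟩ := hU t ht.le
  refine (hlow q ?_).trans hqL
  rw [← heq]
  exact mod_cast (hqX.trans_lt ht')

/-- Among points approximating uniformly with exponent `γ` there is a single point, or a pair of
points, small enough for the dual system to be solvable in the box of sizes `H` and `R`. -/
theorem exists_small_point_or_pair {P : Type*} {X : P → ℕ} {L : P → ℝ} (hL : ∀ p, 0 ≤ L p)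
    (hmin : ∀ N, (∃ p, X p ≤ N) → ∃ p, X p ≤ N ∧ ∀ q, X q ≤ N → L p ≤ L q)
    {γ t₀ : ℝ} (hγ : 0 < γ) (hU : ∀ t : ℝ, t₀ ≤ t → ∃ p, (X p : ℝ) ≤ t ∧ L p ≤ t ^ (-γ))
    {H R W : ℝ} (hH : 0 < H) (hR : 0 < R) (hW : 0 < W) (ht₀ : t₀ ≤ W / R)
    (h1 : H ≤ (W / R) ^ γ) (h2 : R ^ γ ≤ W / H) :
    (∃ p, L p ≤ W / H ∧ X p ≤ W / R) ∨
      ∃ p q, X p < X q ∧ L q < L p ∧ L p * L q ≤ W / H ^ 2 ∧ (X p : ℝ) * X q ≤ W / R ^ 2 ∧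
        L p * X q ≤ W / (H * R) := by
  by_contra! hcon
  obtain ⟨hsingle, hpair⟩ := hcon
  have hA : 0 < W / R := by positivity
  obtain ⟨p₀, hp₀, -⟩ := hU _ ht₀
  obtain ⟨z₀, hz₀X, hz₀⟩ := hmin ⌊W / R⌋₊ ⟨p₀, Nat.le_floor hp₀⟩
  have hz₀X' : (X z₀ : ℝ) ≤ W / R := (Nat.le_floor_iff hA.le).1 hz₀X
  have hz₀L : W / H < L z₀ := by
    by_contra! h
    exact absurd hz₀X' (not_le.2 (hsingle z₀ h))
  obtain ⟨z₁, h01, hL1, hLX1, hz₁⟩ := exists_next_minimal_point hmin hγ hU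
    (ht₀.trans_lt (Nat.lt_floor_add_one _)) hz₀ ((by positivity : 0 < W / H).trans hz₀L)
  have hz₁A : W / R < X z₁ := (Nat.floor_lt hA.le).1 h01
  have hEle : (W / R ^ 2) ^ (-γ) ≤ W / H ^ 2 := by
    have e1 : W / R ^ 2 = (W / R) * R⁻¹ := by field_simp
    rw [e1, Real.mul_rpow hA.le (by positivity), Real.inv_rpow hR.le, Real.rpow_neg hR.le, inv_inv,
      Real.rpow_neg hA.le]
    calc ((W / R) ^ γ)⁻¹ * R ^ γ ≤ H⁻¹ * (W / H) := by gcongr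
      _ = W / H ^ 2 := by field_simp
  -- a consecutive pair beyond `W / R` cannot have both products small
  have hfinal : ∀ w w', X w < X w' → L w' < L w → W / R < X w' → L w ≤ (X w' : ℝ) ^ (-γ) →
      L w * L w' ≤ W / H ^ 2 → (X w : ℝ) * X w' ≤ W / R ^ 2 → False := by
    intro w w' hX hLL hA' hLX hLprod hXprod
    have hX' : (0 : ℝ) < X w' := hA.trans hA'
    rcases le_or_gt (X w' : ℝ) R⁻¹ with hle | hgt
    · refine absurd (hpair w w' hX hLL hLprod hXprod) (not_lt.2 ?_)
      have e1 : L w * X w' ≤ (X w' : ℝ) ^ (1 - γ) := by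
        calc L w * X w' ≤ (X w' : ℝ) ^ (-γ) * X w' := by gcongr
          _ = (X w' : ℝ) ^ (1 - γ) := by
            rw [← Real.rpow_add_one hX'.ne']; ring_nf
      refine e1.trans ?_
      rcases le_total γ 1 with hγ1 | hγ1
      · calc (X w' : ℝ) ^ (1 - γ) ≤ (R⁻¹) ^ (1 - γ) := by
              exact Real.rpow_le_rpow hX'.le hle (by linarith)
          _ = R ^ γ / R := by
            rw [Real.inv_rpow hR.le, ← Real.rpow_neg hR.le, neg_sub, Real.rpow_sub_one hR.ne']
          _ ≤ W / H / R := by gcongr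
          _ = W / (H * R) := by field_simp
      · calc (X w' : ℝ) ^ (1 - γ) ≤ (W / R) ^ (1 - γ) :=
              Real.rpow_le_rpow_of_nonpos hA hA'.le (by linarith)
          _ = W / R / (W / R) ^ γ := by rw [Real.rpow_sub hA, Real.rpow_one]
          _ ≤ W / R / H := by gcongr
          _ = W / (H * R) := by field_simp
    · have e1 : (X w : ℝ) ≤ W / R := by
        have : (X w : ℝ) * R⁻¹ ≤ W / R * R⁻¹ :=
          calc (X w : ℝ) * R⁻¹ ≤ X w * X w' := by gcongr
            _ ≤ W / R ^ 2 := hXprod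
            _ = W / R * R⁻¹ := by field_simp
        exact le_of_mul_le_mul_right this (by positivity)
      refine absurd e1 (not_le.2 (hsingle w ?_))
      calc L w ≤ (X w' : ℝ) ^ (-γ) := hLX
        _ ≤ (R⁻¹) ^ (-γ) := Real.rpow_le_rpow_of_nonpos (by positivity) hgt.le (by linarith)
        _ = R ^ γ := by rw [Real.inv_rpow hR.le, ← Real.rpow_neg hR.le, neg_neg]
        _ ≤ W / H := h2
  have hE : 0 < W / H ^ 2 := by positivity
  obtain ⟨M, hM⟩ : ∃ M : ℕ, ∀ k : ℕ, M ≤ k → (k : ℝ) ^ (-γ) < W / H ^ 2 :=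
    eventually_atTop.1 (((tendsto_rpow_neg_atTop hγ).comp
      tendsto_natCast_atTop_atTop).eventually_lt_const hE)
  -- follow the sequence of minimal points until the product of the `L`s becomes small
  have hstep : ∀ k z z', L z' < L z → W / R < X z' → 1 ≤ X z' → L z ≤ (X z' : ℝ) ^ (-γ) →
      (∀ q, X q ≤ X z' → L z' ≤ L q) → W / H ^ 2 < L z * L z' → M ≤ X z' + k → False := by
    intro k
    induction k with
    | zero =>
      intro z z' hLL hA' h1X hLX hm hprod hk
      have h1X' : (1 : ℝ) ≤ X z' := by exact_mod_cast h1X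
      have e1 : (X z' : ℝ) ^ (-γ) ≤ 1 := Real.rpow_le_one_of_one_le_of_nonpos h1X' (by linarith)
      have e2 := hM (X z') (by simpa using hk)
      nlinarith [hL z, hL z']
    | succ k ih =>
      intro z z' hLL hA' h1X hLX hm hprod hk
      have hz'pos : 0 < L z' := by
        rcases (hL z').lt_or_eq with h | h
        · exact h
        · rw [← h, mul_zero] at hprod
          exact absurd hprod (not_lt.2 hE.le)
      obtain ⟨z'', hX2, hL2, hLX2, hm2⟩ := exists_next_minimal_point hmin hγ hU
        (by linarith : t₀ < (X z' : ℝ) + 1) hm hz'pos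
      have hX2' : (X z' : ℝ) < X z'' := by exact_mod_cast hX2
      rcases le_or_gt (L z' * L z'') (W / H ^ 2) with hle | hgt
      · refine hfinal z' z'' hX2 hL2 (hA'.trans hX2') hLX2 hle ?_
        by_contra! h
        have e1 : L z * L z' ≤ ((X z' : ℝ) * X z'') ^ (-γ) := by
          rw [Real.mul_rpow (by positivity) (by positivity)]
          exact mul_le_mul hLX hLX2 (hL _) (by positivity)
        have e2 : ((X z' : ℝ) * X z'') ^ (-γ) ≤ (W / R ^ 2) ^ (-γ) :=
          Real.rpow_le_rpow_of_nonpos (by positivity) h.le (by linarith)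
        linarith
      · exact ih z' z'' hL2 (hA'.trans hX2') (h1X.trans hX2.le) hLX2 hm2 hgt (by omega)
  rcases le_or_gt (L z₀ * L z₁) (W / H ^ 2) with hle | hgt
  · refine hfinal z₀ z₁ (hz₀X.trans_lt h01) hL1 hz₁A hLX1 hle ?_
    have e1 : (X z₁ : ℝ) ≤ R⁻¹ := by
      by_contra! h
      have e2 : (X z₁ : ℝ) ^ (-γ) ≤ R ^ γ := by
        calc (X z₁ : ℝ) ^ (-γ) ≤ (R⁻¹) ^ (-γ) :=
              Real.rpow_le_rpow_of_nonpos (by positivity) h.le (by linarith)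
          _ = R ^ γ := by rw [Real.inv_rpow hR.le, ← Real.rpow_neg hR.le, neg_neg]
      linarith
    calc (X z₀ : ℝ) * X z₁ ≤ W / R * R⁻¹ := by gcongr
      _ = W / R ^ 2 := by field_simp
  · exact hstep M z₀ z₁ hL1 hz₁A (by omega) hLX1 hz₁ hgt (by omega)

/-- The linear forms `y'` and `ᵗΘ y' - x'` of the transposed system, in the variables
`(y', x')`. -/
def transposedForms {n m : ℕ} (Θ : Matrix (Fin n) (Fin m) ℝ) :
    Matrix (Fin n ⊕ Fin m) (Fin n ⊕ Fin m) ℝ :=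
  Matrix.fromBlocks 1 0 Θ.transpose (-1)

theorem abs_det_transposedForms {n m : ℕ} (Θ : Matrix (Fin n) (Fin m) ℝ) :
    |(transposedForms Θ).det| = 1 := by
  simp [transposedForms, Matrix.det_fromBlocks_zero₁₂, Matrix.det_neg]

theorem exists_transposed_solution {n m : ℕ} (Θ : Matrix (Fin n) (Fin m) ℝ) {H R : ℝ}
    (hH : 0 ≤ H) (hR : 0 ≤ R) (hR1 : R < 1)
    (h : ∃ w : Fin n ⊕ Fin m → ℤ, w ≠ 0 ∧ ∀ i,
      |(transposedForms Θ).mulVec (fun j => (w j : ℝ)) i| ≤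
        Sum.elim (fun _ => H) (fun _ => R) i) :
    ∃ (y : Fin n → ℤ) (x : Fin m → ℤ), y ≠ 0 ∧ ‖(fun i => (y i : ℝ))‖ ≤ H ∧
      ‖Θ.transpose.mulVec (fun i => (y i : ℝ)) - (fun j => (x j : ℝ))‖ ≤ R := by
  obtain ⟨w, hw0, hw⟩ := h
  have hsplit : (fun j => (w j : ℝ)) =
      Sum.elim (fun i => (w (Sum.inl i) : ℝ)) (fun j => (w (Sum.inr j) : ℝ)) := by
    funext j; cases j <;> rfl
  rw [hsplit, transposedForms, Matrix.fromBlocks_mulVec] at hw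
  have hy : ∀ i, |(w (Sum.inl i) : ℝ)| ≤ H := fun i => by simpa using hw (Sum.inl i)
  have hx : ∀ j, |Θ.transpose.mulVec (fun i => (w (Sum.inl i) : ℝ)) j - w (Sum.inr j)| ≤ R :=
    fun j => by
      simpa [Matrix.neg_mulVec, Function.comp_def, sub_eq_add_neg] using hw (Sum.inr j)
  refine ⟨fun i => w (Sum.inl i), fun j => w (Sum.inr j), ?_, ?_, ?_⟩
  · intro h0
    apply hw0
    have h0' : ∀ i, w (Sum.inl i) = 0 := fun i => congrFun h0 i
    funext j
    rcases j with i | j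
    · exact h0' i
    · have h1 := hx j
      have h2 : (fun i => (w (Sum.inl i) : ℝ)) = 0 := by funext i; simp [h0']
      rw [h2, Matrix.mulVec_zero, Pi.zero_apply, zero_sub, abs_neg] at h1
      have h3 : |w (Sum.inr j)| < 1 := by exact_mod_cast h1.trans_lt hR1
      exact Int.abs_lt_one_iff.1 h3
  · exact (pi_norm_le_iff_of_nonneg hH).2 hy
  · exact (pi_norm_le_iff_of_nonneg hR).2 hx

/-- The coordinates, with respect to the forms of the transposed system, of the functional given
by pairing with the integer point `(x, y)`. -/
def pairingCoords {n m : ℕ} (Θ : Matrix (Fin n) (Fin m) ℝ)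
    (p : (Fin m → ℤ) × (Fin n → ℤ)) : Fin n ⊕ Fin m → ℝ :=
  Sum.elim (Θ.mulVec (fun j => (p.1 j : ℝ)) - fun i => (p.2 i : ℝ)) (fun j => -(p.1 j : ℝ))

theorem pairingCoords_vecMul {n m : ℕ} (Θ : Matrix (Fin n) (Fin m) ℝ)
    (p : (Fin m → ℤ) × (Fin n → ℤ)) :
    ∃ z : Fin n ⊕ Fin m → ℤ,
      Matrix.vecMul (pairingCoords Θ p) (transposedForms Θ) = fun i => (z i : ℝ) := by
  refine ⟨Sum.elim (fun i => -p.2 i) p.1, ?_⟩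
  have hneg : (fun j => -(p.1 j : ℝ)) = -(fun j => (p.1 j : ℝ)) := rfl
  rw [pairingCoords, transposedForms, Matrix.vecMul_fromBlocks]
  funext i
  rcases i with i | j
  · simp only [hneg, Sum.elim_comp_inl, Sum.elim_comp_inr, Sum.elim_inl, Matrix.vecMul_one,
      Matrix.vecMul_transpose, Matrix.mulVec_neg, Pi.add_apply, Pi.sub_apply, Pi.neg_apply,
      Int.cast_neg]
    ring
  · simp [hneg, Function.comp_def, Matrix.vecMul_neg]

theorem abs_pairingCoords_le {n m : ℕ} (Θ : Matrix (Fin n) (Fin m) ℝ)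
    (p : (Fin m → ℤ) × (Fin n → ℤ)) (i : Fin n ⊕ Fin m) :
    |pairingCoords Θ p i| ≤
      Sum.elim (fun _ => ‖Θ.mulVec (fun j => (p.1 j : ℝ)) - fun i => (p.2 i : ℝ)‖)
        (fun _ => ‖fun j => (p.1 j : ℝ)‖) i := by
  rcases i with i | j
  · exact norm_le_pi_norm (Θ.mulVec (fun j => (p.1 j : ℝ)) - fun i => (p.2 i : ℝ)) i
  · simpa [pairingCoords] using norm_le_pi_norm (fun j => (p.1 j : ℝ)) j

theorem prod_weights (n m : ℕ) (H R : ℝ) :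
    ∏ i : Fin n ⊕ Fin m, (Sum.elim (fun _ => H) (fun _ => R) i : ℝ) = H ^ n * R ^ m := by
  simp [Fintype.prod_sum_type]

/-- The constant in the transference lemmas. -/
def transferConst (n m : ℕ) : ℝ := ((2 * (n + m : ℕ) : ℝ) ^ (n + m))⁻¹ / 2

theorem transferConst_pos {n : ℕ} (m : ℕ) (hn : 0 < n) : 0 < transferConst n m := by
  unfold transferConst
  have : (0 : ℝ) < (n + m : ℕ) := by exact_mod_cast Nat.add_pos_left hn m
  positivity

theorem transposed_solution_of_point {n m : ℕ} (hn : 0 < n) (Θ : Matrix (Fin n) (Fin m) ℝ)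
    {H R : ℝ} (hH : 0 < H) (hR : 0 < R) (hR1 : R < 1) (p : (Fin m → ℤ) × (Fin n → ℤ))
    (hp : p.1 ≠ 0)
    (hL : ‖Θ.mulVec (fun j => (p.1 j : ℝ)) - fun i => (p.2 i : ℝ)‖ * H ≤
      transferConst n m * (H ^ n * R ^ m))
    (hX : ‖fun j => (p.1 j : ℝ)‖ * R ≤ transferConst n m * (H ^ n * R ^ m)) :
    ∃ (y : Fin n → ℤ) (x : Fin m → ℤ), y ≠ 0 ∧ ‖(fun i => (y i : ℝ))‖ ≤ H ∧
      ‖Θ.transpose.mulVec (fun i => (y i : ℝ)) - (fun j => (x j : ℝ))‖ ≤ R := by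
  have : Nonempty (Fin n) := ⟨⟨0, hn⟩⟩
  refine exists_transposed_solution Θ hH.le hR.le hR1 ?_
  refine exists_int_ne_zero_abs_mulVec_le_of_minors (κ := Fin 1) _ (abs_det_transposedForms Θ) _
    ?_ (fun _ => pairingCoords Θ p) (fun _ => pairingCoords_vecMul Θ p) ?_ ?_
  · rintro (i | j) <;> assumption
  · obtain ⟨j, hj⟩ := Function.ne_iff.1 hp
    refine ⟨fun _ => Sum.inr j, ?_⟩
    simpa [pairingCoords] using hj
  · intro s
    rw [prod_weights, Matrix.det_fin_one, Fin.prod_univ_one, Fintype.card_sum, Fintype.card_fin,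
      Fintype.card_fin, Matrix.of_apply]
    have hW : transferConst n m * (H ^ n * R ^ m) ≤
        ((2 * (n + m : ℕ) : ℝ) ^ (n + m))⁻¹ * (H ^ n * R ^ m) := by
      have := transferConst_pos m hn
      unfold transferConst at *
      gcongr
      linarith
    refine le_trans ?_ hW
    have h1 := abs_pairingCoords_le Θ p (s 0)
    rcases h : s 0 with i | j <;> rw [h] at h1
    · exact (mul_le_mul_of_nonneg_right h1 hH.le).trans hL
    · exact (mul_le_mul_of_nonneg_right h1 hR.le).trans hX

theorem transposed_solution_of_pair {n m : ℕ} (hn : 0 < n) (Θ : Matrix (Fin n) (Fin m) ℝ)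
    {H R : ℝ} (hH : 0 < H) (hR : 0 < R) (hR1 : R < 1) (p q : (Fin m → ℤ) × (Fin n → ℤ))
    (hp : p.1 ≠ 0) {X X' L L' W : ℝ} (hW : W = transferConst n m * (H ^ n * R ^ m))
    (hX : ‖fun j => (p.1 j : ℝ)‖ = X) (hX' : ‖fun j => (q.1 j : ℝ)‖ = X')
    (hL : ‖Θ.mulVec (fun j => (p.1 j : ℝ)) - fun i => (p.2 i : ℝ)‖ = L)
    (hL' : ‖Θ.mulVec (fun j => (q.1 j : ℝ)) - fun i => (q.2 i : ℝ)‖ = L')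
    (hXX : X < X') (hLL : L' < L) (h1 : L * L' ≤ W / H ^ 2) (h2 : X * X' ≤ W / R ^ 2)
    (h3 : L * X' ≤ W / (H * R)) :
    ∃ (y : Fin n → ℤ) (x : Fin m → ℤ), y ≠ 0 ∧ ‖(fun i => (y i : ℝ))‖ ≤ H ∧
      ‖Θ.transpose.mulVec (fun i => (y i : ℝ)) - (fun j => (x j : ℝ))‖ ≤ R := by
  have : Nonempty (Fin n) := ⟨⟨0, hn⟩⟩
  have hX0 : 0 ≤ X := hX ▸ norm_nonneg _
  have hL0 : 0 ≤ L' := hL' ▸ norm_nonneg _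
  have hX0' : 0 ≤ X' := hX0.trans hXX.le
  have hL0' : 0 ≤ L := hL0.trans hLL.le
  refine exists_transposed_solution Θ hH.le hR.le hR1 ?_
  refine exists_int_ne_zero_abs_mulVec_le_of_minors (κ := Fin 2) _ (abs_det_transposedForms Θ) _
    ?_ ![pairingCoords Θ p, pairingCoords Θ q] ?_ ?_ ?_
  · rintro (i | j) <;> assumption
  · intro k
    fin_cases k <;> exact pairingCoords_vecMul Θ _
  · by_contra! hcon
    obtain ⟨j, hj⟩ := Function.ne_iff.1 hp
    have hj' : (p.1 j : ℝ) ≠ 0 := by simpa using hj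
    set μ : ℝ := (q.1 j : ℝ) / p.1 j
    have hprop : ∀ i, pairingCoords Θ q i = μ * pairingCoords Θ p i := by
      intro i
      have h := hcon ![Sum.inr j, i]
      rw [Matrix.det_fin_two] at h
      simp only [Matrix.of_apply, Matrix.cons_val_zero, Matrix.cons_val_one] at h
      have e1 : pairingCoords Θ p (Sum.inr j) = -(p.1 j : ℝ) := rfl
      have e2 : pairingCoords Θ q (Sum.inr j) = -(q.1 j : ℝ) := rfl
      rw [e1, e2] at h
      simp only [μ]
      field_simp
      linarith
    have e1 : X' = |μ| * X := by
      have : (fun j => (q.1 j : ℝ)) = μ • fun j => (p.1 j : ℝ) := by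
        funext i
        have := hprop (Sum.inr i)
        simp only [pairingCoords, Sum.elim_inr] at this
        simp only [Pi.smul_apply, smul_eq_mul]
        linarith
      rw [← hX', ← hX, this, norm_smul, Real.norm_eq_abs]
    have e2 : L' = |μ| * L := by
      have : (Θ.mulVec (fun j => (q.1 j : ℝ)) - fun i => (q.2 i : ℝ)) =
          μ • (Θ.mulVec (fun j => (p.1 j : ℝ)) - fun i => (p.2 i : ℝ)) := by
        funext i
        exact hprop (Sum.inl i)
      rw [← hL', ← hL, this, norm_smul, Real.norm_eq_abs]
    have : |μ| < 1 := by
      by_contra! h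
      nlinarith
    nlinarith
  · intro s
    rw [prod_weights, Matrix.det_fin_two, Fin.prod_univ_two, Fintype.card_sum, Fintype.card_fin,
      Fintype.card_fin]
    simp only [Matrix.of_apply, Matrix.cons_val_zero, Matrix.cons_val_one]
    have hb : ∀ i k, |pairingCoords Θ p i * pairingCoords Θ q k| *
        ((Sum.elim (fun _ => H) (fun _ => R) i : ℝ) * Sum.elim (fun _ => H) (fun _ => R) k) ≤ W := by
      intro i k
      have hpi := abs_pairingCoords_le Θ p i
      have hqk := abs_pairingCoords_le Θ q k
      rw [hX, hL] at hpi
      rw [hX', hL'] at hqk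
      rw [abs_mul]
      rw [le_div_iff₀ (by positivity)] at h1 h2 h3
      rcases i with i | i <;> rcases k with k | k <;>
        simp only [Sum.elim_inl, Sum.elim_inr] at hpi hqk ⊢
      · calc _ ≤ L * L' * (H * H) := by gcongr
          _ ≤ W := by linarith
      · calc _ ≤ L * X' * (H * R) := by gcongr
          _ ≤ W := by linarith
      · calc _ ≤ X * L' * (R * H) := by gcongr
          _ ≤ X' * L * (R * H) := by gcongr
          _ ≤ W := by linarith
      · calc _ ≤ X * X' * (R * R) := by gcongr
          _ ≤ W := by linarith
    have hW2 : ((2 * (n + m : ℕ) : ℝ) ^ (n + m))⁻¹ * (H ^ n * R ^ m) = W + W := by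
      rw [hW, transferConst]; ring
    have hω : ∀ i, (0 : ℝ) ≤ Sum.elim (fun _ : Fin n => H) (fun _ : Fin m => R) i := by
      rintro (i | j)
      exacts [hH.le, hR.le]
    rw [hW2]
    refine (mul_le_mul_of_nonneg_right (abs_sub _ _)
      (mul_nonneg (hω (s 0)) (hω (s 1)))).trans ?_
    rw [add_mul]
    refine add_le_add (hb _ _) ?_
    rw [mul_comm (Sum.elim _ _ (s 0))]
    exact hb _ _

/-- The sup-norm of an integer vector, as a natural number. -/
def intSupNorm {m : ℕ} (x : Fin m → ℤ) : ℕ := Finset.univ.sup fun j => (x j).natAbs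

theorem norm_cast_eq_intSupNorm {m : ℕ} (x : Fin m → ℤ) :
    ‖fun j => (x j : ℝ)‖ = intSupNorm x := by
  have habs : ∀ j, ‖(x j : ℝ)‖ = ((x j).natAbs : ℝ) := fun j => by
    rw [Real.norm_eq_abs, Nat.cast_natAbs, Int.cast_abs]
  apply le_antisymm
  · refine (pi_norm_le_iff_of_nonneg (by positivity)).2 fun j => ?_
    rw [habs]
    exact_mod_cast Finset.le_sup (f := fun j => (x j).natAbs) (Finset.mem_univ j)
  · rcases (Finset.univ : Finset (Fin m)).eq_empty_or_nonempty with h | h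
    · simp [intSupNorm, h]
    · obtain ⟨j, -, hj⟩ := Finset.exists_mem_eq_sup _ h fun j => (x j).natAbs
      rw [intSupNorm, hj, ← habs]
      exact norm_le_pi_norm (fun j => (x j : ℝ)) j

theorem exists_minimal_point {n m : ℕ} (Θ : Matrix (Fin n) (Fin m) ℝ) (N : ℕ)
    (hN : ∃ p : {p : (Fin m → ℤ) × (Fin n → ℤ) // p.1 ≠ 0}, intSupNorm p.1.1 ≤ N) :
    ∃ p : {p : (Fin m → ℤ) × (Fin n → ℤ) // p.1 ≠ 0}, intSupNorm p.1.1 ≤ N ∧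
      ∀ q : {p : (Fin m → ℤ) × (Fin n → ℤ) // p.1 ≠ 0}, intSupNorm q.1.1 ≤ N →
        ‖Θ.mulVec (fun j => (p.1.1 j : ℝ)) - fun i => (p.1.2 i : ℝ)‖ ≤
          ‖Θ.mulVec (fun j => (q.1.1 j : ℝ)) - fun i => (q.1.2 i : ℝ)‖ := by
  let g : (Fin m → ℤ) → Fin n → ℤ := fun x i => round (Θ.mulVec (fun j => (x j : ℝ)) i)
  have hfin : {x : Fin m → ℤ | x ≠ 0 ∧ intSupNorm x ≤ N}.Finite := by
    refine (Set.finite_Icc (fun _ => -(N : ℤ)) (fun _ => (N : ℤ))).subset fun x hx => ?_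
    have : ∀ j, (x j).natAbs ≤ N := fun j =>
      (Finset.le_sup (f := fun j => (x j).natAbs) (Finset.mem_univ j)).trans hx.2
    refine ⟨fun j => ?_, fun j => ?_⟩ <;>
    · have := this j
      dsimp only
      omega
  obtain ⟨p, hp⟩ := hN
  obtain ⟨x, ⟨hx0, hxN⟩, hx⟩ := Set.exists_min_image _
    (fun x => ‖Θ.mulVec (fun j => (x j : ℝ)) - fun i => (g x i : ℝ)‖) hfin ⟨p.1.1, p.2, hp⟩
  refine ⟨⟨(x, g x), hx0⟩, hxN, fun q hq => (hx q.1.1 ⟨q.2, hq⟩).trans ?_⟩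
  refine (pi_norm_le_iff_of_nonneg (norm_nonneg _)).2 fun i => ?_
  exact (round_le _ _).trans
    (norm_le_pi_norm (Θ.mulVec (fun j => (q.1.1 j : ℝ)) - fun i => (q.1.2 i : ℝ)) i)

theorem eventually_rpow_le_const_mul_rpow {a b C : ℝ} (hab : a < b) (hC : 0 < C) :
    ∀ᶠ t : ℝ in atTop, t ^ a ≤ C * t ^ b := by
  filter_upwards [(tendsto_rpow_atTop (sub_pos.2 hab)).eventually_ge_atTop C⁻¹,
    eventually_gt_atTop 0] with t ht ht0
  calc t ^ a = C * (C⁻¹ * t ^ a) := by field_simp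
    _ ≤ C * (t ^ (b - a) * t ^ a) := by gcongr
    _ = C * t ^ b := by rw [← Real.rpow_add ht0]; ring_nf

/-- Transference of uniform approximability, for admissible pairs of exponents. -/
theorem UniformlyApprox.transpose {n m : ℕ} (hn : 0 < n) (Θ : Matrix (Fin n) (Fin m) ℝ)
    {γ β : ℝ} (hγ : 0 < γ) (hβ : 0 < β) (h1 : 1 < γ * (n - β * (m - 1)))
    (h2 : β * (m - γ) < n - 1) (h : UniformlyApprox n m Θ fun t => t ^ (-γ)) :
    UniformlyApprox m n Θ.transpose fun t => t ^ (-β) := by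
  obtain ⟨t₀, ht₀⟩ := eventually_atTop.1 h
  set C := transferConst n m
  have hC : 0 < C := transferConst_pos m hn
  have hexp : 0 < n - β * (m - 1) := by
    by_contra! h
    nlinarith
  filter_upwards [eventually_gt_atTop 1,
    eventually_rpow_le_const_mul_rpow h1 (Real.rpow_pos_of_pos hC γ),
    eventually_rpow_le_const_mul_rpow (by linarith : -(β * γ) < n - 1 - β * m) hC,
    ((tendsto_rpow_atTop hexp).const_mul_atTop hC).eventually_ge_atTop t₀] with t ht e1 e2 e3
  have htpos : 0 < t := by linarith
  have hR : 0 < t ^ (-β) := by positivity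
  have hR1 : t ^ (-β) < 1 := Real.rpow_lt_one_of_one_lt_of_neg ht (by linarith)
  set W := C * (t ^ n * (t ^ (-β)) ^ m) with hWdef
  have hW : W = C * t ^ (n - β * m : ℝ) := by
    rw [hWdef, ← Real.rpow_natCast t, ← Real.rpow_natCast (t ^ (-β)), ← Real.rpow_mul htpos.le,
      ← Real.rpow_add htpos]
    ring_nf
  have hWpos : 0 < W := by positivity
  have hWR : W / t ^ (-β) = C * t ^ (n - β * (m - 1) : ℝ) := by
    rw [hW, mul_div_assoc, ← Real.rpow_sub htpos]
    ring_nf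
  have hWH : W / t = C * t ^ (n - 1 - β * m : ℝ) := by
    rw [hW, mul_div_assoc, ← Real.rpow_sub_one htpos.ne']
    ring_nf
  have f1 : t ≤ (W / t ^ (-β)) ^ γ := by
    rw [hWR, Real.mul_rpow hC.le (by positivity), ← Real.rpow_mul htpos.le, mul_comm _ γ]
    simpa using e1
  have f2 : (t ^ (-β)) ^ γ ≤ W / t := by
    rw [hWH, ← Real.rpow_mul htpos.le, neg_mul]
    exact e2
  have key := exists_small_point_or_pair
    (P := {p : (Fin m → ℤ) × (Fin n → ℤ) // p.1 ≠ 0}) (X := fun p => intSupNorm p.1.1)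
    (L := fun p => ‖Θ.mulVec (fun j => (p.1.1 j : ℝ)) - fun i => (p.1.2 i : ℝ)‖)
    (fun _ => norm_nonneg _) (exists_minimal_point Θ) hγ
    (fun s hs => by
      obtain ⟨x, y, hx0, hx, hxy⟩ := ht₀ s hs
      exact ⟨⟨(x, y), hx0⟩, by rwa [← norm_cast_eq_intSupNorm], hxy⟩)
    htpos hR hWpos (by rw [hWR]; exact e3) f1 f2
  rcases key with ⟨p, hpL, hpX⟩ | ⟨p, q, hX, hL, g1, g2, g3⟩
  · refine transposed_solution_of_point hn Θ htpos hR hR1 p.1 p.2 ?_ ?_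
    · rwa [← le_div_iff₀ htpos]
    · rwa [norm_cast_eq_intSupNorm, ← le_div_iff₀ hR]
  · exact transposed_solution_of_pair hn Θ htpos hR hR1 p.1 q.1 p.2 hWdef
      (norm_cast_eq_intSupNorm _) (norm_cast_eq_intSupNorm _) rfl rfl (by exact_mod_cast hX)
      hL g1 g2 g3

/-- Dirichlet's theorem for the transposed system. -/
theorem uniformlyApprox_transpose_dirichlet {n m : ℕ} (hn : 0 < n) (hm : 0 < m)
    (Θ : Matrix (Fin n) (Fin m) ℝ) :
    UniformlyApprox m n Θ.transpose fun t => t ^ (-(n / m : ℝ)) := by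
  have : Nonempty (Fin n) := ⟨⟨0, hn⟩⟩
  have hn' : (0 : ℝ) < n := by exact_mod_cast hn
  have hm' : (0 : ℝ) < m := by exact_mod_cast hm
  filter_upwards [eventually_gt_atTop 1] with t ht
  have htpos : 0 < t := by linarith
  have hneg : -(n / m : ℝ) < 0 := neg_neg_of_pos (by positivity)
  refine exists_transposed_solution Θ htpos.le (by positivity)
    (Real.rpow_lt_one_of_one_lt_of_neg ht hneg)
    (exists_int_ne_zero_abs_mulVec_le _ ?_ _ ?_ ?_)
  · intro h
    simpa [h] using abs_det_transposedForms Θ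
  · rintro (i | j)
    · exact htpos
    · exact Real.rpow_pos_of_pos htpos _
  · rw [prod_weights, abs_det_transposedForms, ← Real.rpow_natCast t,
      ← Real.rpow_natCast (t ^ (-(n / m : ℝ))), ← Real.rpow_mul htpos.le, ← Real.rpow_add htpos,
      neg_mul, div_mul_cancel₀ _ hm'.ne', add_neg_cancel, Real.rpow_zero]

theorem UniformlyApprox.mono_exponent {n m : ℕ} {Θ : Matrix (Fin n) (Fin m) ℝ} {γ γ' : ℝ}
    (hle : γ ≤ γ') (h : UniformlyApprox n m Θ fun t => t ^ (-γ')) :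
    UniformlyApprox n m Θ fun t => t ^ (-γ) := by
  filter_upwards [h, eventually_ge_atTop 1] with t ⟨x, y, hx0, hx, hxy⟩ ht
  exact ⟨x, y, hx0, hx, hxy.trans (Real.rpow_le_rpow_of_exponent_le ht (by linarith))⟩

theorem UniformlyApprox.le_alphaExp {n m : ℕ} {Θ : Matrix (Fin n) (Fin m) ℝ} {γ : ℝ}
    (hγ : 0 < γ) (h : UniformlyApprox n m Θ fun t => t ^ (-γ)) :
    ENNReal.ofReal γ ≤ alphaExp n m Θ :=
  le_sSup ⟨γ, ⟨hγ, h⟩, rfl⟩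

theorem uniformlyApprox_of_lt_alphaExp {n m : ℕ} {Θ : Matrix (Fin n) (Fin m) ℝ} {γ : ℝ}
    (h : ENNReal.ofReal γ < alphaExp n m Θ) :
    UniformlyApprox n m Θ fun t => t ^ (-γ) := by
  obtain ⟨_, ⟨γ', ⟨-, hγ'⟩, rfl⟩, hlt⟩ := lt_sSup_iff.1 h
  exact hγ'.mono_exponent (ENNReal.ofReal_lt_ofReal_iff'.1 hlt).1.le

/-- If `β ≤ n / m` is not automatic, the admissibility conditions hold with some `γ ≤ 1`. -/
theorem le_alphaExp_transpose_of_le_one {n m : ℕ} (hn : 0 < n) (hm : 0 < m)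
    (Θ : Matrix (Fin n) (Fin m) ℝ) (hα : alphaExp n m Θ ≤ 1) {β : ℝ} (hβ : (n / m : ℝ) < β)
    (h : β * (m - (alphaExp n m Θ).toReal) < n - 1) :
    ENNReal.ofReal β ≤ alphaExp m n Θ.transpose := by
  have hn' : (1 : ℝ) ≤ n := by exact_mod_cast hn
  have hm' : (1 : ℝ) ≤ m := by exact_mod_cast hm
  have hβ0 : 0 < β := lt_of_le_of_lt (by positivity) hβ
  have hαtop : alphaExp n m Θ ≠ ⊤ := ne_top_of_le_ne_top ENNReal.one_ne_top hα
  set a := (alphaExp n m Θ).toReal with ha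
  have ha1 : a ≤ 1 := by simpa using ENNReal.toReal_mono ENNReal.one_ne_top hα
  have hmn : (m / n : ℝ) < a := by
    have : (n / m : ℝ) * (m - a) < n - 1 := lt_of_le_of_lt (by gcongr; linarith) h
    rw [div_mul_eq_mul_div, div_lt_iff₀ (by linarith)] at this
    rw [div_lt_iff₀ (by linarith)]
    linarith
  have hma : m - (n - 1) / β < a := by
    have : m - a < (n - 1) / β := by
      rw [lt_div_iff₀ hβ0]
      linarith
    linarith
  obtain ⟨γ, hγ1, hγa⟩ := exists_between (max_lt hmn hma)
  have hγmn : (m / n : ℝ) < γ := (le_max_left _ _).trans_lt hγ1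
  have hγβ : m - (n - 1) / β < γ := (le_max_right _ _).trans_lt hγ1
  have hγ0 : 0 < γ := lt_of_le_of_lt (by positivity) hγmn
  have h2 : β * (m - γ) < n - 1 := by
    have : m - γ < (n - 1) / β := by linarith
    rw [lt_div_iff₀ hβ0] at this
    linarith
  rw [div_lt_iff₀ (by linarith)] at hγmn
  have h1 : 1 < γ * (n - β * (m - 1)) := by
    have hmγ : 0 < m - γ := by linarith
    have e1 : γ * (m - 1) * (β * (m - γ)) ≤ γ * (m - 1) * (n - 1) :=
      mul_le_mul_of_nonneg_left h2.le (mul_nonneg hγ0.le (by linarith))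
    have e2 : 0 < (1 - γ) * (γ * n - m) := mul_pos (by linarith) (by linarith)
    have e3 : 0 < (γ * (n - β * (m - 1)) - 1) * (m - γ) := by linarith
    have := pos_of_mul_pos_left e3 hmγ.le
    linarith
  refine ((uniformlyApprox_of_lt_alphaExp ?_).transpose hn Θ hγ0 hβ0 h1 h2).le_alphaExp hβ0
  rwa [ENNReal.ofReal_lt_iff_lt_toReal hγ0.le hαtop]

/-- If `β ≤ n / m` is not automatic, the admissibility conditions hold with some `γ > 1`. -/
theorem le_alphaExp_transpose_of_one_lt {n m : ℕ} (hn : 0 < n) (hm : 0 < m)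
    (Θ : Matrix (Fin n) (Fin m) ℝ) (hα : 1 < alphaExp n m Θ) {β : ℝ} (hβ : (n / m : ℝ) < β)
    (h : β * (m - 1) < n - (alphaExp n m Θ)⁻¹.toReal) :
    ENNReal.ofReal β ≤ alphaExp m n Θ.transpose := by
  have hn' : (1 : ℝ) ≤ n := by exact_mod_cast hn
  have hm' : (1 : ℝ) ≤ m := by exact_mod_cast hm
  have hβ0 : 0 < β := lt_of_le_of_lt (by positivity) hβ
  have hinv : (alphaExp n m Θ)⁻¹ < 1 := ENNReal.inv_lt_one.2 hα
  have htop : (alphaExp n m Θ)⁻¹ ≠ ⊤ := hinv.ne_top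
  set s := (alphaExp n m Θ)⁻¹.toReal with hs
  have hs0 : 0 ≤ s := ENNReal.toReal_nonneg
  have hs1 : s < 1 := by
    have := (ENNReal.toReal_lt_toReal htop ENNReal.one_ne_top).2 hinv
    rwa [ENNReal.toReal_one] at this
  have hsnm : s < n / m := by
    have e1 : (n / m : ℝ) * (m - 1) < n - s := lt_of_le_of_lt (mul_le_mul_of_nonneg_right hβ.le (by linarith)) h
    have e2 : (n / m : ℝ) * (m - 1) = n - n / m := by field_simp
    linarith
  obtain ⟨σ, hsσ, hσ⟩ := exists_between
    (lt_min hs1 (lt_min hsnm (by linarith : s < n - β * (m - 1))))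
  have hσ0 : 0 < σ := hs0.trans_lt hsσ
  obtain ⟨hσ1, hσ2, hσ3⟩ : σ < 1 ∧ σ < n / m ∧ σ < n - β * (m - 1) := by
    simpa only [lt_min_iff] using hσ
  have hγ1 : 1 < σ⁻¹ := (one_lt_inv₀ hσ0).2 hσ1
  have hγn : m < σ⁻¹ * n := by
    rw [inv_mul_eq_div, lt_div_iff₀ hσ0]
    rw [lt_div_iff₀ (by linarith)] at hσ2
    linarith
  have h1 : 1 < σ⁻¹ * (n - β * (m - 1)) := by
    rw [inv_mul_eq_div, one_lt_div hσ0]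
    exact hσ3
  set γ := σ⁻¹ with hγ
  have hγ0 : 0 < γ := by linarith
  have h2 : β * (m - γ) < n - 1 := by
    rcases le_or_gt (m : ℝ) γ with hle | hgt
    · rcases hn'.eq_or_lt with h | h
      · rw [← h, mul_one] at hγn
        rw [← h]
        nlinarith
      · nlinarith [mul_nonneg hβ0.le (sub_nonneg.2 hle)]
    · have hm1 : 0 < γ * (m - 1) := mul_pos hγ0 (by linarith)
      have e1 : 0 < (γ * (n - β * (m - 1)) - 1) * (m - γ) := mul_pos (by linarith) (by linarith)
      have e2 : 0 < (γ - 1) * (γ * n - m) := mul_pos (by linarith) (by linarith)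
      have e3 : 0 < (n - 1 - β * (m - γ)) * (γ * (m - 1)) := by linarith
      have := pos_of_mul_pos_left e3 hm1.le
      linarith
  refine ((uniformlyApprox_of_lt_alphaExp ?_).transpose hn Θ hγ0 hβ0 h1 h2).le_alphaExp hβ0
  rw [hγ, ENNReal.ofReal_inv_of_pos hσ0, ENNReal.inv_lt_iff_inv_lt]
  exact (ENNReal.lt_ofReal_iff_toReal_lt htop).2 hsσ

/-- Bounds below for the exponent of the transposed system need only be proved for real numbers
exceeding Dirichlet's exponent. -/
theorem div_le_alphaExp_transpose {n m : ℕ} (hn : 0 < n) (hm : 0 < m)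
    (Θ : Matrix (Fin n) (Fin m) ℝ) {u v : ℝ}
    (h : ∀ β : ℝ, (n / m : ℝ) < β → β * v < u → ENNReal.ofReal β ≤ alphaExp m n Θ.transpose) :
    ENNReal.ofReal u / ENNReal.ofReal v ≤ alphaExp m n Θ.transpose := by
  refine le_of_forall_lt_imp_le_of_dense fun b hb => ?_
  obtain ⟨β, hβ, rfl⟩ : ∃ β : ℝ, 0 ≤ β ∧ ENNReal.ofReal β = b :=
    ⟨b.toReal, ENNReal.toReal_nonneg, ENNReal.ofReal_toReal hb.ne_top⟩
  rcases le_or_gt β (n / m) with hle | hgt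
  · exact (ENNReal.ofReal_le_ofReal hle).trans
      ((uniformlyApprox_transpose_dirichlet hn hm Θ).le_alphaExp (by positivity))
  · have h1 := ENNReal.mul_lt_of_lt_div hb
    rw [← ENNReal.ofReal_mul hβ] at h1
    exact h _ hgt (ENNReal.ofReal_lt_ofReal_iff'.1 h1).1

/-- German's Theorem 1 (uniform exponents of transposed systems), in `[0,∞]`,
with the `ℝ≥0∞` conventions `1/∞ = 0` and `a/0 = ∞` for `a > 0`. -/
theorem uniform_exponent_transference (n m : ℕ) (hn : 0 < n) (hm : 0 < m)
    (hnm : ¬(n = 1 ∧ m = 1)) (Θ : Matrix (Fin n) (Fin m) ℝ) :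
    (alphaExp n m Θ ≤ 1 →
      ((n : ℝ≥0∞) - 1) / ((m : ℝ≥0∞) - alphaExp n m Θ) ≤ alphaExp m n Θ.transpose) ∧
    (1 ≤ alphaExp n m Θ →
      ((n : ℝ≥0∞) - (alphaExp n m Θ)⁻¹) / ((m : ℝ≥0∞) - 1) ≤ alphaExp m n Θ.transpose) := by
  have hfirst : alphaExp n m Θ ≤ 1 →
      ((n : ℝ≥0∞) - 1) / ((m : ℝ≥0∞) - alphaExp n m Θ) ≤ alphaExp m n Θ.transpose := by
    intro hα
    have hαtop : alphaExp n m Θ ≠ ⊤ := ne_top_of_le_ne_top ENNReal.one_ne_top hα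
    have e1 : (n : ℝ≥0∞) - 1 = ENNReal.ofReal (n - 1) := by
      rw [ENNReal.ofReal_sub _ zero_le_one, ENNReal.ofReal_natCast, ENNReal.ofReal_one]
    have e2 : (m : ℝ≥0∞) - alphaExp n m Θ = ENNReal.ofReal (m - (alphaExp n m Θ).toReal) := by
      rw [ENNReal.ofReal_sub _ ENNReal.toReal_nonneg, ENNReal.ofReal_natCast,
        ENNReal.ofReal_toReal hαtop]
    rw [e1, e2]
    exact div_le_alphaExp_transpose hn hm Θ fun β =>
      le_alphaExp_transpose_of_le_one hn hm Θ hα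
  refine ⟨hfirst, fun hα => ?_⟩
  rcases hα.eq_or_lt with heq | hlt
  · simpa [← heq] using hfirst heq.ge
  · have htop : (alphaExp n m Θ)⁻¹ ≠ ⊤ := (ENNReal.inv_lt_one.2 hlt).ne_top
    have e1 : (n : ℝ≥0∞) - (alphaExp n m Θ)⁻¹ =
        ENNReal.ofReal (n - (alphaExp n m Θ)⁻¹.toReal) := by
      rw [ENNReal.ofReal_sub _ ENNReal.toReal_nonneg, ENNReal.ofReal_natCast,
        ENNReal.ofReal_toReal htop]
    have e2 : (m : ℝ≥0∞) - 1 = ENNReal.ofReal (m - 1) := by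
      rw [ENNReal.ofReal_sub _ zero_le_one, ENNReal.ofReal_natCast, ENNReal.ofReal_one]
    rw [e1, e2]
    exact div_le_alphaExp_transpose hn hm Θ fun β =>
      le_alphaExp_transpose_of_one_lt hn hm Θ hlt
end
end

section
/- Let n = 1 and m ≥ 2, and let Θ be a 1×m real matrix. Then, with quantities interpreted in [0,+∞] and the convention 1/(+∞) = 0: α(ᵗΘ) ≥ (1 − α(Θ)^{−1})/(m−1), and α(Θ)^{−1} ≤ (1 − α(ᵗΘ))/(m−1). -/
open Filter MeasureTheory
open scoped ENNReal RealInnerProductSpace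

noncomputable section

section Transference

open Matrix

lemma exists_int_ne_zero_abs_mulVec_lt {ι : Type*} [Fintype ι] [DecidableEq ι]
    (A : Matrix ι ι ℝ) (hA : A.det ≠ 0) (b : ι → ℝ) (hb : ∀ i, 0 < b i)
    (h : |A.det| < ∏ i, b i) :
    ∃ w : ι → ℤ, w ≠ 0 ∧ ∀ i, |(A *ᵥ fun j => (w j : ℝ)) i| < b i := by
  classical
  set f : (ι → ℝ) →ₗ[ℝ] (ι → ℝ) := Matrix.toLin' A with hf
  have hdet : LinearMap.det f = A.det := LinearMap.det_toLin' A
  set s : Set (ι → ℝ) := f ⁻¹' Set.pi Set.univ (fun i => Set.Ioo (-b i) (b i)) with hs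
  have hvol : volume s = ENNReal.ofReal |(A.det)⁻¹| * ∏ i, ENNReal.ofReal (2 * b i) := by
    rw [hs, Measure.addHaar_preimage_linearMap volume (by rwa [hdet]), hdet, volume_pi_pi]
    congr 1
    refine Finset.prod_congr rfl fun i _ => ?_
    rw [Real.volume_Ioo]; congr 1; ring
  have hsymm : ∀ x ∈ s, -x ∈ s := by
    intro x hx i hi
    have := hx i hi
    rw [map_neg]
    simp only [Set.mem_Ioo, Pi.neg_apply] at this ⊢
    constructor <;> linarith [this.1, this.2]
  have hconv : Convex ℝ s :=
    (convex_pi fun i _ => convex_Ioo _ _).linear_preimage f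
  have hF := ZSpan.isAddFundamentalDomain' (Pi.basisFun ℝ ι) (volume : Measure (ι → ℝ))
  have hlt : volume (ZSpan.fundamentalDomain (Pi.basisFun ℝ ι)) *
      2 ^ Module.finrank ℝ (ι → ℝ) < volume s := by
    rw [hvol, ZSpan.fundamentalDomain_pi_basisFun, volume_pi_pi]
    simp only [Real.volume_Ico, sub_zero, ENNReal.ofReal_one, Finset.prod_const_one, one_mul,
      Module.finrank_fintype_fun_eq_card]
    rw [← ENNReal.ofReal_prod_of_nonneg (fun i _ => by have := hb i; positivity),
      ← ENNReal.ofReal_mul (abs_nonneg _), Finset.prod_mul_distrib, Finset.prod_const,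
      Finset.card_univ, show (2 : ENNReal) ^ Fintype.card ι =
        ENNReal.ofReal (2 ^ Fintype.card ι) by rw [ENNReal.ofReal_pow (by norm_num)]; simp]
    have h0 : 0 < |A.det| := abs_pos.mpr hA
    have hp : 1 < |A.det|⁻¹ * ∏ i, b i := by
      rw [← div_eq_inv_mul, one_lt_div h0]; exact h
    have h2 : (0 : ℝ) < 2 ^ Fintype.card ι := by positivity
    rw [abs_inv, ENNReal.ofReal_lt_ofReal_iff (by nlinarith)]
    nlinarith
  have : Countable (Submodule.span ℤ (Set.range (Pi.basisFun ℝ ι))).toAddSubgroup :=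
    inferInstanceAs (Countable (Submodule.span ℤ (Set.range (Pi.basisFun ℝ ι))))
  obtain ⟨⟨x, hxL⟩, hx0, hxs⟩ :=
    exists_ne_zero_mem_lattice_of_measure_mul_two_pow_lt_measure hF hsymm hconv hlt
  have hmem : ∀ i, ∃ k : ℤ, (k : ℝ) = x i := by
    intro i
    have := (Module.Basis.mem_span_iff_repr_mem ℤ (Pi.basisFun ℝ ι) x).1 hxL i
    simpa using this
  choose w hw using hmem
  have hwx : (fun j => (w j : ℝ)) = x := funext hw
  refine ⟨w, ?_, fun i => ?_⟩
  · rintro rfl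
    apply hx0
    ext i
    simpa using (hw i).symm
  · rw [hwx, abs_lt]
    have := hxs i (Set.mem_univ i)
    simpa [hf] using this

lemma det_one_updateRow_updateRow {ι R : Type*} [Fintype ι] [DecidableEq ι] [CommRing R]
    {a b : ι} (hab : a ≠ b) (v w : ι → R) :
    (((1 : Matrix ι ι R).updateRow a v).updateRow b w).det = v a * w b - v b * w a := by
  have : ((1 : Matrix ι ι R).updateRow a v).updateRow b w =
      1 + (Matrix.of fun i => ![(Pi.single a 1 : ι → R) i, (Pi.single b 1 : ι → R) i]) *
        Matrix.of ![v - Pi.single a 1, w - Pi.single b 1] := by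
    ext i j
    rcases eq_or_ne i b with rfl | hib
    · simp [Matrix.mul_apply, Fin.sum_univ_two, hab.symm, Matrix.one_apply, Pi.single_apply,
        eq_comm (a := j)]
    · rcases eq_or_ne i a with rfl | hia
      · simp [Matrix.mul_apply, Fin.sum_univ_two, hab, Matrix.one_apply, Pi.single_apply,
          eq_comm (a := j)]
      · simp [Matrix.mul_apply, Fin.sum_univ_two, hia, hib]
  rw [this, Matrix.det_one_add_mul_comm, Matrix.det_fin_two]
  simp only [Matrix.add_apply, Matrix.mul_apply, Matrix.of_apply, Matrix.one_apply,
    Pi.single_apply, Matrix.cons_val_zero, Matrix.cons_val_one, Pi.sub_apply, mul_ite, mul_one,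
    mul_zero, Finset.sum_ite_eq', Finset.mem_univ, if_true, Fin.isValue, hab, hab.symm, if_false,
    zero_ne_one, one_ne_zero]
  ring

lemma det_one_updateRow {ι R : Type*} [Fintype ι] [DecidableEq ι] [CommRing R]
    (a : ι) (v : ι → R) : ((1 : Matrix ι ι R).updateRow a v).det = v a := by
  rw [← Matrix.cramer_transpose_apply]
  simp

lemma prod_ite_mem_one_const {ι R : Type*} [Fintype ι] [DecidableEq ι] [CommMonoid R]
    (s : Finset ι) (c : R) :
    ∏ i, (if i ∈ s then 1 else c) = c ^ (Fintype.card ι - s.card) := by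
  rw [Finset.prod_ite, Finset.prod_const_one, one_mul, Finset.prod_const, ← Finset.card_compl]
  congr 2
  ext; simp

/-- Minkowski's theorem with all but one of the coordinates bounded, plus one more linear form. -/
lemma exists_int_ne_zero_of_linearForm {ι : Type*} [Fintype ι] [DecidableEq ι]
    (S : Matrix ι ι ℝ) (hS : S.det = 1) (a : ι) (v β : ι → ℝ) (hv : v a ≠ 0)
    (hβ : ∀ i, 0 < β i) (h : |v a| < ∏ i, if i = a then 1 else β i) :
    ∃ w : ι → ℤ, w ≠ 0 ∧ |v ⬝ᵥ (S *ᵥ fun j => (w j : ℝ))| < 1 ∧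
      ∀ i, i ≠ a → |(S *ᵥ fun j => (w j : ℝ)) i| < β i := by
  set B := (1 : Matrix ι ι ℝ).updateRow a v with hB
  have hdet : (B * S).det = v a := by rw [Matrix.det_mul, hS, det_one_updateRow, mul_one]
  obtain ⟨w, hw0, hw⟩ := exists_int_ne_zero_abs_mulVec_lt (B * S) (by rwa [hdet])
    (fun i => if i = a then 1 else β i) (fun i => by split_ifs <;> simp [hβ]) (by rwa [hdet])
  simp only [← Matrix.mulVec_mulVec] at hw
  refine ⟨w, hw0, ?_, fun i hi => ?_⟩
  · simpa [hB, Matrix.mulVec, Matrix.updateRow_self] using hw a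
  · have := hw i
    rw [if_neg hi] at this
    rwa [Matrix.mulVec, hB, Matrix.updateRow_ne hi, ← Matrix.mulVec, Matrix.one_mulVec] at this

/-- Minkowski's theorem with all but two of the coordinates bounded, plus two more linear forms. -/
lemma exists_int_ne_zero_of_two_linearForms {ι : Type*} [Fintype ι] [DecidableEq ι]
    (S : Matrix ι ι ℝ) (hS : S.det = 1) {a b : ι} (hab : a ≠ b) (v v' β : ι → ℝ)
    (hv : v a * v' b - v b * v' a ≠ 0)
    (hβ : ∀ i, 0 < β i)
    (h : |v a * v' b - v b * v' a| < ∏ i, if i = a ∨ i = b then 1 else β i) :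
    ∃ w : ι → ℤ, w ≠ 0 ∧ |v ⬝ᵥ (S *ᵥ fun j => (w j : ℝ))| < 1 ∧
      |v' ⬝ᵥ (S *ᵥ fun j => (w j : ℝ))| < 1 ∧
      ∀ i, i ≠ a → i ≠ b → |(S *ᵥ fun j => (w j : ℝ)) i| < β i := by
  set B := ((1 : Matrix ι ι ℝ).updateRow a v).updateRow b v' with hB
  have hdet : (B * S).det = v a * v' b - v b * v' a := by
    rw [Matrix.det_mul, hS, det_one_updateRow_updateRow hab, mul_one]
  obtain ⟨w, hw0, hw⟩ := exists_int_ne_zero_abs_mulVec_lt (B * S) (by rwa [hdet])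
    (fun i => if i = a ∨ i = b then 1 else β i) (fun i => by split_ifs <;> simp [hβ])
    (by rwa [hdet])
  simp only [← Matrix.mulVec_mulVec] at hw
  refine ⟨w, hw0, ?_, ?_, fun i hia hib => ?_⟩
  · have := hw a
    rwa [Matrix.mulVec, hB, Matrix.updateRow_ne hab, Matrix.updateRow_self,
      if_pos (Or.inl rfl)] at this
  · simpa [hB, Matrix.mulVec, Matrix.updateRow_self] using hw b
  · have := hw i
    rw [if_neg (by tauto)] at this
    rwa [Matrix.mulVec, hB, Matrix.updateRow_ne hib, Matrix.updateRow_ne hia, ← Matrix.mulVec,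
      Matrix.one_mulVec] at this

section Shear

variable {m : ℕ} (θ : Fin m → ℝ)

/-- The unimodular matrix of `(p, q) ↦ (p + q θ, q)`. -/
def simulMatrix : Matrix (Fin m ⊕ Unit) (Fin m ⊕ Unit) ℝ :=
  Matrix.fromBlocks 1 (Matrix.of fun i _ => θ i) 0 1

/-- The unimodular matrix of `(x, y) ↦ (x, ∑ j, θ j * x j + y)`. -/
def formMatrix : Matrix (Fin m ⊕ Unit) (Fin m ⊕ Unit) ℝ :=
  Matrix.fromBlocks 1 0 (Matrix.of fun _ i => θ i) 1

lemma det_simulMatrix : (simulMatrix θ).det = 1 := by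
  simp [simulMatrix]

lemma det_formMatrix : (formMatrix θ).det = 1 := by
  simp [formMatrix]

lemma simulMatrix_mulVec_inl (u : Fin m ⊕ Unit → ℝ) (i : Fin m) :
    (simulMatrix θ *ᵥ u) (Sum.inl i) = u (Sum.inl i) + θ i * u (Sum.inr ()) := by
  simp [simulMatrix, Matrix.mulVec, dotProduct, Matrix.one_apply]

lemma simulMatrix_mulVec_inr (u : Fin m ⊕ Unit → ℝ) :
    (simulMatrix θ *ᵥ u) (Sum.inr ()) = u (Sum.inr ()) := by
  simp [simulMatrix, Matrix.mulVec, dotProduct]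

lemma formMatrix_mulVec_inl (u : Fin m ⊕ Unit → ℝ) (i : Fin m) :
    (formMatrix θ *ᵥ u) (Sum.inl i) = u (Sum.inl i) := by
  simp [formMatrix, Matrix.mulVec, dotProduct, Matrix.one_apply]

lemma formMatrix_mulVec_inr (u : Fin m ⊕ Unit → ℝ) :
    (formMatrix θ *ᵥ u) (Sum.inr ()) = ∑ j, θ j * u (Sum.inl j) + u (Sum.inr ()) := by
  simp [formMatrix, Matrix.mulVec, dotProduct]

lemma sum_ne_zero_imp {w : Fin m ⊕ Unit → ℤ} (hw : w ≠ 0) :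
    ¬ ((fun i => w (Sum.inl i)) = 0 ∧ w (Sum.inr ()) = 0) := by
  rintro ⟨h1, h2⟩
  apply hw
  ext (i | i)
  · exact congrFun h1 i
  · exact h2

lemma exists_simul_of_form (a : Fin m) (v : Fin m → ℝ) (l T R : ℝ) (hT : 0 < T) (hR : 0 < R)
    (hv : v a ≠ 0) (h : |v a| < T * R ^ (m - 1)) :
    ∃ (p : Fin m → ℤ) (q : ℤ), ¬ (p = 0 ∧ q = 0) ∧ |(q : ℝ)| < T ∧
      (∀ i, i ≠ a → |p i + θ i * q| < R) ∧ |∑ i, v i * (p i + θ i * q) + l * q| < 1 := by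
  obtain ⟨w, hw0, hw1, hw⟩ := exists_int_ne_zero_of_linearForm (simulMatrix θ)
    (det_simulMatrix θ) (Sum.inl a) (Sum.elim v fun _ => l) (Sum.elim (fun _ => R) fun _ => T)
    (by simpa using hv) (by rintro (i | i) <;> simpa) (by
      have := prod_ite_mem_one_const {a} R
      simp only [Finset.mem_singleton, Fintype.card_fin, Finset.card_singleton] at this
      simpa [this, mul_comm] using h)
  refine ⟨fun i => w (Sum.inl i), w (Sum.inr ()), sum_ne_zero_imp hw0, ?_, fun i hi => ?_, ?_⟩
  · simpa [simulMatrix_mulVec_inr] using hw (Sum.inr ()) (by simp)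
  · simpa [simulMatrix_mulVec_inl] using hw (Sum.inl i) (by simpa)
  · simpa [dotProduct, simulMatrix_mulVec_inl, simulMatrix_mulVec_inr] using hw1

lemma exists_simul_of_two_forms {a b : Fin m} (hab : a ≠ b) (v v' : Fin m → ℝ) (l l' T R : ℝ)
    (hT : 0 < T) (hR : 0 < R) (hv : v a * v' b - v b * v' a ≠ 0)
    (h : |v a * v' b - v b * v' a| < T * R ^ (m - 2)) :
    ∃ (p : Fin m → ℤ) (q : ℤ), ¬ (p = 0 ∧ q = 0) ∧ |(q : ℝ)| < T ∧
      (∀ i, i ≠ a → i ≠ b → |p i + θ i * q| < R) ∧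
      |∑ i, v i * (p i + θ i * q) + l * q| < 1 ∧
      |∑ i, v' i * (p i + θ i * q) + l' * q| < 1 := by
  obtain ⟨w, hw0, hw1, hw2, hw⟩ := exists_int_ne_zero_of_two_linearForms (simulMatrix θ)
    (det_simulMatrix θ) (a := Sum.inl a) (b := Sum.inl b) (by simpa using hab)
    (Sum.elim v fun _ => l) (Sum.elim v' fun _ => l') (Sum.elim (fun _ => R) fun _ => T)
    (by simpa using hv) (by rintro (i | i) <;> simpa) (by
      have := prod_ite_mem_one_const {a, b} R
      simp only [Finset.mem_insert, Finset.mem_singleton, Fintype.card_fin,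
        Finset.card_pair hab] at this
      simpa [this, mul_comm] using h)
  refine ⟨fun i => w (Sum.inl i), w (Sum.inr ()), sum_ne_zero_imp hw0, ?_,
    fun i hi hi' => ?_, ?_, ?_⟩
  · simpa [simulMatrix_mulVec_inr] using hw (Sum.inr ()) (by simp) (by simp)
  · simpa [simulMatrix_mulVec_inl] using hw (Sum.inl i) (by simpa) (by simpa)
  · simpa [dotProduct, simulMatrix_mulVec_inl, simulMatrix_mulVec_inr] using hw1
  · simpa [dotProduct, simulMatrix_mulVec_inl, simulMatrix_mulVec_inr] using hw2

lemma exists_form_of_simul (a : Fin m) (v : Fin m → ℝ) (l H R : ℝ) (hH : 0 < H) (hR : 0 < R)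
    (hv : v a ≠ 0) (h : |v a| < H * R ^ (m - 1)) :
    ∃ (x : Fin m → ℤ) (y : ℤ), ¬ (x = 0 ∧ y = 0) ∧ |∑ j, θ j * x j + y| < H ∧
      (∀ i, i ≠ a → |(x i : ℝ)| < R) ∧
      |∑ i, v i * x i + l * (∑ j, θ j * x j + y)| < 1 := by
  obtain ⟨w, hw0, hw1, hw⟩ := exists_int_ne_zero_of_linearForm (formMatrix θ)
    (det_formMatrix θ) (Sum.inl a) (Sum.elim v fun _ => l) (Sum.elim (fun _ => R) fun _ => H)
    (by simpa using hv) (by rintro (i | i) <;> simpa) (by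
      have := prod_ite_mem_one_const {a} R
      simp only [Finset.mem_singleton, Fintype.card_fin, Finset.card_singleton] at this
      simpa [this, mul_comm] using h)
  refine ⟨fun i => w (Sum.inl i), w (Sum.inr ()), sum_ne_zero_imp hw0, ?_, fun i hi => ?_, ?_⟩
  · simpa [formMatrix_mulVec_inr] using hw (Sum.inr ()) (by simp)
  · simpa [formMatrix_mulVec_inl] using hw (Sum.inl i) (by simpa)
  · simpa [dotProduct, formMatrix_mulVec_inl, formMatrix_mulVec_inr] using hw1

lemma exists_form_of_simul_denominator (v : Fin m → ℝ) (l R : ℝ) (hR : 0 < R)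
    (hl : l ≠ 0) (h : |l| < R ^ m) :
    ∃ (x : Fin m → ℤ) (y : ℤ), ¬ (x = 0 ∧ y = 0) ∧ (∀ i, |(x i : ℝ)| < R) ∧
      |∑ i, v i * x i + l * (∑ j, θ j * x j + y)| < 1 := by
  obtain ⟨w, hw0, hw1, hw⟩ := exists_int_ne_zero_of_linearForm (formMatrix θ)
    (det_formMatrix θ) (Sum.inr ()) (Sum.elim v fun _ => l) (fun _ => R)
    (by simpa using hl) (by simpa) (by simpa using h)
  refine ⟨fun i => w (Sum.inl i), w (Sum.inr ()), sum_ne_zero_imp hw0, fun i => ?_, ?_⟩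
  · simpa [formMatrix_mulVec_inl] using hw (Sum.inl i) (by simp)
  · simpa [dotProduct, formMatrix_mulVec_inl, formMatrix_mulVec_inr] using hw1

lemma exists_form_of_two_simul (a : Fin m) (v v' : Fin m → ℝ) (l l' R : ℝ) (hR : 0 < R)
    (hv : v a * l' - l * v' a ≠ 0) (h : |v a * l' - l * v' a| < R ^ (m - 1)) :
    ∃ (x : Fin m → ℤ) (y : ℤ), ¬ (x = 0 ∧ y = 0) ∧ (∀ i, i ≠ a → |(x i : ℝ)| < R) ∧
      |∑ i, v i * x i + l * (∑ j, θ j * x j + y)| < 1 ∧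
      |∑ i, v' i * x i + l' * (∑ j, θ j * x j + y)| < 1 := by
  obtain ⟨w, hw0, hw1, hw2, hw⟩ := exists_int_ne_zero_of_two_linearForms (formMatrix θ)
    (det_formMatrix θ) (a := Sum.inl a) (b := Sum.inr ()) (by simp) (Sum.elim v fun _ => l)
    (Sum.elim v' fun _ => l') (fun _ => R) (by simpa using hv) (by simpa) (by
      have := prod_ite_mem_one_const {a} R
      simp only [Finset.mem_singleton, Fintype.card_fin, Finset.card_singleton] at this
      simpa [this] using h)
  refine ⟨fun i => w (Sum.inl i), w (Sum.inr ()), sum_ne_zero_imp hw0, fun i hi => ?_, ?_, ?_⟩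
  · simpa [formMatrix_mulVec_inl] using hw (Sum.inl i) (by simpa) (by simp)
  · simpa [dotProduct, formMatrix_mulVec_inl, formMatrix_mulVec_inr] using hw1
  · simpa [dotProduct, formMatrix_mulVec_inl, formMatrix_mulVec_inr] using hw2

end Shear

lemma Int.eq_zero_of_abs_cast_lt_one {k : ℤ} (h : |(k : ℝ)| < 1) : k = 0 := by
  rw [← Int.abs_lt_one_iff]; exact_mod_cast h

lemma abs_mul_le_of_sum_eq {m : ℕ} {c z : Fin m → ℝ} {e B : ℝ} (a : Fin m)
    (h : ∑ i, c i * z i = e) (hB : ∀ i, i ≠ a → |c i * z i| ≤ B) (hB0 : 0 ≤ B) :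
    |c a| * |z a| ≤ |e| + m * B := by
  rw [← Finset.add_sum_erase _ _ (Finset.mem_univ a)] at h
  have h1 : |∑ i ∈ Finset.univ.erase a, c i * z i| ≤ m * B := by
    refine (Finset.abs_sum_le_sum_abs _ _).trans ?_
    refine (Finset.sum_le_card_nsmul _ _ B fun i hi => hB i (Finset.ne_of_mem_erase hi)).trans ?_
    rw [nsmul_eq_mul]
    refine mul_le_mul_of_nonneg_right ?_ hB0
    exact_mod_cast (Finset.card_le_univ _).trans (by simp)
  rw [← abs_mul, show c a * z a = e - ∑ i ∈ Finset.univ.erase a, c i * z i by linarith]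
  exact (abs_sub _ _).trans (by linarith)

lemma simul_of_small {m : ℕ} {θ : Fin m → ℝ} {p : Fin m → ℤ} {q : ℤ} {T R : ℝ}
    (hne : ¬ (p = 0 ∧ q = 0)) (hq : |(q : ℝ)| < T) (hR : R < 1)
    (hz : ∀ i, |p i + θ i * q| ≤ R) :
    ∃ (q : ℤ) (p : Fin m → ℤ), q ≠ 0 ∧ |(q : ℝ)| ≤ T ∧ ∀ j, |θ j * q - p j| ≤ R := by
  refine ⟨q, -p, ?_, hq.le, fun j => ?_⟩
  · rintro rfl
    refine hne ⟨?_, rfl⟩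
    ext i
    exact Int.eq_zero_of_abs_cast_lt_one (by simpa using (hz i).trans_lt hR)
  · convert hz j using 2
    simp; ring

lemma form_of_small {m : ℕ} {θ : Fin m → ℝ} {x : Fin m → ℤ} {y : ℤ} {R H : ℝ}
    (hne : ¬ (x = 0 ∧ y = 0)) (hx : ∀ i, |(x i : ℝ)| ≤ R) (hH : H < 1)
    (hL : |∑ j, θ j * x j + y| ≤ H) :
    ∃ (x : Fin m → ℤ) (y : ℤ), x ≠ 0 ∧ (∀ j, |(x j : ℝ)| ≤ R) ∧ |∑ j, θ j * x j - y| ≤ H := by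
  refine ⟨x, -y, ?_, hx, by simpa using hL⟩
  rintro rfl
  refine hne ⟨rfl, ?_⟩
  exact Int.eq_zero_of_abs_cast_lt_one (by simpa using hL.trans_lt hH)

/-- The smallest integer point whose linear form is at most `ε`. -/
lemma exists_minimal_form {m : ℕ} {θ : Fin m → ℝ} {ε Y : ℝ}
    (h : ∃ (x : Fin m → ℤ) (y : ℤ), x ≠ 0 ∧ (∀ j, |(x j : ℝ)| ≤ Y) ∧ |∑ j, θ j * x j - y| ≤ ε) :
    ∃ (x : Fin m → ℤ) (y : ℤ) (a : Fin m), x a ≠ 0 ∧ (∀ j, |(x j : ℝ)| ≤ |(x a : ℝ)|) ∧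
      |(x a : ℝ)| ≤ Y ∧ |∑ j, θ j * x j - y| ≤ ε ∧
      ∀ (x' : Fin m → ℤ) (y' : ℤ), x' ≠ 0 → (∀ j, |(x' j : ℝ)| < |(x a : ℝ)|) →
        ¬ |∑ j, θ j * x' j - y'| ≤ ε := by
  classical
  have max_coord : ∀ x : Fin m → ℤ, x ≠ 0 → ∃ a, x a ≠ 0 ∧ ∀ j, |x j| ≤ |x a| := by
    intro x hx
    obtain ⟨i, hi⟩ := Function.ne_iff.1 hx
    obtain ⟨a, -, ha⟩ := Finset.exists_max_image Finset.univ (fun j => |x j|) ⟨i, Finset.mem_univ i⟩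
    refine ⟨a, fun h0 => hi ?_, fun j => ha j (Finset.mem_univ j)⟩
    simpa [h0] using ha i (Finset.mem_univ i)
  set P : ℕ → Prop := fun k => ∃ (x : Fin m → ℤ) (y : ℤ), x ≠ 0 ∧
    (∀ j, |x j| ≤ (k : ℤ)) ∧ |∑ j, θ j * x j - y| ≤ ε with hP
  have hPY : ∀ (x : Fin m → ℤ) (y : ℤ), x ≠ 0 → |∑ j, θ j * x j - y| ≤ ε → ∀ a, (∀ j, |x j| ≤ |x a|) →
      P (x a).natAbs := by
    intro x y hx hL a ha
    exact ⟨x, y, hx, by simpa using ha, hL⟩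
  obtain ⟨x₀, y₀, hx₀, hxY, hL₀⟩ := h
  obtain ⟨a₀, ha₀, ham₀⟩ := max_coord x₀ hx₀
  have hex : ∃ k, P k := ⟨_, hPY x₀ y₀ hx₀ hL₀ a₀ ham₀⟩
  obtain ⟨x, y, hx, hxk, hL⟩ := Nat.find_spec hex
  obtain ⟨a, ha, ham⟩ := max_coord x hx
  have h1 : Nat.find hex ≤ (x a).natAbs := Nat.find_min' hex (hPY x y hx hL a ham)
  have h2 : (x a).natAbs ≤ Nat.find hex := by
    have := hxk a
    rw [Int.abs_eq_natAbs] at this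
    omega
  refine ⟨x, y, a, ha, fun j => by exact_mod_cast ham j, ?_, hL, fun x' y' hx' hlt hL' => ?_⟩
  · refine le_trans ?_ (hxY a₀)
    have h3 := Nat.find_min' hex (hPY x₀ y₀ hx₀ hL₀ a₀ ham₀)
    have : |x a| ≤ |x₀ a₀| := by rw [Int.abs_eq_natAbs, Int.abs_eq_natAbs]; omega
    exact_mod_cast this
  · obtain ⟨a', ha', ham'⟩ := max_coord x' hx'
    have h3 := Nat.find_min' hex (hPY x' y' hx' hL' a' ham')
    have : |x' a'| < |x a| := by exact_mod_cast hlt a'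
    rw [Int.abs_eq_natAbs, Int.abs_eq_natAbs] at this
    omega

lemma exists_simul_of_uniform_form_aux {m : ℕ} (hm : 2 ≤ m) (θ : Fin m → ℝ) {Y T R : ℝ}
    (hT : 0 < T) (hR : 0 < R) (hR1 : (m + 1) * R < 1) (hY : 0 < Y)
    (hYTR : 8 * Y ≤ T * R ^ (m - 1))
    (h : ∃ (x : Fin m → ℤ) (y : ℤ), x ≠ 0 ∧ (∀ j, |(x j : ℝ)| ≤ Y) ∧
      |∑ j, θ j * x j - y| ≤ 1 / T)
    (hnext : ∀ e : ℝ, 0 < e → e ≤ 1 / T → ∃ (x : Fin m → ℤ) (y : ℤ) (t : ℝ), x ≠ 0 ∧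
      (∀ j, |(x j : ℝ)| ≤ t) ∧ |∑ j, θ j * x j - y| ≤ e / 2 ∧ Y ≤ t ∧ e * t * T ≤ 2 * Y) :
    ∃ (q : ℤ) (p : Fin m → ℤ), q ≠ 0 ∧ |(q : ℝ)| ≤ T ∧
      ∀ j, |θ j * q - p j| ≤ (m + 1) * R := by
  classical
  obtain ⟨x, y, a, hxa, hxm, hxY, hL, hmin⟩ := exists_minimal_form h
  have hm0 : (0 : ℝ) < m := by positivity
  have key : ∀ (x : Fin m → ℤ) (y : ℤ) (p : Fin m → ℤ) (q : ℤ),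
      |∑ i, (x i : ℝ) * (p i + θ i * q) + -(∑ j, θ j * x j - y) * q| < 1 →
      ∑ i, (x i : ℝ) * (p i + θ i * q) = (∑ j, θ j * x j - y) * q := by
    intro x y p q hlt
    have heq : ∑ i, (x i : ℝ) * (p i + θ i * q) + -(∑ j, θ j * x j - y) * q =
        ((∑ i, x i * p i + y * q : ℤ) : ℝ) := by
      push_cast
      simp only [mul_add, Finset.sum_add_distrib, neg_mul, sub_mul, Finset.sum_mul]
      have : ∑ i, (x i : ℝ) * (θ i * q) = ∑ i, θ i * x i * q :=
        Finset.sum_congr rfl fun i _ => by ring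
      rw [this]; ring
    rw [heq] at hlt
    rw [Int.eq_zero_of_abs_cast_lt_one hlt, Int.cast_zero] at heq
    linarith
  set L : ℝ := ∑ j, θ j * x j - y with hLdef
  set X : ℝ := |(x a : ℝ)| with hX
  have hX0 : 0 < X := abs_pos.2 (by exact_mod_cast hxa)
  have hLT : |L| * T ≤ 1 := by rwa [le_div_iff₀ hT] at hL
  have hRpow : R ^ (m - 1) = R ^ (m - 2) * R := by
    rw [← pow_succ]; congr 1; omega
  rcases le_or_gt (|L| * T) (R * X) with hcase | hcase
  · obtain ⟨p, q, hne, hq, hz, hform⟩ := exists_simul_of_form θ a (fun i => (x i : ℝ)) (-L) T R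
      hT hR (by exact_mod_cast hxa) (by show X < _; linarith)
    have hs := key x y p q hform
    refine simul_of_small hne hq hR1 fun i => ?_
    by_cases hi : i = a
    · subst hi
      have := abs_mul_le_of_sum_eq (B := X * R) i hs (fun j hj => by
        rw [abs_mul]
        exact mul_le_mul (hxm j) (hz j hj).le (abs_nonneg _) hX0.le) (by positivity)
      rw [abs_mul] at this
      have h2 : |L| * |(q : ℝ)| ≤ |L| * T := mul_le_mul_of_nonneg_left hq.le (abs_nonneg _)
      refine le_of_mul_le_mul_left (a := X) ?_ hX0
      linarith
    · exact (hz i hi).le.trans (by nlinarith)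
  · have hLpos : 0 < |L| := by
      by_contra hcon
      have : |L| = 0 := le_antisymm (not_lt.1 hcon) (abs_nonneg _)
      rw [this, zero_mul] at hcase
      have : 0 < R * X := by positivity
      linarith
    obtain ⟨x', y', t, hx', hxt, hL', hYt, htT⟩ := hnext |L| hLpos hL
    set L' : ℝ := ∑ j, θ j * x' j - y' with hL'def
    have ht0 : 0 < t := hY.trans_le hYt
    have hLt : 4 * (|L| * t) ≤ R ^ (m - 1) := by
      refine le_of_mul_le_mul_left (a := T) ?_ hT
      linarith
    have hRlt : R < 1 := by nlinarith
    have hLt1 : 4 * (|L| * t) < 1 :=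
      hLt.trans_lt (pow_lt_one₀ hR.le hRlt (by omega))
    obtain ⟨⟨a', b⟩, -, hmax⟩ := Finset.exists_max_image (Finset.univ : Finset (Fin m × Fin m))
      (fun i => |(x i.1 : ℝ) * x' i.2 - x i.2 * x' i.1|) ⟨(a, a), Finset.mem_univ _⟩
    replace hmax : ∀ i j, |(x i : ℝ) * x' j - x j * x' i| ≤
      |(x a' : ℝ) * x' b - x b * x' a'| := fun i j => hmax (i, j) (Finset.mem_univ _)
    set D : ℝ := (x a' : ℝ) * x' b - x b * x' a' with hD
    have hE : ∀ b, |L * x' b - L' * x b| ≤ 2 * (|L| * t) := by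
      intro b
      refine (abs_sub _ _).trans ?_
      rw [abs_mul, abs_mul]
      have h1 : |L| * |(x' b : ℝ)| ≤ |L| * t := mul_le_mul_of_nonneg_left (hxt b) (abs_nonneg _)
      have h2 : |L'| * |(x b : ℝ)| ≤ |L| / 2 * t :=
        mul_le_mul hL' ((hxm b).trans (hxY.trans hYt)) (abs_nonneg _) (by positivity)
      nlinarith
    have hD0 : D ≠ 0 := by
      intro h0
      have hpar : ∀ i j, (x i : ℝ) * x' j = x j * x' i := by
        intro i j
        have := hmax i j
        rw [h0, abs_zero] at this
        have := abs_nonpos_iff.1 this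
        linarith
      have hminor : (x' a : ℝ) * L - x a * L' = ((x a * y' - x' a * y : ℤ) : ℝ) := by
        rw [hLdef, hL'def, mul_sub, mul_sub, Finset.mul_sum, Finset.mul_sum]
        have : ∑ i, (x' a : ℝ) * (θ i * x i) = ∑ i, (x a : ℝ) * (θ i * x' i) :=
          Finset.sum_congr rfl fun i _ => by linear_combination θ i * hpar i a
        rw [this]; push_cast; ring
      have hsmall : |(x' a : ℝ) * L - x a * L'| < 1 := by
        refine (abs_sub _ _).trans_lt ?_
        rw [abs_mul, abs_mul]
        have h1 : |(x' a : ℝ)| * |L| ≤ t * |L| := mul_le_mul_of_nonneg_right (hxt a) (abs_nonneg _)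
        have h2 : |(x a : ℝ)| * |L'| ≤ t * (|L| / 2) :=
          mul_le_mul (hxY.trans hYt) hL' (abs_nonneg _) ht0.le
        nlinarith
      rw [hminor] at hsmall
      rw [Int.eq_zero_of_abs_cast_lt_one hsmall, Int.cast_zero, sub_eq_zero] at hminor
      have habs : |(x' a : ℝ)| * |L| = X * |L'| := by rw [← abs_mul, hminor, abs_mul]
      have hhalf : |(x' a : ℝ)| ≤ X / 2 := by
        refine le_of_mul_le_mul_right (a := |L|) ?_ hLpos
        rw [habs]; nlinarith
      refine hmin x' y' hx' (fun j => ?_) (hL'.trans (by linarith))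
      have h3 : X * |(x' j : ℝ)| ≤ X * (X / 2) := by
        rw [hX, ← abs_mul, hpar a j, abs_mul]
        exact mul_le_mul (hxm j) hhalf (abs_nonneg _) hX0.le
      have h4 := le_of_mul_le_mul_left h3 hX0
      change |(x' j : ℝ)| < X
      linarith
    have hab : a' ≠ b := by
      rintro rfl
      exact hD0 (by rw [hD]; ring)
    have hDpos : 0 < |D| := abs_pos.2 hD0
    have hDle : |D| * R ≤ 4 * Y := by
      have h1 : |D| ≤ 2 * (X * t) := by
        rw [hD]
        refine (abs_sub _ _).trans ?_
        rw [abs_mul, abs_mul]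
        have h1 : |(x a' : ℝ)| * |(x' b : ℝ)| ≤ X * t :=
          mul_le_mul (hxm _) (hxt _) (abs_nonneg _) hX0.le
        have h2 : |(x b : ℝ)| * |(x' a' : ℝ)| ≤ X * t :=
          mul_le_mul (hxm _) (hxt _) (abs_nonneg _) hX0.le
        linarith
      have h2 : |D| * R ≤ 2 * (X * t) * R := mul_le_mul_of_nonneg_right h1 hR.le
      have h3 : R * X * t ≤ |L| * T * t := mul_le_mul_of_nonneg_right hcase.le ht0.le
      nlinarith
    set P : ℝ := R ^ (m - 2) with hP
    have hP0 : 0 < P := by positivity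
    have hT'T : 2 * |D| / P ≤ T := by
      rw [div_le_iff₀ hP0]
      refine le_of_mul_le_mul_right (a := R) ?_ hR
      rw [hRpow] at hYTR
      linarith
    have hT'0 : 0 < 2 * |D| / P := by positivity
    obtain ⟨p, q, hne, hq, hz, hform, hform'⟩ := exists_simul_of_two_forms θ hab
      (fun i => (x i : ℝ)) (fun i => (x' i : ℝ)) (-L) (-L') (2 * |D| / P) R hT'0 hR hD0
      (by rw [div_mul_cancel₀ _ hP0.ne']; change |D| < _; linarith)
    have hs := key x y p q hform
    have hs' := key x' y' p q hform'
    rw [← hLdef] at hs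
    rw [← hL'def] at hs'
    have hqE : 2 * (|L| * t) * |(q : ℝ)| ≤ |D| * R := by
      refine (mul_le_mul_of_nonneg_left hq.le (by positivity)).trans ?_
      rw [← mul_div_assoc, div_le_iff₀ hP0]
      rw [hRpow] at hLt
      linarith [mul_le_mul_of_nonneg_left hLt hDpos.le]
    have hcoord : ∀ c d : Fin m, (∀ i, i ≠ c → i ≠ d → |p i + θ i * q| < R) →
        |(x c : ℝ) * x' d - x d * x' c| = |D| → |p c + θ c * q| ≤ (m + 1) * R := by
      intro c d hzcd hcd
      have hcomb : ∑ j, ((x j : ℝ) * x' d - x d * x' j) * (p j + θ j * q) =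
          (L * x' d - L' * x d) * q := by
        rw [show (L * x' d - L' * x d) * q = x' d * (L * q) - x d * (L' * q) by ring, ← hs, ← hs',
          Finset.mul_sum, Finset.mul_sum, ← Finset.sum_sub_distrib]
        exact Finset.sum_congr rfl fun j _ => by ring
      have h1 := abs_mul_le_of_sum_eq (B := |D| * R) c hcomb (fun j hj => by
        by_cases hjd : j = d
        · subst hjd
          rw [show (x j : ℝ) * x' j - x j * x' j = 0 by ring, zero_mul, abs_zero]
          positivity
        · rw [abs_mul]
          exact mul_le_mul (hmax j d) (hzcd j hj hjd).le (abs_nonneg _) (abs_nonneg _))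
        (by positivity)
      have h2 : |(L * x' d - L' * x d) * q| ≤ |D| * R := by
        rw [abs_mul]
        exact (mul_le_mul_of_nonneg_right (hE d) (abs_nonneg _)).trans hqE
      rw [hcd] at h1
      refine le_of_mul_le_mul_left (a := |D|) ?_ hDpos
      linarith
    refine simul_of_small hne (hq.trans_le hT'T) hR1 fun i => ?_
    by_cases hia : i = a'
    · subst hia
      exact hcoord i b hz rfl
    · by_cases hib : i = b
      · subst hib
        refine hcoord i a' (fun j hj hj' => hz j hj' hj) ?_
        rw [← abs_neg, hD]; congr 1; ring
      · exact (hz i hia hib).le.trans (by nlinarith)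

/-- The smallest denominator whose simultaneous approximations are at most `ε`. -/
lemma exists_minimal_simul {m : ℕ} {θ : Fin m → ℝ} {ε N : ℝ}
    (h : ∃ (q : ℤ) (p : Fin m → ℤ), q ≠ 0 ∧ |(q : ℝ)| ≤ N ∧ ∀ j, |θ j * q - p j| ≤ ε) :
    ∃ (q : ℤ) (p : Fin m → ℤ), q ≠ 0 ∧ |(q : ℝ)| ≤ N ∧ (∀ j, |θ j * q - p j| ≤ ε) ∧
      ∀ (q' : ℤ) (p' : Fin m → ℤ), q' ≠ 0 → |(q' : ℝ)| < |(q : ℝ)| →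
        ¬ ∀ j, |θ j * q' - p' j| ≤ ε := by
  classical
  set P : ℕ → Prop := fun k => ∃ (q : ℤ) (p : Fin m → ℤ), q ≠ 0 ∧ q.natAbs = k ∧
    ∀ j, |θ j * q - p j| ≤ ε
  obtain ⟨q₀, p₀, hq₀, hqN, hz₀⟩ := h
  have hex : ∃ k, P k := ⟨_, q₀, p₀, hq₀, rfl, hz₀⟩
  obtain ⟨q, p, hq, hqk, hz⟩ := Nat.find_spec hex
  refine ⟨q, p, hq, le_trans ?_ hqN, hz, fun q' p' hq' hlt hz' => ?_⟩
  · have h3 := Nat.find_min' hex ⟨q₀, p₀, hq₀, rfl, hz₀⟩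
    have : |q| ≤ |q₀| := by rw [Int.abs_eq_natAbs, Int.abs_eq_natAbs]; omega
    exact_mod_cast this
  · have h3 := Nat.find_min' hex ⟨q', p', hq', rfl, hz'⟩
    have : |q'| < |q| := by exact_mod_cast hlt
    rw [Int.abs_eq_natAbs, Int.abs_eq_natAbs] at this
    omega

lemma exists_form_of_uniform_simul_aux {m : ℕ} (hm : 2 ≤ m) (θ : Fin m → ℝ) {X H ε : ℝ}
    (hX : 0 < X) (hH : 0 < H) (hH1 : 4 * m ^ 2 * H < 1) (hε : ε ≤ X ^ (m - 1) * H)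
    (h : ∃ (q : ℤ) (p : Fin m → ℤ), q ≠ 0 ∧ |(q : ℝ)| ≤ 1 / H ∧ ∀ j, |θ j * q - p j| ≤ ε)
    (hnext : ∀ k : ℝ, X ^ m < k → k ≤ 1 / H → ∃ (q : ℤ) (p : Fin m → ℤ) (ρ : ℝ), q ≠ 0 ∧
      |(q : ℝ)| ≤ k / 2 ∧ (∀ j, |θ j * q - p j| ≤ ρ) ∧ k * ρ ≤ 2 * X ^ (m - 1)) :
    ∃ (x : Fin m → ℤ) (y : ℤ), x ≠ 0 ∧ (∀ j, |(x j : ℝ)| ≤ 4 * m ^ 2 * X) ∧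
      |∑ j, θ j * x j - y| ≤ 4 * m ^ 2 * H := by
  classical
  obtain ⟨q, p, hq0, hqN, hz, hmin⟩ := exists_minimal_simul h
  have hm2 : (2 : ℝ) ≤ m := by exact_mod_cast hm
  have : Nonempty (Fin m) := ⟨⟨0, by omega⟩⟩
  have key : ∀ (q : ℤ) (p : Fin m → ℤ) (x : Fin m → ℤ) (y : ℤ),
      |∑ i, -(θ i * q - p i) * x i + q * (∑ j, θ j * x j + y)| < 1 →
      ∑ i, (θ i * q - p i) * x i = q * (∑ j, θ j * x j + y) := by
    intro q p x y hlt
    have heq : ∑ i, -(θ i * q - p i) * x i + q * (∑ j, θ j * x j + y) =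
        ((∑ i, p i * x i + q * y : ℤ) : ℝ) := by
      push_cast
      rw [mul_add, Finset.mul_sum, ← add_assoc, ← Finset.sum_add_distrib]
      congr 1
      exact Finset.sum_congr rfl fun i _ => by ring
    have hneg : ∑ i, -(θ i * q - p i) * (x i : ℝ) = -∑ i, (θ i * q - p i) * (x i : ℝ) := by
      rw [← Finset.sum_neg_distrib]
      exact Finset.sum_congr rfl fun i _ => by ring
    rw [heq] at hlt
    rw [Int.eq_zero_of_abs_cast_lt_one hlt, Int.cast_zero, hneg] at heq
    linarith
  set Q : ℝ := |(q : ℝ)| with hQ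
  have hQ0 : 0 < Q := abs_pos.2 (by exact_mod_cast hq0)
  set z : Fin m → ℝ := fun i => θ i * q - p i with hzdef
  have hQH : Q * H ≤ 1 := by rwa [le_div_iff₀ hH] at hqN
  have hXpow : X ^ m = X ^ (m - 1) * X := by rw [← pow_succ]; congr 1; omega
  have hXm : 0 < X ^ (m - 1) := by positivity
  obtain ⟨a, -, ha⟩ := Finset.exists_max_image Finset.univ (fun i => |z i|) Finset.univ_nonempty
  replace ha : ∀ i, |z i| ≤ |z a| := fun i => ha i (Finset.mem_univ i)
  have hbound : ∀ (x : Fin m → ℤ) (Λ B : ℝ), ∑ i, z i * x i = q * Λ → 0 ≤ B →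
      (∀ i, |(x i : ℝ)| ≤ B) → Q * |Λ| ≤ m * (|z a| * B) := by
    intro x Λ B hs hB hx
    rw [hQ, ← abs_mul, ← hs]
    refine (Finset.abs_sum_le_sum_abs _ _).trans ?_
    refine (Finset.sum_le_card_nsmul _ _ (|z a| * B) fun i _ => ?_).trans (by simp)
    rw [abs_mul]
    exact mul_le_mul (ha i) (hx i) (abs_nonneg _) (abs_nonneg _)
  rcases le_or_gt Q (X ^ m) with hcase | hcase
  · rcases le_or_gt (Q * H) (X * |z a|) with hcase' | hcase'
    · have hz0 : 0 < |z a| := by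
        by_contra hcon
        have h0 : |z a| = 0 := le_antisymm (not_lt.1 hcon) (abs_nonneg _)
        rw [h0, mul_zero] at hcase'
        have : 0 < Q * H := by positivity
        linarith
      obtain ⟨x, y, hne, hL, hx, hform⟩ := exists_form_of_simul θ a (fun i => -z i) q (2 * H) X
        (by positivity) hX (by simpa using hz0) (by
          rw [abs_neg]
          have h1 := hz a
          have h2 : 0 < X ^ (m - 1) * H := by positivity
          change |z a| ≤ _ at h1
          linarith)
      have hs := key q p x y hform
      refine form_of_small hne (fun i => ?_) hH1
        (hL.le.trans (mul_le_mul_of_nonneg_right (by nlinarith) hH.le))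
      by_cases hi : i = a
      · subst hi
        have h1 := abs_mul_le_of_sum_eq (B := |z i| * X) i hs (fun j hj => by
          rw [abs_mul]
          exact mul_le_mul (ha j) (hx j hj).le (abs_nonneg _) (abs_nonneg _)) (by positivity)
        rw [abs_mul] at h1
        have h2 : Q * |∑ j, θ j * (x j : ℝ) + y| ≤ Q * (2 * H) :=
          mul_le_mul_of_nonneg_left hL.le hQ0.le
        refine le_of_mul_le_mul_left (a := |z i|) ?_ hz0
        have h3 : 0 < |z i| * X := by positivity
        change |z i| * _ ≤ _ at h1
        have h4 : (m + 2) * (|z i| * X) ≤ 4 * m ^ 2 * (|z i| * X) :=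
          mul_le_mul_of_nonneg_right (by nlinarith) h3.le
        linarith
      · exact (hx i hi).le.trans (le_mul_of_one_le_left hX.le (by nlinarith))
    · obtain ⟨x, y, hne, hx, hform⟩ := exists_form_of_simul_denominator θ (fun i => -z i) q (2 * X)
        (by positivity) (by exact_mod_cast hq0) (by
          rw [mul_pow]
          have h1 : (2 : ℝ) ≤ 2 ^ m := by
            simpa using pow_le_pow_right₀ (one_le_two : (1 : ℝ) ≤ 2) (show 1 ≤ m by omega)
          have h2 : 0 < X ^ m := by positivity
          change Q < _
          nlinarith)
      have hs := key q p x y hform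
      have h1 := hbound x _ (2 * X) hs (by positivity) fun i => (hx i).le
      refine form_of_small hne (fun i => (hx i).le.trans ?_) hH1 ?_
      · exact mul_le_mul_of_nonneg_right (by nlinarith) hX.le
      · refine le_of_mul_le_mul_left (a := Q) ?_ hQ0
        have h2 : 2 * m * (X * |z a|) ≤ 2 * m * (Q * H) :=
          mul_le_mul_of_nonneg_left hcase'.le (by positivity)
        have h3 : 2 * m * (Q * H) ≤ 4 * m ^ 2 * (Q * H) :=
          mul_le_mul_of_nonneg_right (by nlinarith) (by positivity)
        linarith
  · obtain ⟨q', p', ρ, hq'0, hq', hz', hρ⟩ := hnext Q hcase hqN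
    set z' : Fin m → ℝ := fun i => θ i * q' - p' i with hz'def
    obtain ⟨b, -, hb⟩ := Finset.exists_max_image Finset.univ
      (fun i => |z i * q' - q * z' i|) Finset.univ_nonempty
    replace hb : ∀ i, |z i * q' - q * z' i| ≤ |z b * q' - q * z' b| :=
      fun i => hb i (Finset.mem_univ i)
    set D : ℝ := z b * q' - q * z' b with hD
    have hD0 : D ≠ 0 := by
      intro h0
      refine hmin q' p' hq'0 (lt_of_le_of_lt hq' (by linarith)) fun j => ?_
      have h1 := hb j
      rw [h0, abs_zero] at h1
      have h2 : Q * |z' j| = |z j| * |(q' : ℝ)| := by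
        rw [hQ, ← abs_mul, ← abs_mul, sub_eq_zero.1 (abs_nonpos_iff.1 h1)]
      have h3 : |z j| * |(q' : ℝ)| ≤ |z j| * (Q / 2) :=
        mul_le_mul_of_nonneg_left hq' (abs_nonneg _)
      have h4 : |z' j| ≤ |z j| / 2 := by
        refine le_of_mul_le_mul_left (a := Q) ?_ hQ0
        linarith
      have h5 := abs_nonneg (z j)
      have h6 : |z j| ≤ ε := hz j
      change |z' j| ≤ ε
      linarith
    have hDpos : 0 < |D| := abs_pos.2 hD0
    have hDle : |D| ≤ 3 * X ^ (m - 1) := by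
      refine (abs_sub _ _).trans ?_
      rw [abs_mul, abs_mul]
      have h1 : |z b| * |(q' : ℝ)| ≤ X ^ (m - 1) * H * (Q / 2) :=
        mul_le_mul ((hz b).trans hε) hq' (abs_nonneg _) (by positivity)
      have h2 : Q * |z' b| ≤ Q * ρ := mul_le_mul_of_nonneg_left (hz' b) hQ0.le
      have h3 : X ^ (m - 1) * (Q * H) ≤ X ^ (m - 1) * 1 := mul_le_mul_of_nonneg_left hQH hXm.le
      linarith
    obtain ⟨x, y, hne, hx, hform, hform'⟩ := exists_form_of_two_simul θ b (fun i => -z i)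
      (fun i => -z' i) q q' (4 * X) (by positivity)
      (by rw [show -z b * q' - q * -z' b = -D by rw [hD]; ring]; simpa using hD0) (by
        rw [show -z b * q' - q * -z' b = -D by rw [hD]; ring, abs_neg, mul_pow]
        have h1 : (4 : ℝ) ≤ 4 ^ (m - 1) := by
          simpa using pow_le_pow_right₀ (by norm_num : (1 : ℝ) ≤ 4) (show 1 ≤ m - 1 by omega)
        nlinarith)
    have hs := key q p x y hform
    have hs' := key q' p' x y hform'
    set Λ : ℝ := ∑ j, θ j * (x j : ℝ) + y with hΛ
    have hx' : ∀ i, |(x i : ℝ)| ≤ 4 * m * X := by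
      intro i
      by_cases hi : i = b
      · subst hi
        have hcomb : ∑ j, (z j * q' - q * z' j) * x j = 0 := by
          have : ∑ j, (z j * q' - q * z' j) * (x j : ℝ) =
              q' * ∑ j, z j * (x j : ℝ) - q * ∑ j, z' j * (x j : ℝ) := by
            rw [Finset.mul_sum, Finset.mul_sum, ← Finset.sum_sub_distrib]
            exact Finset.sum_congr rfl fun j _ => by ring
          rw [this]
          linear_combination (q' : ℝ) * hs - (q : ℝ) * hs'
        have h1 := abs_mul_le_of_sum_eq (B := |D| * (4 * X)) i hcomb (fun j hj => by
          rw [abs_mul]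
          exact mul_le_mul (hb j) (hx j hj).le (abs_nonneg _) (abs_nonneg _)) (by positivity)
        rw [abs_zero, zero_add] at h1
        refine le_of_mul_le_mul_left (a := |D|) ?_ hDpos
        linarith
      · exact (hx i hi).le.trans (mul_le_mul_of_nonneg_right (by linarith) hX.le)
    refine form_of_small hne (fun i => (hx' i).trans ?_) hH1 ?_
    · exact mul_le_mul_of_nonneg_right (by nlinarith) hX.le
    · have h1 := hbound x _ (4 * m * X) hs (by positivity) hx'
      refine le_of_mul_le_mul_left (a := Q) ?_ hQ0
      refine h1.trans ?_
      have h2 : |z a| ≤ X ^ (m - 1) * H := (hz a).trans hε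
      have h3 : |z a| * X ≤ Q * H := by
        calc |z a| * X ≤ X ^ (m - 1) * H * X := mul_le_mul_of_nonneg_right h2 hX.le
          _ = X ^ m * H := by rw [hXpow]; ring
          _ ≤ Q * H := mul_le_mul_of_nonneg_right hcase.le hH.le
      have h4 := mul_le_mul_of_nonneg_left h3 (show (0 : ℝ) ≤ 4 * m ^ 2 by positivity)
      linarith

lemma eventually_mul_rpow_neg_lt {c δ δ' : ℝ} (h : δ' < δ) :
    ∀ᶠ t : ℝ in atTop, c * t ^ (-δ) < t ^ (-δ') := by
  have h1 : Tendsto (fun t : ℝ => c * t ^ (-(δ - δ'))) atTop (nhds (c * 0)) :=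
    (tendsto_rpow_neg_atTop (sub_pos.2 h)).const_mul c
  rw [mul_zero] at h1
  filter_upwards [h1.eventually_lt_const one_pos, eventually_gt_atTop 0] with t ht ht0
  have h2 : t ^ (-δ) = t ^ (-(δ - δ')) * t ^ (-δ') := by
    rw [← Real.rpow_add ht0]; congr 1; ring
  have h3 : 0 < t ^ (-δ') := Real.rpow_pos_of_pos ht0 _
  rw [h2, ← mul_assoc]
  nlinarith

lemma eventually_simul_of_eventually_form {m : ℕ} (hm : 2 ≤ m) (θ : Fin m → ℝ) {γ δ : ℝ}
    (hγ : 1 < γ) (hδ0 : 0 < δ) (hδ : δ < (1 - 1 / γ) / (m - 1))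
    (h : ∀ᶠ t : ℝ in atTop, ∃ (x : Fin m → ℤ) (y : ℤ), x ≠ 0 ∧ (∀ j, |(x j : ℝ)| ≤ t) ∧
      |∑ j, θ j * x j - y| ≤ t ^ (-γ)) :
    ∀ᶠ t : ℝ in atTop, ∃ (q : ℤ) (p : Fin m → ℤ), q ≠ 0 ∧ |(q : ℝ)| ≤ t ∧
      ∀ j, |θ j * q - p j| ≤ t ^ (-δ) := by
  obtain ⟨t₀, ht₀⟩ := eventually_atTop.1 h
  have hm2 : (2 : ℝ) ≤ m := by exact_mod_cast hm
  have hγ0 : 0 < γ := by linarith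
  have hγi : 0 < 1 / γ := by positivity
  set δ₁ : ℝ := (1 - 1 / γ) / (m - 1) with hδ₁
  filter_upwards [eventually_mul_rpow_neg_lt (c := (m + 1) * 8) hδ, eventually_ge_atTop 1,
    (tendsto_rpow_atTop hγi).eventually_ge_atTop t₀] with T hTδ hT1 hTt₀
  have hT : 0 < T := by linarith
  have hR : 0 < 8 * T ^ (-δ₁) := by have := Real.rpow_pos_of_pos hT (-δ₁); positivity
  have hY : 0 < T ^ (1 / γ) := Real.rpow_pos_of_pos hT _
  have hYγ : (T ^ (1 / γ)) ^ γ = T := by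
    rw [← Real.rpow_mul hT.le, one_div_mul_cancel hγ0.ne', Real.rpow_one]
  have hTδ1 : T ^ (-δ) ≤ 1 := Real.rpow_le_one_of_one_le_of_nonpos hT1 (by linarith)
  have hYTR : 8 * T ^ (1 / γ) ≤ T * (8 * T ^ (-δ₁)) ^ (m - 1) := by
    have h1 : (T ^ (-δ₁)) ^ (m - 1) = T ^ (1 / γ) * T⁻¹ := by
      rw [← Real.rpow_natCast, ← Real.rpow_mul hT.le, ← Real.rpow_neg_one T,
        ← Real.rpow_add hT, Nat.cast_sub (by omega), Nat.cast_one, hδ₁, neg_mul,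
        div_mul_cancel₀ _ (by linarith)]
      congr 1; ring
    have h2 : (8 : ℝ) ≤ 8 ^ (m - 1) := by
      simpa using pow_le_pow_right₀ (by norm_num : (1 : ℝ) ≤ 8) (show 1 ≤ m - 1 by omega)
    rw [mul_pow, h1]
    calc 8 * T ^ (1 / γ) ≤ 8 ^ (m - 1) * T ^ (1 / γ) := mul_le_mul_of_nonneg_right h2 hY.le
      _ = _ := by field_simp
  obtain ⟨q, p, hq, hqT, hz⟩ := exists_simul_of_uniform_form_aux hm θ hT hR (by linarith) hY hYTR
    (by
      obtain ⟨x, y, hx, hxt, hL⟩ := ht₀ _ hTt₀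
      refine ⟨x, y, hx, hxt, hL.trans_eq ?_⟩
      rw [Real.rpow_neg hY.le, hYγ, one_div])
    (fun e he heT => by
      have h2e : 0 < 2 / e := by positivity
      have hTe : T ≤ 2 / e := by
        rw [le_div_iff₀ hT] at heT
        rw [le_div_iff₀ he]
        linarith
      have hYt : T ^ (1 / γ) ≤ (2 / e) ^ (1 / γ) := Real.rpow_le_rpow hT.le hTe hγi.le
      have htγ : ((2 / e) ^ (1 / γ)) ^ γ = 2 / e := by
        rw [← Real.rpow_mul h2e.le, one_div_mul_cancel hγ0.ne', Real.rpow_one]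
      obtain ⟨x, y, hx, hxt, hL⟩ := ht₀ _ (hTt₀.trans hYt)
      refine ⟨x, y, _, hx, hxt, hL.trans_eq ?_, hYt, ?_⟩
      · rw [Real.rpow_neg (by positivity), htγ, inv_div]
      · have h1 : 1 ≤ (2 / e) ^ (1 / γ) / T ^ (1 / γ) := (one_le_div hY).2 hYt
        have h2 := Real.rpow_le_rpow_of_exponent_le h1 hγ.le
        rw [Real.rpow_one, Real.div_rpow (by positivity) hY.le, htγ, hYγ, div_le_iff₀ hY,
          div_div, div_mul_eq_mul_div, le_div_iff₀ (by positivity)] at h2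
        linarith)
  exact ⟨q, p, hq, hqT, fun j => (hz j).trans (by linarith)⟩

lemma eventually_form_of_eventually_simul {m : ℕ} (hm : 2 ≤ m) (θ : Fin m → ℝ) {γ δ : ℝ}
    (hγ0 : 0 ≤ γ) (hγ1 : γ < 1) (hδ0 : 0 < δ) (hδ : δ < (m - 1) / (1 - γ))
    (h : ∀ᶠ t : ℝ in atTop, ∃ (q : ℤ) (p : Fin m → ℤ), q ≠ 0 ∧ |(q : ℝ)| ≤ t ∧
      ∀ j, |θ j * q - p j| ≤ t ^ (-γ)) :
    ∀ᶠ t : ℝ in atTop, ∃ (x : Fin m → ℤ) (y : ℤ), x ≠ 0 ∧ (∀ j, |(x j : ℝ)| ≤ t) ∧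
      |∑ j, θ j * x j - y| ≤ t ^ (-δ) := by
  obtain ⟨t₀, ht₀⟩ := eventually_atTop.1 h
  have hm2 : (2 : ℝ) ≤ m := by exact_mod_cast hm
  set δ₁ : ℝ := (m - 1) / (1 - γ) with hδ₁
  have hδ₁γ : δ₁ * (1 - γ) = m - 1 := div_mul_cancel₀ _ (by linarith)
  have hδ₁1 : 1 ≤ δ₁ := by rw [hδ₁, one_le_div (by linarith)]; linarith
  set C : ℝ := 4 * m ^ 2 with hC
  have hC0 : 0 < C := by positivity
  filter_upwards [eventually_mul_rpow_neg_lt (c := C * C ^ δ₁) hδ, eventually_ge_atTop 1,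
    eventually_ge_atTop C, eventually_ge_atTop (C * (2 * t₀))] with t htδ ht1 htC htt₀
  have ht : 0 < t := by linarith
  set X : ℝ := t / C with hX
  have hX1 : 1 ≤ X := (one_le_div hC0).2 htC
  have hXt₀ : 2 * t₀ ≤ X := by rw [hX, le_div_iff₀ hC0]; linarith
  have hX0 : 0 < X := by linarith
  have hN0 : 0 < X ^ δ₁ := Real.rpow_pos_of_pos hX0 _
  have hH : 0 < X ^ (-δ₁) := Real.rpow_pos_of_pos hX0 _
  have hN : 1 / X ^ (-δ₁) = X ^ δ₁ := by rw [Real.rpow_neg hX0.le, one_div, inv_inv]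
  have hXN : X ≤ X ^ δ₁ := by
    simpa using Real.rpow_le_rpow_of_exponent_le hX1 hδ₁1
  have hXpow : X ^ (m - 1) = X ^ ((m : ℝ) - 1) := by
    rw [← Real.rpow_natCast, Nat.cast_sub (by omega), Nat.cast_one]
  have hCH : C * X ^ (-δ₁) < t ^ (-δ) := by
    refine lt_of_eq_of_lt ?_ htδ
    rw [hX, Real.div_rpow ht.le hC0.le, Real.rpow_neg hC0.le, div_inv_eq_mul]
    ring
  have hTδ1 : t ^ (-δ) ≤ 1 := Real.rpow_le_one_of_one_le_of_nonpos ht1 (by linarith)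
  obtain ⟨x, y, hx, hxt, hL⟩ := exists_form_of_uniform_simul_aux hm θ hX0 hH
    (hCH.trans_le hTδ1) (ε := (X ^ δ₁) ^ (-γ))
    (by
      rw [hXpow, ← Real.rpow_mul hX0.le, ← Real.rpow_add hX0]
      refine le_of_eq ?_
      congr 1
      linarith)
    (by
      rw [hN]
      refine ht₀ _ ?_
      rcases le_or_gt t₀ 0 with h0 | h0 <;> linarith)
    (fun k hk hkN => by
      have hXk : X < k := by
        refine lt_of_le_of_lt ?_ hk
        simpa using pow_le_pow_right₀ hX1 (show 1 ≤ m by omega)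
      have hk0 : 0 < k := by linarith
      obtain ⟨q, p, hq, hqk, hz⟩ := ht₀ (k / 2) (by linarith)
      refine ⟨q, p, _, hq, hqk, hz, ?_⟩
      rw [Real.div_rpow hk0.le zero_le_two, Real.rpow_neg zero_le_two, div_inv_eq_mul,
        ← mul_assoc, mul_comm]
      have h1 : (2 : ℝ) ^ γ ≤ 2 := by
        simpa using Real.rpow_le_rpow_of_exponent_le one_le_two hγ1.le
      have h2 : k * k ^ (-γ) = k ^ (1 - γ) := by
        rw [sub_eq_add_neg, Real.rpow_add hk0, Real.rpow_one]
      have h3 : k ^ (1 - γ) ≤ X ^ (m - 1) := by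
        rw [hN] at hkN
        refine (Real.rpow_le_rpow hk0.le hkN (by linarith)).trans_eq ?_
        rw [← Real.rpow_mul hX0.le, hδ₁γ, hXpow]
      rw [h2]
      exact mul_le_mul h1 h3 (by positivity) zero_le_two)
  refine ⟨x, y, hx, fun j => (hxt j).trans_eq ?_, hL.trans hCH.le⟩
  rw [hX, mul_div_cancel₀ _ hC0.ne']

lemma uniformlyApprox_form_iff {m : ℕ} (Θ : Matrix (Fin 1) (Fin m) ℝ) (γ : ℝ) :
    UniformlyApprox 1 m Θ (fun t => t ^ (-γ)) ↔
      ∀ᶠ t : ℝ in atTop, ∃ (x : Fin m → ℤ) (y : ℤ), x ≠ 0 ∧ (∀ j, |(x j : ℝ)| ≤ t) ∧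
        |∑ j, Θ 0 j * x j - y| ≤ t ^ (-γ) := by
  refine eventually_congr ?_
  filter_upwards [eventually_gt_atTop 0] with t ht
  have ht' : 0 ≤ t ^ (-γ) := Real.rpow_nonneg ht.le _
  simp only [pi_norm_le_iff_of_nonneg ht.le, pi_norm_le_iff_of_nonneg ht', Real.norm_eq_abs,
    Fin.forall_fin_one, Pi.sub_apply, Matrix.mulVec, dotProduct]
  exact exists_congr fun x => ⟨fun ⟨y, hy⟩ => ⟨y 0, hy⟩, fun ⟨y, hy⟩ => ⟨fun _ => y, hy⟩⟩

lemma uniformlyApprox_simul_iff {m : ℕ} (Θ : Matrix (Fin 1) (Fin m) ℝ) (γ : ℝ) :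
    UniformlyApprox m 1 Θ.transpose (fun t => t ^ (-γ)) ↔
      ∀ᶠ t : ℝ in atTop, ∃ (q : ℤ) (p : Fin m → ℤ), q ≠ 0 ∧ |(q : ℝ)| ≤ t ∧
        ∀ j, |Θ 0 j * q - p j| ≤ t ^ (-γ) := by
  refine eventually_congr ?_
  filter_upwards [eventually_gt_atTop 0] with t ht
  have ht' : 0 ≤ t ^ (-γ) := Real.rpow_nonneg ht.le _
  simp only [pi_norm_le_iff_of_nonneg ht.le, pi_norm_le_iff_of_nonneg ht', Real.norm_eq_abs,
    Fin.forall_fin_one, Pi.sub_apply, Matrix.mulVec, dotProduct, Fin.sum_univ_one,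
    Matrix.transpose_apply, Function.ne_iff, Fin.exists_fin_one, Pi.zero_apply]
  exact ⟨fun ⟨x, p, h⟩ => ⟨x 0, p, h⟩, fun ⟨q, p, h⟩ => ⟨fun _ => q, p, h⟩⟩

lemma ofReal_le_alphaExp {n m : ℕ} {Θ : Matrix (Fin n) (Fin m) ℝ} {c : ℝ}
    (h : ∀ δ, 0 < δ → δ < c → UniformlyApprox n m Θ (fun t => t ^ (-δ))) :
    ENNReal.ofReal c ≤ alphaExp n m Θ := by
  refine le_of_forall_lt fun b hb => ?_
  obtain ⟨r, hbr, hrc⟩ := ENNReal.lt_iff_exists_nnreal_btwn.1 hb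
  have hr0 : 0 < (r : ℝ) := by
    have : 0 < r := by exact_mod_cast pos_of_gt hbr
    exact_mod_cast this
  have hrc' : (r : ℝ) < c := by
    rw [← ENNReal.ofReal_coe_nnreal] at hrc
    exact (ENNReal.ofReal_lt_ofReal_iff_of_nonneg hr0.le).1 hrc
  refine hbr.trans_le (le_sSup ⟨r, ⟨hr0, h r hr0 hrc'⟩, ENNReal.ofReal_coe_nnreal⟩)

end Transference

/-- The case `n = 1`, `m ≥ 2` of German's theorem on uniform exponents,
in `[0,∞]` with the convention `1/∞ = 0`. -/
theorem uniform_exponent_transference_linear_form (m : ℕ) (hm : 2 ≤ m)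
    (Θ : Matrix (Fin 1) (Fin m) ℝ) :
    (1 - (alphaExp 1 m Θ)⁻¹) / ((m : ℝ≥0∞) - 1) ≤ alphaExp m 1 Θ.transpose ∧
    (alphaExp 1 m Θ)⁻¹ ≤ (1 - alphaExp m 1 Θ.transpose) / ((m : ℝ≥0∞) - 1) := by
  have hm2 : (2 : ℝ) ≤ m := by exact_mod_cast hm
  have hM : (m : ℝ≥0∞) - 1 = ENNReal.ofReal (m - 1) := by
    rw [ENNReal.ofReal_sub _ zero_le_one, ENNReal.ofReal_natCast, ENNReal.ofReal_one]
  have hM0 : ENNReal.ofReal ((m : ℝ) - 1) ≠ 0 := by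
    rw [Ne, ENNReal.ofReal_eq_zero]; linarith
  rw [hM]
  set M : ℝ≥0∞ := ENNReal.ofReal ((m : ℝ) - 1) with hMdef
  constructor
  · rw [ENNReal.div_le_iff hM0 ENNReal.ofReal_ne_top, tsub_le_iff_tsub_le, ENNReal.le_inv_iff_le_inv]
    refine sSup_le ?_
    rintro _ ⟨γ, ⟨hγ0, hγ⟩, rfl⟩
    rw [ENNReal.le_inv_iff_le_inv, ← ENNReal.ofReal_inv_of_pos hγ0, tsub_le_iff_left]
    rcases le_or_gt γ 1 with hγ1 | hγ1
    · refine le_add_left ?_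
      rw [← ENNReal.ofReal_one]
      exact ENNReal.ofReal_le_ofReal ((one_le_inv₀ hγ0).2 hγ1)
    · have h1 : ENNReal.ofReal ((1 - 1 / γ) / (m - 1)) ≤ alphaExp m 1 Θ.transpose :=
        ofReal_le_alphaExp fun δ hδ0 hδ => (uniformlyApprox_simul_iff Θ δ).2
          (eventually_simul_of_eventually_form hm _ hγ1 hδ0 hδ ((uniformlyApprox_form_iff Θ γ).1 hγ))
      have h2 : 0 ≤ 1 - 1 / γ := by
        rw [sub_nonneg, div_le_one hγ0]; exact hγ1.le
      calc (1 : ℝ≥0∞) = ENNReal.ofReal ((1 - 1 / γ) / (m - 1)) * M + ENNReal.ofReal γ⁻¹ := by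
            rw [hMdef, ← ENNReal.ofReal_mul (div_nonneg h2 (by linarith)),
              div_mul_cancel₀ _ (by linarith), ← ENNReal.ofReal_add h2 (by positivity)]
            simp
        _ ≤ _ := by gcongr
  · have hB : ∀ γ : ℝ, 0 ≤ γ → γ < 1 →
        (∀ᶠ t : ℝ in atTop, ∃ (q : ℤ) (p : Fin m → ℤ), q ≠ 0 ∧ |(q : ℝ)| ≤ t ∧
          ∀ j, |Θ 0 j * q - p j| ≤ t ^ (-γ)) →
        (alphaExp 1 m Θ)⁻¹ * M ≤ ENNReal.ofReal (1 - γ) := by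
      intro γ hγ0 hγ1 hγ
      have h1 : ENNReal.ofReal ((m - 1) / (1 - γ)) ≤ alphaExp 1 m Θ :=
        ofReal_le_alphaExp fun δ hδ0 hδ => (uniformlyApprox_form_iff Θ δ).2
          (eventually_form_of_eventually_simul hm _ hγ0 hγ1 hδ0 hδ hγ)
      have h2 : (0 : ℝ) < 1 - γ := by linarith
      have h3 : (0 : ℝ) < m - 1 := by linarith
      calc (alphaExp 1 m Θ)⁻¹ * M ≤ (ENNReal.ofReal ((m - 1) / (1 - γ)))⁻¹ * M := by gcongr
        _ = ENNReal.ofReal (1 - γ) := by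
            rw [← ENNReal.ofReal_inv_of_pos (div_pos h3 h2), hMdef,
              ← ENNReal.ofReal_mul (by positivity), inv_div, div_mul_cancel₀ _ h3.ne']
    have hzero : (alphaExp 1 m Θ)⁻¹ * M ≤ 1 := by
      have := hB 0 le_rfl one_pos (by
        filter_upwards [eventually_ge_atTop 1] with t ht
        refine ⟨1, fun j => ⌊Θ 0 j⌋, one_ne_zero, by simpa, fun j => ?_⟩
        rw [neg_zero, Real.rpow_zero, Int.cast_one, mul_one, Int.self_sub_floor, Int.abs_fract]
        exact (Int.fract_lt_one _).le)
      simpa using this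
    have hmono : ∀ γ γ' : ℝ, γ' ≤ γ → UniformlyApprox m 1 Θ.transpose (fun t => t ^ (-γ)) →
        UniformlyApprox m 1 Θ.transpose (fun t => t ^ (-γ')) := by
      intro γ γ' hle h
      filter_upwards [h, eventually_ge_atTop 1] with t ⟨x, y, hx, hxt, hxy⟩ ht
      exact ⟨x, y, hx, hxt, hxy.trans (Real.rpow_le_rpow_of_exponent_le ht (by linarith))⟩
    rw [ENNReal.le_div_iff_mul_le (Or.inl hM0) (Or.inl ENNReal.ofReal_ne_top)]
    by_cases hex : ∃ γ : ℝ, 1 ≤ γ ∧ UniformlyApprox m 1 Θ.transpose (fun t => t ^ (-γ))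
    · obtain ⟨γ, hγ1, hγ⟩ := hex
      refine le_trans (b := 0) (le_of_forall_gt fun b hb => ?_) bot_le
      obtain ⟨r, hr0, hrb⟩ := ENNReal.lt_iff_exists_nnreal_btwn.1 hb
      have hr0' : (0 : ℝ) < r := by exact_mod_cast hr0
      refine lt_of_le_of_lt ?_ hrb
      rcases le_or_gt (r : ℝ) 1 with hr1 | hr1
      · have := hB (1 - r) (by linarith) (by linarith)
          ((uniformlyApprox_simul_iff Θ _).1 (hmono γ _ (by linarith) hγ))
        simpa using this
      · refine hzero.trans ?_
        exact_mod_cast hr1.le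
    · have hle : alphaExp m 1 Θ.transpose ≤ 1 - (alphaExp 1 m Θ)⁻¹ * M := by
        refine sSup_le ?_
        rintro _ ⟨γ, ⟨hγ0, hγ⟩, rfl⟩
        have hγ1 : γ < 1 := by
          by_contra hcon
          exact hex ⟨γ, not_lt.1 hcon, hγ⟩
        have h1 := hB γ hγ0.le hγ1 ((uniformlyApprox_simul_iff Θ γ).1 hγ)
        refine ENNReal.le_sub_of_add_le_right (ne_top_of_le_ne_top ENNReal.one_ne_top hzero) ?_
        calc ENNReal.ofReal γ + (alphaExp 1 m Θ)⁻¹ * M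
            ≤ ENNReal.ofReal γ + ENNReal.ofReal (1 - γ) := by gcongr
          _ = 1 := by
              rw [← ENNReal.ofReal_add hγ0.le (by linarith)]
              simp
      calc (alphaExp 1 m Θ)⁻¹ * M = 1 - (1 - (alphaExp 1 m Θ)⁻¹ * M) :=
            (ENNReal.sub_sub_cancel ENNReal.one_ne_top hzero).symm
        _ ≤ _ := tsub_le_tsub_left hle 1
end
end

section
/- Let n and m be positive integers, not both equal to 1, and let Θ be an n×m real matrix with α(Θ) < +∞ and β(Θ) < +∞. Then β(ᵗΘ) ≥ ((n−1)(1+β(Θ)) − (1−α(Θ))) / ((m−1)(1+β(Θ)) + (1−α(Θ))), with the convention a/0 = +∞ for a > 0. -/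
open Filter MeasureTheory
open scoped ENNReal RealInnerProductSpace

noncomputable section

theorem exists_int_abs_mulVec_lt {ι : Type*} [Fintype ι] [DecidableEq ι] (A : Matrix ι ι ℝ)
    (c : ι → ℝ) (hc : ∀ i, 0 < c i) (hA : A.det ≠ 0) (hlt : |A.det| < ∏ i, c i) :
    ∃ p : ι → ℤ, p ≠ 0 ∧ ∀ i, |A.mulVec (fun k => (p k : ℝ)) i| < c i := by
  let b := Pi.basisFun ℝ ι
  let s : Set (ι → ℝ) := Matrix.toLin' A ⁻¹' Set.univ.pi fun i => Set.Ioo (-c i) (c i)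
  have hdet : LinearMap.det (Matrix.toLin' A) = A.det := LinearMap.det_toLin' A
  have hvol : volume s = ENNReal.ofReal (|A.det⁻¹| * ∏ i, (2 * c i)) := by
    rw [Measure.addHaar_preimage_linearMap _ (by rwa [hdet]), hdet, Real.volume_pi_Ioo,
      ← ENNReal.ofReal_prod_of_nonneg (fun i _ => by linarith [hc i]),
      ← ENNReal.ofReal_mul (abs_nonneg _)]
    congr 3
    ext i
    ring
  have hconv : Convex ℝ s := (convex_pi fun i _ => convex_Ioo _ _).linear_preimage _
  have hsymm : ∀ x ∈ s, -x ∈ s := by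
    intro x hx i hi
    have := hx i hi
    simp only [map_neg, Pi.neg_apply, Set.mem_Ioo] at this ⊢
    constructor <;> linarith [this.1, this.2]
  have hpos : 0 < |A.det| := abs_pos.2 hA
  have hbig : volume (ZSpan.fundamentalDomain b) * 2 ^ Module.finrank ℝ (ι → ℝ) < volume s := by
    rw [hvol, ZSpan.volume_fundamentalDomain, Module.finrank_fintype_fun_eq_card]
    have h1 : (Matrix.of ⇑b).det = 1 := by
      have : Matrix.of ⇑b = (1 : Matrix ι ι ℝ) := by
        ext i j
        simp [b, Pi.basisFun_apply, Pi.single_apply, Matrix.one_apply, eq_comm]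
      rw [this, Matrix.det_one]
    rw [h1, Finset.prod_mul_distrib, Finset.prod_const, Finset.card_univ, abs_inv, abs_one,
      ENNReal.ofReal_one, one_mul]
    have h2 : (2 : ℝ≥0∞) ^ Fintype.card ι = ENNReal.ofReal (2 ^ Fintype.card ι) := by
      rw [ENNReal.ofReal_pow (by norm_num)]; simp
    rw [h2, ENNReal.ofReal_lt_ofReal_iff_of_nonneg (by positivity)]
    have h3 : 1 < |A.det|⁻¹ * ∏ i, c i := by
      rw [inv_mul_eq_div, one_lt_div hpos]; exact hlt
    have h4 : (0 : ℝ) < 2 ^ Fintype.card ι := by positivity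
    nlinarith
  have : Countable (Submodule.span ℤ (Set.range b)).toAddSubgroup :=
    inferInstanceAs (Countable (Submodule.span ℤ (Set.range b)))
  obtain ⟨x, hx0, hxs⟩ := exists_ne_zero_mem_lattice_of_measure_mul_two_pow_lt_measure
    (ZSpan.isAddFundamentalDomain' b volume) hsymm hconv hbig
  have hmem : ∀ i, ∃ k : ℤ, (k : ℝ) = (x : ι → ℝ) i := by
    intro i
    have := (b.mem_span_iff_repr_mem ℤ (x : ι → ℝ)).1 x.2 i
    simpa [b] using this
  choose p hp using hmem
  have hpx : (fun k => (p k : ℝ)) = (x : ι → ℝ) := funext hp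
  refine ⟨p, ?_, fun i => ?_⟩
  · rintro rfl
    apply hx0
    ext i
    simp [← hp i]
  · rw [hpx]
    exact abs_lt.2 (hxs i trivial)

theorem exists_abs_eq_pi_norm {ι : Type*} [Fintype ι] [Nonempty ι] (x : ι → ℝ) :
    ∃ i, |x i| = ‖x‖ := by
  obtain ⟨i, -, hi⟩ := Finset.exists_max_image Finset.univ (fun i => |x i|) Finset.univ_nonempty
  refine ⟨i, le_antisymm (norm_le_pi_norm x i) ?_⟩
  exact (pi_norm_le_iff_of_nonneg (abs_nonneg _)).2 fun j => hi j (Finset.mem_univ j)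

theorem abs_dotProduct_sub_le {ι : Type*} [Fintype ι] [DecidableEq ι] (a u : ι → ℝ) (j : ι)
    {W : ℝ} (hW : 0 ≤ W) (hu : ∀ i ≠ j, |u i| ≤ W) :
    |a ⬝ᵥ u - a j * u j| ≤ Fintype.card ι * (‖a‖ * W) := by
  rw [dotProduct, ← Finset.add_sum_erase _ _ (Finset.mem_univ j), add_sub_cancel_left]
  refine (Finset.abs_sum_le_sum_abs _ _).trans ?_
  have : ∀ i ∈ Finset.univ.erase j, |a i * u i| ≤ ‖a‖ * W := fun i hi => by
    rw [abs_mul]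
    exact mul_le_mul (norm_le_pi_norm a i) (hu i (Finset.ne_of_mem_erase hi)) (abs_nonneg _)
      (norm_nonneg _)
  refine (Finset.sum_le_card_nsmul _ _ _ this).trans ?_
  rw [nsmul_eq_mul]
  have : ((Finset.univ.erase j).card : ℝ) ≤ Fintype.card ι := by
    exact_mod_cast Finset.card_le_univ _
  gcongr

/-- A matrix differing from the identity in two rows only has a two-by-two determinant. -/
theorem det_replace_two_rows {ι κ : Type*} [Fintype ι] [DecidableEq ι] [Fintype κ]
    [DecidableEq κ] (j : ι) (i : κ) (r s : ι ⊕ κ → ℝ) :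
    (Matrix.of fun k => if k = Sum.inl j then r else if k = Sum.inr i then s
      else Pi.single k 1 : Matrix (ι ⊕ κ) (ι ⊕ κ) ℝ).det
      = r (Sum.inl j) * s (Sum.inr i) - r (Sum.inr i) * s (Sum.inl j) := by
  let U : Matrix (ι ⊕ κ) (Fin 2) ℝ := Matrix.of fun k =>
    ![if k = Sum.inl j then 1 else 0, if k = Sum.inr i then 1 else 0]
  let V : Matrix (Fin 2) (ι ⊕ κ) ℝ := Matrix.of
    ![r - Pi.single (Sum.inl j) 1, s - Pi.single (Sum.inr i) 1]
  have hUV : (Matrix.of fun k => if k = Sum.inl j then r else if k = Sum.inr i then s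
      else Pi.single k 1 : Matrix (ι ⊕ κ) (ι ⊕ κ) ℝ) = 1 + U * V := by
    ext k l
    rw [Matrix.add_apply, Matrix.one_eq_pi_single, Matrix.mul_apply, Fin.sum_univ_two]
    by_cases h1 : k = Sum.inl j
    · subst h1; simp [U, V]
    by_cases h2 : k = Sum.inr i
    · subst h2; simp [U, V]
    simp [U, V, h1, h2]
  have hVU : ∀ a, (V * U) a 0 = V a (Sum.inl j) ∧ (V * U) a 1 = V a (Sum.inr i) := by
    intro a
    constructor <;> simp [Matrix.mul_apply, U]
  rw [hUV, Matrix.det_one_add_mul_comm, Matrix.det_fin_two]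
  simp only [Matrix.add_apply, hVU]
  simp [V]

/-- Minkowski's theorem for the coordinate box with two of the coordinates replaced by the
linear forms `r` and `s`. -/
theorem exists_int_two_forms_lt {ι κ : Type*} [Fintype ι] [DecidableEq ι] [Fintype κ]
    [DecidableEq κ] (B : Matrix (ι ⊕ κ) (ι ⊕ κ) ℝ) (hB : |B.det| = 1) (j : ι) (i : κ)
    (r s : ι ⊕ κ → ℝ) {W Z : ℝ} (hW : 0 < W) (hZ : 0 < Z)
    (hpos : 0 < |r (Sum.inl j) * s (Sum.inr i) - r (Sum.inr i) * s (Sum.inl j)|)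
    (hlt : |r (Sum.inl j) * s (Sum.inr i) - r (Sum.inr i) * s (Sum.inl j)|
      < W ^ (Fintype.card ι - 1) * Z ^ (Fintype.card κ - 1)) :
    ∃ p : ι ⊕ κ → ℤ, p ≠ 0 ∧ |r ⬝ᵥ B.mulVec (fun k => (p k : ℝ))| < 1 ∧
      |s ⬝ᵥ B.mulVec (fun k => (p k : ℝ))| < 1 ∧
      (∀ k ≠ j, |B.mulVec (fun k => (p k : ℝ)) (Sum.inl k)| ≤ W) ∧
      ∀ k ≠ i, |B.mulVec (fun k => (p k : ℝ)) (Sum.inr k)| ≤ Z := by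
  let R : Matrix (ι ⊕ κ) (ι ⊕ κ) ℝ := Matrix.of fun k =>
    if k = Sum.inl j then r else if k = Sum.inr i then s else Pi.single k 1
  let c : ι ⊕ κ → ℝ :=
    Sum.elim (fun k => if k = j then 1 else W) (fun k => if k = i then 1 else Z)
  have hdet : |(R * B).det|
      = |r (Sum.inl j) * s (Sum.inr i) - r (Sum.inr i) * s (Sum.inl j)| := by
    rw [Matrix.det_mul, abs_mul, hB, det_replace_two_rows, mul_one]
  have hcpos : ∀ k, 0 < c k := by
    rintro (k | k)
    · simp only [c, Sum.elim_inl]; split_ifs <;> linarith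
    · simp only [c, Sum.elim_inr]; split_ifs <;> linarith
  have hcprod : ∏ k, c k = W ^ (Fintype.card ι - 1) * Z ^ (Fintype.card κ - 1) := by
    rw [Fintype.prod_sum_type]
    simp only [c, Sum.elim_inl, Sum.elim_inr]
    rw [Finset.prod_ite, Finset.prod_ite]
    simp [Finset.filter_ne', Finset.card_erase_of_mem]
  obtain ⟨p, hp0, hp⟩ := exists_int_abs_mulVec_lt (R * B) c hcpos
    (by rw [← abs_pos, hdet]; exact hpos) (by rw [hdet, hcprod]; exact hlt)
  rw [← Matrix.mulVec_mulVec] at hp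
  set q := B.mulVec (fun k => (p k : ℝ))
  have hrow : ∀ k, R.mulVec q k = R k ⬝ᵥ q := fun _ => rfl
  have hRk : ∀ k, R k = if k = Sum.inl j then r else if k = Sum.inr i then s
      else Pi.single k 1 := fun _ => rfl
  refine ⟨p, hp0, ?_, ?_, fun k hk => ?_, fun k hk => ?_⟩
  · have hR : R (Sum.inl j) = r := by rw [hRk, if_pos rfl]
    have := hp (Sum.inl j)
    rw [hrow, hR] at this
    simpa only [c, Sum.elim_inl, if_true] using this
  · have hR : R (Sum.inr i) = s := by
      rw [hRk, if_neg Sum.inr_ne_inl, if_pos rfl]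
    have := hp (Sum.inr i)
    rw [hrow, hR] at this
    simpa only [c, Sum.elim_inr, if_true] using this
  · have hR : R (Sum.inl k) = Pi.single (Sum.inl k) 1 := by
      rw [hRk, if_neg (Sum.inl_injective.ne hk), if_neg Sum.inl_ne_inr]
    have := hp (Sum.inl k)
    rw [hrow, hR, single_one_dotProduct] at this
    simpa only [c, Sum.elim_inl, if_neg hk] using this.le
  · have hR : R (Sum.inr k) = Pi.single (Sum.inr k) 1 := by
      rw [hRk, if_neg Sum.inr_ne_inl, if_neg (Sum.inr_injective.ne hk)]
    have := hp (Sum.inr k)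
    rw [hrow, hR, single_one_dotProduct] at this
    simpa only [c, Sum.elim_inr, if_neg hk] using this.le

/-- Two nearly triangular inequalities bound both unknowns. -/
theorem le_and_le_of_cross_bounds {X₂ Y₁ Y₂ W Z D u v : ℝ} (hY : Y₂ ≤ Y₁) (hX₂ : 0 < X₂)
    (hY₂ : 0 < Y₂) (hZ : 0 < Z) (hD : 0 ≤ D) (hu : 0 ≤ u) (hWZ : X₂ * W = Y₂ * Z)
    (q₂ : X₂ * u ≤ D * (X₂ * W) + Y₂ * v) (q₁ : Y₁ * v ≤ D * (Y₁ * Z) + X₂ / 2 * u) :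
    u ≤ 4 * D * W ∧ v ≤ 4 * D * Z := by
  have hY₁ : 0 < Y₁ := hY₂.trans_le hY
  have hU : u ≤ 4 * D * W := by
    have h1 : Y₂ * (Y₁ * v) ≤ Y₂ * (D * (Y₁ * Z) + X₂ / 2 * u) :=
      mul_le_mul_of_nonneg_left q₁ hY₂.le
    have h2 : Y₁ * (X₂ * u) ≤ Y₁ * (D * (X₂ * W) + Y₂ * v) :=
      mul_le_mul_of_nonneg_left q₂ hY₁.le
    have h3 : Y₂ * (X₂ / 2 * u) ≤ Y₁ * (X₂ / 2 * u) :=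
      mul_le_mul_of_nonneg_right hY (by positivity)
    have h4 : Y₂ * (D * (Y₁ * Z)) = Y₁ * (D * (X₂ * W)) := by rw [hWZ]; ring
    have h5 : (X₂ * Y₁) * u ≤ (X₂ * Y₁) * (4 * D * W) := by linarith
    exact le_of_mul_le_mul_left h5 (mul_pos hX₂ hY₁)
  refine ⟨hU, ?_⟩
  have h1 : X₂ / 2 * u ≤ X₂ / 2 * (4 * D * W) := mul_le_mul_of_nonneg_left hU (by positivity)
  have h2 : D * (Y₂ * Z) ≤ D * (Y₁ * Z) := by gcongr
  have h3 : X₂ / 2 * (4 * D * W) = 2 * (D * (Y₂ * Z)) := by rw [← hWZ]; ring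
  have h4 : 0 ≤ D * (Y₁ * Z) := by positivity
  have h5 : Y₁ * v ≤ Y₁ * (4 * D * Z) := by linarith
  exact le_of_mul_le_mul_left h5 hY₁

/-- Two independent integer points `(x₁, y₁)`, `(x₂, y₂)` yield a small solution of the
transposed system, found in the lattice orthogonal to both of them. -/
theorem exists_transpose_approx_of_two_points {n m : ℕ} (hn : 0 < n) (hm : 0 < m)
    (Θ : Matrix (Fin n) (Fin m) ℝ) (x₁ x₂ : Fin m → ℤ) (y₁ y₂ : Fin n → ℤ) {X₁ X₂ Y₁ Y₂ W Z : ℝ}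
    (hX₁ : ‖(fun j => (x₁ j : ℝ))‖ = X₁) (hX₂ : ‖(fun j => (x₂ j : ℝ))‖ = X₂)
    (hY₁ : ‖Θ.mulVec (fun j => (x₁ j : ℝ)) - (fun i => (y₁ i : ℝ))‖ = Y₁)
    (hY₂ : ‖Θ.mulVec (fun j => (x₂ j : ℝ)) - (fun i => (y₂ i : ℝ))‖ = Y₂)
    (hX : X₁ ≤ X₂ / 2) (hY : Y₂ ≤ Y₁) (hX₂pos : 0 < X₂) (hY₂pos : 0 < Y₂)
    (hW : 0 < W) (hZ : 0 < Z) (hWZ : X₂ * W = Y₂ * Z)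
    (hvol : 2 * (X₂ * Y₁) < W ^ (m - 1) * Z ^ (n - 1)) :
    ∃ (z : Fin n → ℤ) (w : Fin m → ℤ), (z ≠ 0 ∨ w ≠ 0) ∧
      ‖(fun i => (z i : ℝ))‖ ≤ 4 * (m + n) * Z ∧
      ‖Θ.transpose.mulVec (fun i => (z i : ℝ)) - (fun j => (w j : ℝ))‖ ≤ 4 * (m + n) * W := by
  have : Nonempty (Fin m) := ⟨⟨0, hm⟩⟩
  have : Nonempty (Fin n) := ⟨⟨0, hn⟩⟩
  have hm1 : (1 : ℝ) ≤ m := by exact_mod_cast hm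
  have hn1 : (1 : ℝ) ≤ n := by exact_mod_cast hn
  set a₁ : Fin m → ℝ := fun j => (x₁ j : ℝ) with ha₁
  set a₂ : Fin m → ℝ := fun j => (x₂ j : ℝ) with ha₂
  set b₁ : Fin n → ℝ := (fun i => (y₁ i : ℝ)) - Θ.mulVec a₁ with hb₁
  set b₂ : Fin n → ℝ := (fun i => (y₂ i : ℝ)) - Θ.mulVec a₂ with hb₂
  have hY₁' : ‖b₁‖ = Y₁ := by rw [← hY₁, hb₁, norm_sub_rev]
  have hY₂' : ‖b₂‖ = Y₂ := by rw [← hY₂, hb₂, norm_sub_rev]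
  obtain ⟨j, hj⟩ := exists_abs_eq_pi_norm a₂
  obtain ⟨i, hi⟩ := exists_abs_eq_pi_norm b₁
  rw [hX₂] at hj
  rw [hY₁'] at hi
  have hY₁pos : 0 < Y₁ := hY₂pos.trans_le hY
  have hj₁ : |a₁ j| ≤ X₁ := hX₁ ▸ norm_le_pi_norm a₁ j
  have hi₂ : |b₂ i| ≤ Y₂ := hY₂' ▸ norm_le_pi_norm b₂ i
  let B : Matrix (Fin m ⊕ Fin n) (Fin m ⊕ Fin n) ℝ :=
    Matrix.fromBlocks (-1) Θ.transpose 0 1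
  have hdetB : |B.det| = 1 := by
    simp [B, Matrix.det_neg]
  have hmain : |a₂ j * b₁ i| = X₂ * Y₁ := by rw [abs_mul, hj, hi]
  have hsmall : |b₂ i * a₁ j| ≤ X₂ * Y₁ / 2 := by
    rw [abs_mul]
    have : |b₂ i| * |a₁ j| ≤ Y₁ * (X₂ / 2) :=
      mul_le_mul (hi₂.trans hY) (hj₁.trans hX) (abs_nonneg _) hY₁pos.le
    linarith
  have hXY : 0 < X₂ * Y₁ := mul_pos hX₂pos hY₁pos
  obtain ⟨p, hp0, hp₂, hp₁, hξW, hzZ⟩ := exists_int_two_forms_lt B hdetB j i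
    (Sum.elim a₂ b₂) (Sum.elim a₁ b₁) hW hZ
    (by
      simp only [Sum.elim_inl, Sum.elim_inr]
      have := abs_sub_abs_le_abs_sub (a₂ j * b₁ i) (b₂ i * a₁ j)
      linarith)
    (by
      simp only [Sum.elim_inl, Sum.elim_inr, Fintype.card_fin]
      have := abs_sub (a₂ j * b₁ i) (b₂ i * a₁ j)
      linarith)
  set z : Fin n → ℝ := fun k => (p (Sum.inr k) : ℝ) with hz
  set w : Fin m → ℝ := fun k => (p (Sum.inl k) : ℝ) with hw
  set ξ : Fin m → ℝ := Θ.transpose.mulVec z - w with hξ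
  have hBp : B.mulVec (fun k => (p k : ℝ)) = Sum.elim ξ z := by
    have : (fun k => (p k : ℝ)) = Sum.elim w z := by
      ext (k | k) <;> rfl
    rw [this, Matrix.fromBlocks_mulVec]
    simp [hξ, Matrix.neg_mulVec, sub_eq_neg_add]
  rw [hBp] at hp₁ hp₂ hξW hzZ
  have hpair : ∀ (x : Fin m → ℤ) (y : Fin n → ℤ),
      (fun k => (x k : ℝ)) ⬝ᵥ ξ + ((fun k => (y k : ℝ)) - Θ.mulVec (fun k => (x k : ℝ))) ⬝ᵥ z
        = ((∑ k, y k * p (Sum.inr k) - ∑ k, x k * p (Sum.inl k) : ℤ) : ℝ) := by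
    intro x y
    rw [hξ, dotProduct_sub, sub_dotProduct, Matrix.mulVec_transpose, dotProduct_comm _
      (Matrix.vecMul z Θ), ← Matrix.dotProduct_mulVec, dotProduct_comm z]
    push_cast
    simp only [dotProduct, hz, hw]
    ring
  have hzero : ∀ (x : Fin m → ℤ) (y : Fin n → ℤ),
      |(fun k => (x k : ℝ)) ⬝ᵥ ξ + ((fun k => (y k : ℝ)) - Θ.mulVec (fun k => (x k : ℝ))) ⬝ᵥ z|
        < 1 → (fun k => (x k : ℝ)) ⬝ᵥ ξ +
          ((fun k => (y k : ℝ)) - Θ.mulVec (fun k => (x k : ℝ))) ⬝ᵥ z = 0 := by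
    intro x y h
    rw [hpair] at h ⊢
    have : |∑ k, y k * p (Sum.inr k) - ∑ k, x k * p (Sum.inl k)| < 1 := by exact_mod_cast h
    rw [Int.abs_lt_one_iff.1 this, Int.cast_zero]
  have e₂ : a₂ ⬝ᵥ ξ + b₂ ⬝ᵥ z = 0 := hzero _ _ (by
    simpa only [dotProduct, Fintype.sum_sum_type, Sum.elim_inl, Sum.elim_inr] using hp₂)
  have e₁ : a₁ ⬝ᵥ ξ + b₁ ⬝ᵥ z = 0 := hzero _ _ (by
    simpa only [dotProduct, Fintype.sum_sum_type, Sum.elim_inl, Sum.elim_inr] using hp₁)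
  have s₁ := abs_le.1 (abs_dotProduct_sub_le a₁ ξ j hW.le hξW)
  have s₂ := abs_le.1 (abs_dotProduct_sub_le a₂ ξ j hW.le hξW)
  have t₁ := abs_le.1 (abs_dotProduct_sub_le b₁ z i hZ.le hzZ)
  have t₂ := abs_le.1 (abs_dotProduct_sub_le b₂ z i hZ.le hzZ)
  rw [Fintype.card_fin, hX₁] at s₁
  rw [Fintype.card_fin, hX₂] at s₂
  rw [Fintype.card_fin, hY₁'] at t₁
  rw [Fintype.card_fin, hY₂'] at t₂
  have hX₁W : X₁ * W ≤ Y₁ * Z :=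
    calc X₁ * W ≤ X₂ * W := mul_le_mul_of_nonneg_right (by linarith) hW.le
      _ = Y₂ * Z := hWZ
      _ ≤ Y₁ * Z := mul_le_mul_of_nonneg_right hY hZ.le
  have k₂ : |a₂ j * ξ j + b₂ i * z i| ≤ (m + n) * (X₂ * W) := by
    rw [abs_le]; rw [← hWZ] at t₂; constructor <;> linarith [s₂.1, s₂.2, t₂.1, t₂.2]
  have hmXW : (m : ℝ) * (X₁ * W) ≤ m * (Y₁ * Z) := by gcongr
  have k₁ : |a₁ j * ξ j + b₁ i * z i| ≤ (m + n) * (Y₁ * Z) := by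
    rw [abs_le]; constructor <;> linarith [s₁.1, s₁.2, t₁.1, t₁.2]
  have q₂ : X₂ * |ξ j| ≤ (m + n) * (X₂ * W) + Y₂ * |z i| := by
    have h := abs_sub (a₂ j * ξ j + b₂ i * z i) (b₂ i * z i)
    rw [add_sub_cancel_right, abs_mul, abs_mul, hj] at h
    linarith [mul_le_mul_of_nonneg_right hi₂ (abs_nonneg (z i))]
  have q₁ : Y₁ * |z i| ≤ (m + n) * (Y₁ * Z) + X₂ / 2 * |ξ j| := by
    have h := abs_sub (a₁ j * ξ j + b₁ i * z i) (a₁ j * ξ j)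
    rw [add_sub_cancel_left, abs_mul, abs_mul, hi] at h
    linarith [mul_le_mul_of_nonneg_right (hj₁.trans hX) (abs_nonneg (ξ j))]
  set D : ℝ := m + n with hD
  have hD1 : 1 ≤ D := by linarith
  obtain ⟨hξj, hzi⟩ := le_and_le_of_cross_bounds hY hX₂pos hY₂pos hZ (by linarith)
    (abs_nonneg _) hWZ q₂ q₁
  refine ⟨fun k => p (Sum.inr k), fun k => p (Sum.inl k), ?_, ?_, ?_⟩
  · by_contra! h
    refine hp0 (funext ?_)
    rintro (k | k)
    · exact congrFun h.2 k
    · exact congrFun h.1 k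
  · refine (pi_norm_le_iff_of_nonneg (by positivity)).2 fun k => ?_
    by_cases hk : k = i
    · exact hk ▸ hzi
    · exact (hzZ k hk).trans (le_mul_of_one_le_left hZ.le (by linarith))
  · refine (pi_norm_le_iff_of_nonneg (by positivity)).2 fun k => ?_
    by_cases hk : k = j
    · exact hk ▸ hξj
    · exact (hξW k hk).trans (le_mul_of_one_le_left hW.le (by linarith))

/-- The sup-norm of an integer vector. -/
abbrev intNorm {k : ℕ} (x : Fin k → ℤ) : ℝ := ‖(fun j => (x j : ℝ))‖

/-- The approximation error `|Θx - y|_∞`. -/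
abbrev approxErr {n m : ℕ} (Θ : Matrix (Fin n) (Fin m) ℝ) (x : Fin m → ℤ) (y : Fin n → ℤ) : ℝ :=
  ‖Θ.mulVec (fun j => (x j : ℝ)) - (fun i => (y i : ℝ))‖

theorem one_le_intNorm {k : ℕ} {x : Fin k → ℤ} (hx : x ≠ 0) : 1 ≤ intNorm x := by
  obtain ⟨j, hj⟩ := Function.ne_iff.1 hx
  have h1 : (1 : ℝ) ≤ |(x j : ℝ)| := by exact_mod_cast Int.one_le_abs hj
  exact h1.trans (norm_le_pi_norm (fun j => (x j : ℝ)) j)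

theorem finite_intNorm_le (k : ℕ) (T : ℝ) : {x : Fin k → ℤ | intNorm x ≤ T}.Finite := by
  refine (Set.finite_Icc (fun _ : Fin k => -⌈T⌉) (fun _ => ⌈T⌉)).subset fun x hx => ?_
  have h : ∀ j, |x j| ≤ ⌈T⌉ := fun j => by
    have h1 : |(x j : ℝ)| ≤ ⌈T⌉ :=
      ((norm_le_pi_norm (fun j => (x j : ℝ)) j).trans hx).trans (Int.le_ceil T)
    exact_mod_cast h1
  exact ⟨fun j => (abs_le.1 (h j)).1, fun j => (abs_le.1 (h j)).2⟩

theorem finite_bounded_pairs {n m : ℕ} (Θ : Matrix (Fin n) (Fin m) ℝ) (T S : ℝ) :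
    {p : (Fin m → ℤ) × (Fin n → ℤ) | intNorm p.1 ≤ T ∧ approxErr Θ p.1 p.2 ≤ S}.Finite := by
  refine ((finite_intNorm_le m T).biUnion fun x _ => (Set.finite_singleton x).prod
    (finite_intNorm_le n (‖Θ.mulVec (fun j => (x j : ℝ))‖ + S))).subset ?_
  rintro ⟨x, y⟩ ⟨hx, hy⟩
  refine Set.mem_biUnion hx ⟨rfl, ?_⟩
  have h := norm_sub_norm_le (fun i => (y i : ℝ)) (Θ.mulVec (fun j => (x j : ℝ)))
  rw [norm_sub_rev] at h
  change intNorm y ≤ _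
  linarith

theorem Set.Finite.exists_pos_lt {ι : Type*} {s : Set ι} (hs : s.Finite) {f : ι → ℝ}
    (hf : ∀ i ∈ s, 0 < f i) : ∃ δ > 0, ∀ i ∈ s, δ < f i := by
  have h : ∀ᶠ δ in nhdsWithin (0 : ℝ) (Set.Ioi 0), ∀ i ∈ s, δ < f i :=
    (Filter.eventually_all_finite hs).2 fun i hi =>
      (eventually_lt_nhds (hf i hi)).filter_mono nhdsWithin_le_nhds
  obtain ⟨δ, h1, h2⟩ := (h.and self_mem_nhdsWithin).exists
  exact ⟨δ, h2, h1⟩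

theorem indivApprox_of_approxErr_eq_zero {n m : ℕ} {Θ : Matrix (Fin n) (Fin m) ℝ}
    {x : Fin m → ℤ} {y : Fin n → ℤ} (hx : x ≠ 0) (h : approxErr Θ x y = 0) (γ : ℝ) :
    IndivApprox n m Θ (fun t => t ^ (-γ)) := by
  refine Set.infinite_of_injective_forall_mem
    (f := fun k : ℤ => ((k • x, k • y) : (Fin m → ℤ) × (Fin n → ℤ))) ?_ fun k => ?_
  · intro k l hkl
    exact smul_left_injective ℤ hx (congrArg Prod.fst hkl)
  · have h0 := norm_eq_zero.1 h
    have h1 : Θ.mulVec (fun j => ((k • x) j : ℝ)) - (fun i => ((k • y) i : ℝ)) = 0 := by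
      have hX : (fun j => ((k • x) j : ℝ)) = (k : ℝ) • fun j => (x j : ℝ) := by
        ext j; simp
      have hY : (fun j => ((k • y) j : ℝ)) = (k : ℝ) • fun j => (y j : ℝ) := by
        ext j; simp
      rw [hX, hY, Matrix.mulVec_smul, ← smul_sub, h0, smul_zero]
    simp only [Set.mem_ofPred_eq]
    rw [h1, norm_zero]
    exact Real.rpow_nonneg (norm_nonneg _) _

/-- Arbitrarily small errors satisfying the approximation inequality give infinitely many
approximations. -/
theorem indivApprox_of_forall_exists {n m : ℕ} {Θ : Matrix (Fin n) (Fin m) ℝ} {γ : ℝ}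
    (h : ∀ δ > 0, ∃ (x : Fin m → ℤ) (y : Fin n → ℤ), x ≠ 0 ∧ approxErr Θ x y ≤ δ ∧
      approxErr Θ x y ≤ intNorm x ^ (-γ)) :
    IndivApprox n m Θ (fun t => t ^ (-γ)) := by
  by_cases h0 : ∃ (x : Fin m → ℤ) (y : Fin n → ℤ), x ≠ 0 ∧ approxErr Θ x y = 0
  · obtain ⟨x, y, hx, hxy⟩ := h0
    exact indivApprox_of_approxErr_eq_zero hx hxy γ
  push Not at h0
  intro hfin
  obtain ⟨δ, hδ, hlt⟩ := (hfin.subset (Set.sep_subset _ fun p => p.1 ≠ 0)).exists_pos_lt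
    (f := fun p => approxErr Θ p.1 p.2)
    fun p hp => (norm_nonneg _).lt_of_ne' (h0 p.1 p.2 hp.2)
  obtain ⟨x, y, hx, h1, h2⟩ := h δ hδ
  exact (hlt (x, y) ⟨h2, hx⟩).not_ge h1

theorem approxErr_pos {n m : ℕ} {Θ : Matrix (Fin n) (Fin m) ℝ} (hα : alphaExp n m Θ ≠ ⊤)
    (x : Fin m → ℤ) (y : Fin n → ℤ) (hx : x ≠ 0) : 0 < approxErr Θ x y := by
  refine (norm_nonneg _).lt_of_ne' fun h => hα ?_
  refine ENNReal.eq_top_of_forall_nnreal_le fun r => ?_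
  refine le_trans ?_ (le_sSup ⟨(r : ℝ) + 1, ⟨by positivity, ?_⟩, rfl⟩)
  · rw [← ENNReal.ofReal_coe_nnreal]
    exact ENNReal.ofReal_le_ofReal (by linarith)
  · filter_upwards [eventually_ge_atTop (intNorm x), eventually_ge_atTop 0] with t ht ht0
    exact ⟨x, y, hx, ht, h.trans_le (Real.rpow_nonneg ht0 _)⟩

theorem uniformlyApprox_of_lt {n m : ℕ} {Θ : Matrix (Fin n) (Fin m) ℝ} {a : ℝ}
    (h : ENNReal.ofReal a < alphaExp n m Θ) : UniformlyApprox n m Θ (fun t => t ^ (-a)) := by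
  obtain ⟨_, ⟨γ, ⟨-, hγ⟩, rfl⟩, hlt⟩ := lt_sSup_iff.1 h
  have haγ : a ≤ γ := (ENNReal.ofReal_lt_ofReal_iff'.1 hlt).1.le
  filter_upwards [hγ, eventually_ge_atTop 1] with t ⟨x, y, hx, hxt, hxy⟩ ht
  exact ⟨x, y, hx, hxt, hxy.trans (Real.rpow_le_rpow_of_exponent_le ht (by linarith))⟩

theorem indivApprox_of_lt {n m : ℕ} {Θ : Matrix (Fin n) (Fin m) ℝ} {b : ℝ}
    (h : ENNReal.ofReal b < betaExp n m Θ) : IndivApprox n m Θ (fun t => t ^ (-b)) := by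
  obtain ⟨_, ⟨γ, ⟨hγ0, hγ⟩, rfl⟩, hlt⟩ := lt_sSup_iff.1 h
  have hbγ : b ≤ γ := (ENNReal.ofReal_lt_ofReal_iff'.1 hlt).1.le
  refine hγ.mono fun p hp => ?_
  simp only [Set.mem_ofPred_eq] at hp ⊢
  refine hp.trans ?_
  by_cases hx : p.1 = 0
  · simp only [hx, Pi.zero_apply, Int.cast_zero]
    rw [show (fun _ : Fin m => (0 : ℝ)) = 0 from rfl, norm_zero,
      Real.zero_rpow (neg_ne_zero.2 hγ0.ne')]
    exact Real.rpow_nonneg le_rfl _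
  · exact Real.rpow_le_rpow_of_exponent_le (one_le_intNorm hx) (by linarith)

theorem alphaExp_pos {n m : ℕ} (hn : 0 < n) (hm : 0 < m) (Θ : Matrix (Fin n) (Fin m) ℝ) :
    0 < alphaExp n m Θ := by
  have hn' : (0 : ℝ) < n := by exact_mod_cast hn
  have hγ : (0 : ℝ) < 1 / (2 * n) := by positivity
  refine (ENNReal.ofReal_pos.2 hγ).trans_le (le_sSup ⟨_, ⟨hγ, ?_⟩, rfl⟩)
  filter_upwards [eventually_gt_atTop 1] with t ht
  have ht0 : 0 < t := by linarith
  let A : Matrix (Fin m ⊕ Fin n) (Fin m ⊕ Fin n) ℝ := Matrix.fromBlocks 1 0 Θ (-1)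
  set s : ℝ := t ^ (-(1 / (2 * n)) : ℝ) with hs
  have hs0 : 0 < s := Real.rpow_pos_of_pos ht0 _
  have hs1 : s ≤ 1 := Real.rpow_le_one_of_one_le_of_nonpos ht.le (by linarith)
  have hA : |A.det| = 1 := by simp [A, Matrix.det_neg]
  have hprod : 1 < t ^ m * s ^ n := by
    rw [hs, ← Real.rpow_natCast, ← Real.rpow_natCast, ← Real.rpow_mul ht0.le,
      ← Real.rpow_add ht0]
    have hm1 : (1 : ℝ) ≤ m := by exact_mod_cast hm
    refine Real.one_lt_rpow ht ?_
    have : -(1 / (2 * n) : ℝ) * n = -1 / 2 := by field_simp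
    rw [this]
    linarith
  obtain ⟨p, hp0, hp⟩ := exists_int_abs_mulVec_lt A (Sum.elim (fun _ => t) (fun _ => s))
    (by rintro (k | k) <;> simpa) (by rw [← abs_pos, hA]; exact one_pos)
    (by rw [hA, Fintype.prod_sum_type]; simpa using hprod)
  have hAp : A.mulVec (fun k => (p k : ℝ)) = Sum.elim (fun k => (p (Sum.inl k) : ℝ))
      (Θ.mulVec (fun k => (p (Sum.inl k) : ℝ)) - fun k => (p (Sum.inr k) : ℝ)) := by
    have : (fun k => (p k : ℝ)) = Sum.elim (fun k => (p (Sum.inl k) : ℝ))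
        (fun k => (p (Sum.inr k) : ℝ)) := by
      ext (k | k) <;> rfl
    rw [this, Matrix.fromBlocks_mulVec]
    simp [Matrix.neg_mulVec, sub_eq_add_neg]
  rw [hAp] at hp
  refine ⟨fun k => p (Sum.inl k), fun k => p (Sum.inr k), fun h0 => hp0 ?_, ?_, ?_⟩
  · have h1 : ∀ k, p (Sum.inl k) = 0 := congrFun h0
    ext (k | k)
    · exact h1 k
    · have := (hp (Sum.inr k)).trans_le hs1
      simp only [h1, Int.cast_zero, Sum.elim_inr, Pi.sub_apply] at this
      rw [show (fun _ : Fin m => (0 : ℝ)) = 0 from rfl, Matrix.mulVec_zero, Pi.zero_apply,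
        zero_sub, abs_neg] at this
      exact Int.abs_lt_one_iff.1 (by exact_mod_cast this)
  · exact (pi_norm_le_iff_of_nonneg ht0.le).2 fun k => (hp (Sum.inl k)).le
  · exact (pi_norm_le_iff_of_nonneg hs0.le).2 fun k => (hp (Sum.inr k)).le

theorem alphaExp_le_betaExp (n m : ℕ) (Θ : Matrix (Fin n) (Fin m) ℝ) :
    alphaExp n m Θ ≤ betaExp n m Θ := by
  refine sSup_le_sSup (Set.image_mono ?_)
  rintro γ ⟨hγ0, hγ⟩
  refine ⟨hγ0, indivApprox_of_forall_exists fun δ hδ => ?_⟩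
  obtain ⟨t, ⟨x, y, hx, hxt, hxy⟩, ht⟩ :=
    (hγ.and ((tendsto_rpow_neg_atTop hγ0).eventually_le_const hδ)).exists
  exact ⟨x, y, hx, hxy.trans ht, hxy.trans (Real.rpow_le_rpow_of_nonpos
    (one_pos.trans_le (one_le_intNorm hx)) hxt (by linarith))⟩

/-- Among good approximations there are arbitrarily large minimal points: every strictly smaller
nonzero integer vector has strictly larger error. -/
theorem exists_minimal_approx {n m : ℕ} {Θ : Matrix (Fin n) (Fin m) ℝ}
    (hpos : ∀ (x : Fin m → ℤ) (y : Fin n → ℤ), x ≠ 0 → 0 < approxErr Θ x y) {b : ℝ} (hb : 0 < b)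
    (h : IndivApprox n m Θ (fun t => t ^ (-b))) (T : ℝ) :
    ∃ (x : Fin m → ℤ) (y : Fin n → ℤ), x ≠ 0 ∧ T < intNorm x ∧
      approxErr Θ x y ≤ intNorm x ^ (-b) ∧
      ∀ (x' : Fin m → ℤ) (y' : Fin n → ℤ), x' ≠ 0 → intNorm x' < intNorm x →
        approxErr Θ x y < approxErr Θ x' y' := by
  obtain ⟨δ, hδ, hlt⟩ := ((finite_bounded_pairs Θ T 1).subset
    (Set.sep_subset _ fun p => p.1 ≠ 0)).exists_pos_lt
    (f := fun p => approxErr Θ p.1 p.2) fun p hp => hpos p.1 p.2 hp.2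
  obtain ⟨T', hT', hT'1⟩ := (((tendsto_rpow_neg_atTop hb).eventually_le_const
    (lt_min hδ one_pos)).and (eventually_ge_atTop 1)).exists
  obtain ⟨⟨x₀, y₀⟩, hp, hpT⟩ := (h.sdiff (finite_bounded_pairs Θ T' 1)).nonempty
  simp only [Set.mem_ofPred_eq, not_and] at hp hpT
  have hx₀T : T' < intNorm x₀ := by
    by_contra! hle
    refine hpT hle (hp.trans ?_)
    by_cases hx : x₀ = 0
    · simp only [hx, Pi.zero_apply, Int.cast_zero]
      rw [show (fun _ : Fin m => (0 : ℝ)) = 0 from rfl, norm_zero,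
        Real.zero_rpow (neg_ne_zero.2 hb.ne')]
      exact zero_le_one
    · exact Real.rpow_le_one_of_one_le_of_nonpos (one_le_intNorm hx) (by linarith)
  have hx₀ : x₀ ≠ 0 := by
    rintro rfl
    have : intNorm (0 : Fin m → ℤ) = 0 := by simp [intNorm, ← Pi.zero_def]
    linarith
  obtain ⟨x, ⟨⟨hxle, hx, y, hy⟩, hmin⟩⟩ := Set.exists_min_image
    {x : Fin m → ℤ | intNorm x ≤ intNorm x₀ ∧ x ≠ 0 ∧
      ∃ y : Fin n → ℤ, approxErr Θ x y ≤ intNorm x₀ ^ (-b)} intNorm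
    ((finite_intNorm_le m _).subset fun x hx => hx.1) ⟨x₀, le_rfl, hx₀, y₀, hp⟩
  have hyδ : approxErr Θ x y ≤ min δ 1 :=
    (hy.trans (Real.rpow_le_rpow_of_nonpos (by linarith) hx₀T.le (by linarith))).trans hT'
  refine ⟨x, y, hx, ?_, hy.trans (Real.rpow_le_rpow_of_nonpos
    (one_pos.trans_le (one_le_intNorm hx)) hxle (by linarith)), fun x' y' hx' hlt_x => ?_⟩
  · by_contra! hle
    exact (hlt (x, y) ⟨⟨hle, hyδ.trans (min_le_right _ _)⟩, hx⟩).not_ge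
      (hyδ.trans (min_le_left _ _))
  · by_contra! hle
    exact (hmin x' ⟨hlt_x.le.trans hxle, hx', y', hle.trans hy⟩).not_gt hlt_x

/-- The exponents of the box sides used for the transposed system, and the margins they leave. -/
theorem box_exponent_bounds {n m α β γ ε a b d : ℝ} (hn : 1 ≤ n) (hd : 0 < d)
    (hdef : d = m + n - 2) (ha : a = α - ε) (hb : |b - β| ≤ ε)
    (h₁ : ε * (1 + γ + |(m - 1) * γ - (n - 1)|) ≤
      (((n - 1) * (1 + β) - (1 - α)) - γ * ((m - 1) * (1 + β) + (1 - α))) / 2)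
    (h₂ : ε * n ≤ ((n - 1) * (1 + β) - (1 - α)) / 2) :
    (1 - a - (n - 1) * (1 + b)) / d ≤ -(((n - 1) * (1 + β) - (1 - α)) / (2 * d)) ∧
    (1 - a - (n - 1) * (1 + b)) / d + ((1 - a - (n - 1) * (1 + b)) / d + 1 + b) * γ ≤
      -((((n - 1) * (1 + β) - (1 - α)) - γ * ((m - 1) * (1 + β) + (1 - α))) / (2 * d)) := by
  obtain ⟨hb₁, hb₂⟩ := abs_le.1 hb
  constructor
  · rw [← neg_div, div_le_div_iff₀ hd (by positivity), ha]
    have : (n - 1) * (β - b) ≤ (n - 1) * ε :=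
      mul_le_mul_of_nonneg_left (by linarith) (by linarith)
    have h : 2 * (1 - (α - ε) - (n - 1) * (1 + b)) ≤ -((n - 1) * (1 + β) - (1 - α)) := by
      linarith
    have := mul_le_mul_of_nonneg_right h hd.le
    linarith
  · have hcross : (b - β) * ((m - 1) * γ - (n - 1)) ≤ ε * |(m - 1) * γ - (n - 1)| := by
      refine (le_abs_self _).trans ?_
      rw [abs_mul]
      exact mul_le_mul_of_nonneg_right hb (abs_nonneg _)
    have heq : (1 - a - (n - 1) * (1 + b)) / d + ((1 - a - (n - 1) * (1 + b)) / d + 1 + b) * γ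
        = ((1 - a) * (1 + γ) + (1 + b) * ((m - 1) * γ - (n - 1))) / d := by
      field_simp
      rw [hdef]
      ring
    rw [heq, ← neg_div, div_le_div_iff₀ hd (by positivity), ha]
    have h : 2 * ((1 - (α - ε)) * (1 + γ) + (1 + b) * ((m - 1) * γ - (n - 1))) ≤
        -(((n - 1) * (1 + β) - (1 - α)) - γ * ((m - 1) * (1 + β) + (1 - α))) := by
      linarith
    have := mul_le_mul_of_nonneg_right h hd.le
    linarith

set_option maxHeartbeats 800000 in
/-- The transference inequality at the level of a single exponent `γ`. -/
theorem indivApprox_transpose {n m : ℕ} (hn : 0 < n) (hm : 0 < m) (hnm : ¬(n = 1 ∧ m = 1))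
    {Θ : Matrix (Fin n) (Fin m) ℝ} {α β γ : ℝ}
    (hpos : ∀ (x : Fin m → ℤ) (y : Fin n → ℤ), x ≠ 0 → 0 < approxErr Θ x y)
    (hα0 : 0 < α) (hβ0 : 0 < β) (hγ : 0 < γ)
    (hα : ∀ a, 0 < a → a < α → UniformlyApprox n m Θ (fun t => t ^ (-a)))
    (hβ : ∀ b, 0 < b → b < β → IndivApprox n m Θ (fun t => t ^ (-b)))
    (hβ' : ∀ b, β < b → ¬ IndivApprox n m Θ (fun t => t ^ (-b)))
    (hN : 0 < ((n : ℝ) - 1) * (1 + β) - (1 - α))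
    (hγN : γ * (((m : ℝ) - 1) * (1 + β) + (1 - α)) < ((n : ℝ) - 1) * (1 + β) - (1 - α)) :
    IndivApprox m n Θ.transpose (fun t => t ^ (-γ)) := by
  have hn1 : (1 : ℝ) ≤ n := by exact_mod_cast hn
  have hm1 : (1 : ℝ) ≤ m := by exact_mod_cast hm
  set N : ℝ := ((n : ℝ) - 1) * (1 + β) - (1 - α) with hNdef
  set G : ℝ := N - γ * (((m : ℝ) - 1) * (1 + β) + (1 - α)) with hGdef
  have hG : 0 < G := by linarith
  obtain ⟨ε, hε, hεα, hεβ, h₁, h₂⟩ : ∃ ε > 0, ε < α ∧ ε < β ∧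
      ε * (1 + γ + |((m : ℝ) - 1) * γ - (n - 1)|) ≤ G / 2 ∧ ε * n ≤ N / 2 := by
    have hc : 0 < 1 + γ + |((m : ℝ) - 1) * γ - (n - 1)| := by positivity
    have hev : ∀ᶠ ε in nhdsWithin (0 : ℝ) (Set.Ioi 0), ε < α ∧ ε < β ∧
        ε < G / 2 / (1 + γ + |((m : ℝ) - 1) * γ - (n - 1)|) ∧ ε < N / 2 / n :=
      Filter.Eventually.filter_mono nhdsWithin_le_nhds
        ((eventually_lt_nhds hα0).and ((eventually_lt_nhds hβ0).and
          ((eventually_lt_nhds (by positivity)).and (eventually_lt_nhds (by positivity)))))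
    obtain ⟨ε, ⟨e₁, e₂, e₃, e₄⟩, e₀⟩ := (hev.and self_mem_nhdsWithin).exists
    exact ⟨ε, e₀, e₁, e₂, ((lt_div_iff₀ hc).1 e₃).le, ((lt_div_iff₀ (by positivity)).1 e₄).le⟩
  obtain ⟨D, hD⟩ : ∃ D : ℕ, D = (m - 1) + (n - 1) := ⟨_, rfl⟩
  have hD0 : D ≠ 0 := by omega
  set d : ℝ := (D : ℝ) with hd
  have hdpos : 0 < d := by positivity
  have hmcast : ((m - 1 : ℕ) : ℝ) = m - 1 := by rw [Nat.cast_sub hm, Nat.cast_one]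
  have hncast : ((n - 1 : ℕ) : ℝ) = n - 1 := by rw [Nat.cast_sub hn, Nat.cast_one]
  have hdef : d = m + n - 2 := by
    rw [hd, hD, Nat.cast_add, hmcast, hncast]; ring
  obtain ⟨a, ha⟩ : ∃ a, a = α - ε := ⟨_, rfl⟩
  obtain ⟨κ, hκ⟩ : ∃ κ : ℝ, κ = (3 * 2 ^ a) ^ ((D : ℝ)⁻¹) := ⟨_, rfl⟩
  have hκ0 : 0 < κ := hκ ▸ Real.rpow_pos_of_pos (by positivity) _
  have hκD : κ ^ D = 3 * 2 ^ a := by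
    rw [hκ]; exact Real.rpow_inv_natCast_pow (by positivity) hD0
  obtain ⟨C, hC⟩ : ∃ C : ℝ, C = 4 * ((n : ℝ) + m) * κ := ⟨_, rfl⟩
  have hC0 : 0 < C := by rw [hC]; positivity
  refine indivApprox_of_forall_exists fun δ hδ => ?_
  have hfin := Set.not_infinite.1 (hβ' (β + ε) (by linarith))
  have hev : ∀ᶠ X : ℝ in atTop, 2 ≤ X ∧
      (∃ (x : Fin m → ℤ) (y : Fin n → ℤ), x ≠ 0 ∧ intNorm x ≤ X / 2 ∧
        approxErr Θ x y ≤ (X / 2) ^ (-a)) ∧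
      (∀ p ∈ {p : (Fin m → ℤ) × (Fin n → ℤ) |
        approxErr Θ p.1 p.2 ≤ intNorm p.1 ^ (-(β + ε))}, intNorm p.1 < X) ∧
      X ^ (-(N / (2 * d))) < min δ 1 / C ∧ X ^ (-(G / (2 * d))) < 1 / (C * C ^ γ) := by
    refine (eventually_ge_atTop 2).and ?_
    refine ((tendsto_id.atTop_div_const two_pos).eventually
      (hα a (by linarith) (by linarith))).and ?_
    refine ((Filter.eventually_all_finite hfin).2 fun p _ => eventually_gt_atTop _).and ?_
    exact ((tendsto_rpow_neg_atTop (by positivity)).eventually_lt_const (by positivity)).and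
      ((tendsto_rpow_neg_atTop (by positivity)).eventually_lt_const (by positivity))
  obtain ⟨T, hT⟩ := Filter.eventually_atTop.1 hev
  obtain ⟨x₂, y₂, hx₂, hTx, hy₂, hmin⟩ :=
    exists_minimal_approx hpos (b := β - ε) (by linarith) (hβ _ (by linarith) (by linarith)) T
  obtain ⟨X, hX⟩ : ∃ X, X = intNorm x₂ := ⟨_, rfl⟩
  obtain ⟨Y, hY⟩ : ∃ Y, Y = approxErr Θ x₂ y₂ := ⟨_, rfl⟩
  have hY0 : 0 < Y := hY ▸ hpos x₂ y₂ hx₂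
  rw [← hX] at hTx hy₂ hmin
  rw [← hY] at hy₂ hmin
  obtain ⟨hX2, ⟨x₁, y₁, hx₁, hx₁X, hy₁⟩, hlarge, hXδ, hX1⟩ := hT X hTx.le
  have hX1' : 1 < X := by linarith
  have hX0 : 0 < X := by linarith
  obtain ⟨b, hb⟩ : ∃ b, b = -Real.logb X Y := ⟨_, rfl⟩
  have hYb : Y = X ^ (-b) := by
    rw [hb, neg_neg, Real.rpow_logb hX0 hX1'.ne' hY0]
  have hbβ : |b - β| ≤ ε := by
    rw [abs_le]
    constructor
    · rw [hYb, Real.rpow_le_rpow_left_iff hX1'] at hy₂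
      linarith
    · by_contra! hlt
      refine (hlarge (x₂, y₂) ?_).ne hX.symm
      rw [Set.mem_ofPred_eq, ← hX, ← hY, hYb]
      exact Real.rpow_le_rpow_of_exponent_le hX1'.le (by linarith)
  obtain ⟨e₁, e₂⟩ := box_exponent_bounds hn1 hdpos hdef ha hbβ h₁ h₂
  rw [← hNdef] at e₁ e₂
  rw [← hGdef] at e₂
  obtain ⟨e, he⟩ : ∃ e, e = (1 - a - ((n : ℝ) - 1) * (1 + b)) / d := ⟨_, rfl⟩
  rw [← he] at e₁ e₂
  have hYle : Y ≤ approxErr Θ x₁ y₁ := (hmin x₁ y₁ hx₁ (by linarith)).le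
  have hvol : 2 * (X * approxErr Θ x₁ y₁) <
      (κ * X ^ e) ^ (m - 1) * (κ * X ^ (e + 1 + b)) ^ (n - 1) := by
    have hrhs : (κ * X ^ e) ^ (m - 1) * (κ * X ^ (e + 1 + b)) ^ (n - 1)
        = 3 * 2 ^ a * (X * X ^ (-a)) := by
      calc _ = κ ^ D * ((X ^ e) ^ (m - 1) * (X ^ (e + 1 + b)) ^ (n - 1)) := by
            rw [hD, mul_pow, mul_pow, pow_add]; ring
        _ = 3 * 2 ^ a * X ^ (1 + -a) := by
            rw [hκD, ← Real.rpow_mul_natCast hX0.le, ← Real.rpow_mul_natCast hX0.le,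
              ← Real.rpow_add hX0, hmcast, hncast]
            congr 2
            have : e * d = 1 - a - ((n : ℝ) - 1) * (1 + b) := by
              rw [he]; field_simp
            rw [hdef] at this
            linarith
        _ = _ := by rw [Real.rpow_add hX0, Real.rpow_one]
    have hy : approxErr Θ x₁ y₁ ≤ 2 ^ a * X ^ (-a) := by
      refine hy₁.trans_eq ?_
      rw [Real.div_rpow hX0.le two_pos.le, Real.rpow_neg two_pos.le, div_inv_eq_mul, mul_comm]
    rw [hrhs]
    have h2a : (0 : ℝ) < 2 ^ a := by positivity
    have hXa : 0 < X ^ (-a) := Real.rpow_pos_of_pos hX0 _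
    have := mul_le_mul_of_nonneg_left hy hX0.le
    have : 0 < 2 ^ a * (X * X ^ (-a)) := by positivity
    linarith
  have hXe : 0 < X ^ e := Real.rpow_pos_of_pos hX0 _
  have hXeb : 0 < X ^ (e + 1 + b) := Real.rpow_pos_of_pos hX0 _
  obtain ⟨z, w, hzw, hzle, hwle⟩ := exists_transpose_approx_of_two_points hn hm Θ x₁ x₂ y₁ y₂
    rfl hX.symm rfl hY.symm hx₁X hYle hX0 hY0 (mul_pos hκ0 hXe) (mul_pos hκ0 hXeb)
    (by
      rw [hYb, mul_left_comm, mul_left_comm _ κ, ← Real.rpow_add hX0]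
      congr 1
      rw [show -b + (e + 1 + b) = 1 + e by ring, Real.rpow_add hX0, Real.rpow_one]) hvol
  have hzC : intNorm z ≤ C * X ^ (e + 1 + b) := by
    rw [hC]; convert hzle using 1; ring
  have hwC : approxErr Θ.transpose z w ≤ C * X ^ e := by
    rw [hC]; convert hwle using 1; ring
  have hCδ : C * X ^ e < min δ 1 := by
    rw [lt_div_iff₀ hC0] at hXδ
    refine lt_of_le_of_lt ?_ hXδ
    rw [mul_comm]
    exact mul_le_mul_of_nonneg_right (Real.rpow_le_rpow_of_exponent_le hX1'.le e₁) hC0.le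
  have hz : z ≠ 0 := by
    rintro rfl
    have hw : w ≠ 0 := by simpa using hzw
    have h0 : approxErr Θ.transpose 0 w = intNorm w := by
      simp only [approxErr, Pi.zero_apply, Int.cast_zero]
      rw [show (fun _ : Fin n => (0 : ℝ)) = 0 from rfl, Matrix.mulVec_zero, zero_sub, norm_neg]
    have := one_le_intNorm hw
    have := min_le_right δ 1
    linarith
  refine ⟨z, w, hz, hwC.trans (hCδ.le.trans (min_le_left _ _)), hwC.trans ?_⟩
  have hzpos : 0 < intNorm z := one_pos.trans_le (one_le_intNorm hz)
  refine le_trans ?_ (Real.rpow_le_rpow_of_nonpos hzpos hzC (by linarith))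
  rw [Real.rpow_neg (by positivity), le_inv_comm₀ (by positivity) (by positivity),
    Real.mul_rpow hC0.le hXeb.le, ← Real.rpow_mul hX0.le, ← one_div, le_div_iff₀ (by positivity)]
  have hCC : 0 < C * C ^ γ := by positivity
  calc C ^ γ * X ^ ((e + 1 + b) * γ) * (C * X ^ e)
      = C * C ^ γ * X ^ (e + (e + 1 + b) * γ) := by rw [Real.rpow_add hX0]; ring
    _ ≤ C * C ^ γ * X ^ (-(G / (2 * d))) := by
        gcongr
        exact hX1'.le
    _ ≤ 1 := by
        rw [lt_div_iff₀ hCC] at hX1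
        linarith

/-- Inequality (2) of German's Theorem 3: a refinement of Dyson's transference
inequality taking the uniform exponent into account. Here `α(Θ), β(Θ) < ∞`, the
numerator and denominator are computed in `ℝ` and the quotient is taken in `ℝ≥0∞`
(so that `a/0 = +∞` for `a > 0`). -/
theorem individual_exponent_transference_two (n m : ℕ) (hn : 0 < n) (hm : 0 < m)
    (hnm : ¬(n = 1 ∧ m = 1)) (Θ : Matrix (Fin n) (Fin m) ℝ)
    (hα : alphaExp n m Θ ≠ ⊤) (hβ : betaExp n m Θ ≠ ⊤) :
    ENNReal.ofReal
        (((n : ℝ) - 1) * (1 + (betaExp n m Θ).toReal) - (1 - (alphaExp n m Θ).toReal)) /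
      ENNReal.ofReal
        (((m : ℝ) - 1) * (1 + (betaExp n m Θ).toReal) + (1 - (alphaExp n m Θ).toReal)) ≤
      betaExp m n Θ.transpose := by
  have hα0 : 0 < (alphaExp n m Θ).toReal := ENNReal.toReal_pos (alphaExp_pos hn hm Θ).ne' hα
  have hβ0 : 0 < (betaExp n m Θ).toReal :=
    hα0.trans_le (ENNReal.toReal_mono hβ (alphaExp_le_betaExp n m Θ))
  have hβ' : ∀ b, (betaExp n m Θ).toReal < b → ¬ IndivApprox n m Θ (fun t => t ^ (-b)) := by
    intro b hb hI
    have h : ENNReal.ofReal b ≤ betaExp n m Θ := le_sSup ⟨b, ⟨hβ0.trans hb, hI⟩, rfl⟩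
    exact hb.not_ge ((ENNReal.ofReal_le_iff_le_toReal hβ).1 h)
  have key := fun (γ : ℝ) (hγ : 0 < γ) => indivApprox_transpose hn hm hnm (approxErr_pos hα)
    hα0 hβ0 hγ
    (fun a _ h => uniformlyApprox_of_lt ((ENNReal.ofReal_lt_iff_lt_toReal (by linarith) hα).2 h))
    (fun b _ h => indivApprox_of_lt ((ENNReal.ofReal_lt_iff_lt_toReal (by linarith) hβ).2 h)) hβ'
  set N : ℝ := ((n : ℝ) - 1) * (1 + (betaExp n m Θ).toReal) - (1 - (alphaExp n m Θ).toReal)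
  set D : ℝ := ((m : ℝ) - 1) * (1 + (betaExp n m Θ).toReal) + (1 - (alphaExp n m Θ).toReal)
  rcases le_or_gt N 0 with hN | hN
  · rw [ENNReal.ofReal_of_nonpos hN, ENNReal.zero_div]
    exact zero_le
  by_contra! hlt
  obtain ⟨r, hr₁, hr₂⟩ := ENNReal.lt_iff_exists_nnreal_btwn.1 hlt
  have hr0 : 0 < (r : ℝ) := by
    exact_mod_cast (zero_le (a := betaExp m n Θ.transpose)).trans_lt hr₁
  refine hr₁.not_ge ?_
  rw [← ENNReal.ofReal_coe_nnreal]
  refine le_sSup ⟨r, ⟨hr0, key r hr0 hN ?_⟩, rfl⟩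
  rcases le_or_gt D 0 with hD | hD
  · exact (mul_nonpos_of_nonneg_of_nonpos hr0.le hD).trans_lt hN
  · rw [← ENNReal.ofReal_div_of_pos hD, ← ENNReal.ofReal_coe_nnreal,
      ENNReal.ofReal_lt_ofReal_iff (by positivity), lt_div_iff₀ hD] at hr₂
    exact hr₂
end
end
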